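/- arXiv:1809.03223 — 2 statements merged into one kernel-verified Lean document; each statement's English description precedes it below -/
import Mathlib

section
/- In U^♮_χ define B_{n−1} := E_n and, descending, B_i := ⌊E_{N−i−1},⌊B_{i+1},E_{i+1}⌋⌋ for i = n−2,…,1,0; define B_{−1} := ⌊E_N,⌊B_0,E_0⌋⌋, A_0 := B_{−1}, and A_i := ⌊E_{N−i},⌊A_{i−1},E_i⌋⌋ for i = 1,…,n−1 (all q-brackets ⌊·,·⌋ computed with the degrees inherited from the letters E_j). Define scalars a_0 := 1 and a_i := a_{i−1}·χ(δ̂,α_{N−i})·χ(−α_i, Σ_{t=i+1}^{N−i−1}α_t)·χ(Σ_{t=i}^{N−i−1}α_t, −α_{N−i}) for i = 1,…,n−1, where δ̂ := α_0 + 2Σ_{t=1}^{N−1}α_t + α_N ∈ ⊕ℤα_i. Set Z := Σ_{i=0}^{n−1} a_i ⌊A_i,B_i⌋ (a homogeneous element of degree δ̂). Then for every i ∈ I: Z·F_i − F_i·Z = 0 and Z·E_i − χ(α_i, δ̂)^{−1} E_i·Z = 0 in U^♮_χ. -/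
/-- Generators of the quantum superalgebra. -/
inductive QGen (Λ I : Type) : Type
  | Kg : Λ → QGen Λ I
  | Lg : Λ → QGen Λ I
  | Eg : I → QGen Λ I
  | Fg : I → QGen Λ I

/-- The lattice `V̂ = (⊕_{i∈I} ℤα_i) ⊕ ℤ∂` for `I = {0,…,N}`, `N = 2n`. -/
abbrev Lam (n : ℕ) : Type := (Fin (2 * n + 1) → ℤ) × ℤ

/-- The simple roots `α_i` as elements of `V̂`. -/
def αr (n : ℕ) (i : Fin (2 * n + 1)) : Lam n := (Pi.single i 1, 0)

/-- The element `∂` of `V̂`. -/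
def dr (n : ℕ) : Lam n := (0, 1)

/-- `α` reindexed by `ℕ` (with junk value `0` out of range). -/
def αn (n : ℕ) (t : ℕ) : Lam n := if h : t < 2 * n + 1 then αr n ⟨t, h⟩ else 0

/-- `δ̂ = α_0 + 2Σ_{t=1}^{N−1} α_t + α_N`. -/
def hatδ (n : ℕ) : Lam n :=
  αn n 0 + (2 : ℤ) • (∑ t ∈ Finset.Icc 1 (2 * n - 1), αn n t) + αn n (2 * n)

/-- `ε`-coordinates of `α_i` : `α_0 = δ̂ − 2ε_1`, `α_i = ε_i − ε_{i+1}`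
(`1 ≤ i ≤ N−1`), `α_N = 2ε_N` (`ε`-indices 0-based). -/
def wVec (n : ℕ) (i : ℕ) : Fin (2 * n) → ℤ := fun t =>
  if i = 0 then (if (t : ℕ) = 0 then -2 else 0)
  else if i = 2 * n then (if (t : ℕ) = 2 * n - 1 then 2 else 0)
  else (if (t : ℕ) = i - 1 then 1 else 0) - (if (t : ℕ) = i then 1 else 0)

/-- The bilinear-form values `(α_i, α_j)`, from `(ε_s,ε_t) = δ_{st} d̄_s`,
`d̄_s = 1` for `s ≤ n` and `−1` otherwise. -/
def Bfm (n : ℕ) (i j : ℕ) : ℤ :=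
  ∑ t : Fin (2 * n), (if (t : ℕ) < n then 1 else -1) * wVec n i t * wVec n j t

/-- `(ε_1, α_i)`. -/
def eps1dot (n : ℕ) (i : ℕ) : ℤ :=
  ∑ t : Fin (2 * n), (if (t : ℕ) < n then 1 else -1)
    * (if (t : ℕ) = 0 then 1 else 0) * wVec n i t

section Defs

variable (K : Type) [Field K] (n : ℕ)

/-- The free algebra on the generators. -/
abbrev FA : Type := FreeAlgebra K (QGen (Lam n) (Fin (2 * n + 1)))

def fK (a : Lam n) : FA K n := FreeAlgebra.ι K (QGen.Kg a)
def fL (a : Lam n) : FA K n := FreeAlgebra.ι K (QGen.Lg a)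
def fE (i : Fin (2 * n + 1)) : FA K n := FreeAlgebra.ι K (QGen.Eg i)
def fF (i : Fin (2 * n + 1)) : FA K n := FreeAlgebra.ι K (QGen.Fg i)

variable (χ : Lam n → Lam n → Kˣ)

/-- The `q`-bracket `⌊X,Y⌋ = XY − χ(μ,λ)⁻¹ YX` for `X` of degree `λ`, `Y` of
degree `μ` (free-algebra version, `E`-side). -/
def fbrE (lam mu : Lam n) (X Y : FA K n) : FA K n :=
  X * Y - ((((χ mu lam)⁻¹ : Kˣ) : K)) • (Y * X)

/-- The corresponding bracket on the `F`-side: the coefficient `χ(μ,λ)⁻¹` is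
replaced by `χ(λ,μ)⁻¹`. -/
def fbrF (lam mu : Lam n) (X Y : FA K n) : FA K n :=
  X * Y - ((((χ lam mu)⁻¹ : Kˣ) : K)) • (Y * X)

/-- The defining relations of the quantum affine superalgebra `U^♮_χ` of
`sl^{(2)}(2n|2n)`: the relations of `Ũ_χ` together with the Serre-type
relations for the `E_i` and the `F_i`. -/
inductive NRel : FA K n → FA K n → Prop
  | K0 : NRel (fK K n 0) 1
  | L0 : NRel (fL K n 0) 1
  | KK (a b : Lam n) : NRel (fK K n a * fK K n b) (fK K n (a + b))
  | LL (a b : Lam n) : NRel (fL K n a * fL K n b) (fL K n (a + b))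
  | KL (a b : Lam n) : NRel (fK K n a * fL K n b) (fL K n b * fK K n a)
  | KE (a : Lam n) (i : Fin (2 * n + 1)) :
      NRel (fK K n a * fE K n i) ((χ a (αr n i) : K) • (fE K n i * fK K n a))
  | KF (a : Lam n) (i : Fin (2 * n + 1)) :
      NRel (fK K n a * fF K n i) ((((χ a (αr n i))⁻¹ : Kˣ) : K) • (fF K n i * fK K n a))
  | LE (a : Lam n) (i : Fin (2 * n + 1)) :
      NRel (fL K n a * fE K n i) ((((χ (αr n i) a)⁻¹ : Kˣ) : K) • (fE K n i * fL K n a))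
  | LF (a : Lam n) (i : Fin (2 * n + 1)) :
      NRel (fL K n a * fF K n i) ((χ (αr n i) a : K) • (fF K n i * fL K n a))
  | EFsame (i : Fin (2 * n + 1)) :
      NRel (fE K n i * fF K n i - fF K n i * fE K n i) (-fK K n (αr n i) + fL K n (αr n i))
  | EFne (i j : Fin (2 * n + 1)) (h : i ≠ j) :
      NRel (fE K n i * fF K n j - fF K n j * fE K n i) 0
  | SE1 (i j : Fin (2 * n + 1)) (h : Bfm n i j = 0) :
      NRel (fbrE K n χ (αr n i) (αr n j) (fE K n i) (fE K n j)) 0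
  | SE2 (i j : Fin (2 * n + 1)) (hne : i ≠ j) (h1 : -(2 * Bfm n i j) = Bfm n i i)
      (h2 : Bfm n i i ≠ 0) :
      NRel (fbrE K n χ (αr n i) (αr n i + αr n j) (fE K n i)
        (fbrE K n χ (αr n i) (αr n j) (fE K n i) (fE K n j))) 0
  | SE3 (i j : Fin (2 * n + 1)) (hne : i ≠ j) (h1 : -(Bfm n i j) = Bfm n i i)
      (h2 : Bfm n i i ≠ 0) :
      NRel (fbrE K n χ (αr n i) (αr n i + (αr n i + αr n j)) (fE K n i)
        (fbrE K n χ (αr n i) (αr n i + αr n j) (fE K n i)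
          (fbrE K n χ (αr n i) (αr n j) (fE K n i) (fE K n j)))) 0
  | SE4 (i j k : Fin (2 * n + 1)) (h1 : i ≠ j) (h2 : j ≠ k) (h3 : k ≠ i)
      (h4 : Bfm n i i = 0) (h5 : Bfm n j k = 0)
      (h6 : -(Bfm n i j) = Bfm n i k) (h7 : Bfm n i k ≠ 0) :
      NRel (fbrE K n χ (αr n i + αr n j) (αr n i + αr n k)
        (fbrE K n χ (αr n i) (αr n j) (fE K n i) (fE K n j))
        (fbrE K n χ (αr n i) (αr n k) (fE K n i) (fE K n k))) 0
  | SF1 (i j : Fin (2 * n + 1)) (h : Bfm n i j = 0) :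
      NRel (fbrF K n χ (αr n i) (αr n j) (fF K n i) (fF K n j)) 0
  | SF2 (i j : Fin (2 * n + 1)) (hne : i ≠ j) (h1 : -(2 * Bfm n i j) = Bfm n i i)
      (h2 : Bfm n i i ≠ 0) :
      NRel (fbrF K n χ (αr n i) (αr n i + αr n j) (fF K n i)
        (fbrF K n χ (αr n i) (αr n j) (fF K n i) (fF K n j))) 0
  | SF3 (i j : Fin (2 * n + 1)) (hne : i ≠ j) (h1 : -(Bfm n i j) = Bfm n i i)
      (h2 : Bfm n i i ≠ 0) :
      NRel (fbrF K n χ (αr n i) (αr n i + (αr n i + αr n j)) (fF K n i)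
        (fbrF K n χ (αr n i) (αr n i + αr n j) (fF K n i)
          (fbrF K n χ (αr n i) (αr n j) (fF K n i) (fF K n j)))) 0
  | SF4 (i j k : Fin (2 * n + 1)) (h1 : i ≠ j) (h2 : j ≠ k) (h3 : k ≠ i)
      (h4 : Bfm n i i = 0) (h5 : Bfm n j k = 0)
      (h6 : -(Bfm n i j) = Bfm n i k) (h7 : Bfm n i k ≠ 0) :
      NRel (fbrF K n χ (αr n i + αr n j) (αr n i + αr n k)
        (fbrF K n χ (αr n i) (αr n j) (fF K n i) (fF K n j))
        (fbrF K n χ (αr n i) (αr n k) (fF K n i) (fF K n k))) 0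

/-- The quantum affine superalgebra `U^♮_χ` of `sl^{(2)}(2n|2n)`. -/
abbrev Unat : Type := RingQuot (NRel K n χ)

def uK (a : Lam n) : Unat K n χ := RingQuot.mkAlgHom K (NRel K n χ) (fK K n a)
def uL (a : Lam n) : Unat K n χ := RingQuot.mkAlgHom K (NRel K n χ) (fL K n a)
def uE (i : Fin (2 * n + 1)) : Unat K n χ := RingQuot.mkAlgHom K (NRel K n χ) (fE K n i)
def uF (i : Fin (2 * n + 1)) : Unat K n χ := RingQuot.mkAlgHom K (NRel K n χ) (fF K n i)

/-- `E` reindexed by `ℕ` (junk value `0` out of range). -/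
def uEn (t : ℕ) : Unat K n χ := if h : t < 2 * n + 1 then uE K n χ ⟨t, h⟩ else 0

/-- The `q`-bracket in `U^♮_χ` (for `X` of degree `λ` and `Y` of degree `μ`). -/
def ubrE (lam mu : Lam n) (X Y : Unat K n χ) : Unat K n χ :=
  X * Y - ((((χ mu lam)⁻¹ : Kˣ) : K)) • (Y * X)

/-- `deg B_i = Σ_{t=i+1}^{N−i−1} α_t`. -/
def degB (i : ℕ) : Lam n := ∑ t ∈ Finset.Icc (i + 1) (2 * n - i - 1), αn n t

/-- `C j := B_{n−1−j}` : `C 0 = E_n`,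
`C (j+1) = ⌊E_{n+j+1}, ⌊C j, E_{n−1−j}⌋⌋`. -/
def Cseq : ℕ → Unat K n χ
  | 0 => uEn K n χ n
  | j + 1 =>
      ubrE K n χ (αn n (n + j + 1)) (degB n (n - 1 - j) + αn n (n - 1 - j))
        (uEn K n χ (n + j + 1))
        (ubrE K n χ (degB n (n - 1 - j)) (αn n (n - 1 - j)) (Cseq j) (uEn K n χ (n - 1 - j)))

/-- `B_i` (for `i ∈ {0,…,n−1}`): `B_{n−1} = E_n`,
`B_i = ⌊E_{N−i−1}, ⌊B_{i+1}, E_{i+1}⌋⌋`. -/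
def Bseq (i : ℕ) : Unat K n χ := Cseq K n χ (n - 1 - i)

/-- `B_{−1} := ⌊E_N, ⌊B_0, E_0⌋⌋`. -/
def Bm1 : Unat K n χ :=
  ubrE K n χ (αn n (2 * n)) (degB n 0 + αn n 0) (uEn K n χ (2 * n))
    (ubrE K n χ (degB n 0) (αn n 0) (Bseq K n χ 0) (uEn K n χ 0))

/-- `deg B_{−1} = α_N + Σ_{t=1}^{N−1} α_t + α_0`. -/
def degBm1 : Lam n := αn n (2 * n) + degB n 0 + αn n 0

/-- `deg A_i = deg B_{−1} + Σ_{t=1}^{i} α_t + Σ_{t=N−i}^{N−1} α_t`. -/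
def degA (i : ℕ) : Lam n :=
  degBm1 n + (∑ t ∈ Finset.Icc 1 i, αn n t)
    + ∑ t ∈ Finset.Icc (2 * n - i) (2 * n - 1), αn n t

/-- `A_0 = B_{−1}`, `A_i = ⌊E_{N−i}, ⌊A_{i−1}, E_i⌋⌋`. -/
def Aseq : ℕ → Unat K n χ
  | 0 => Bm1 K n χ
  | i + 1 =>
      ubrE K n χ (αn n (2 * n - i - 1)) (degA n i + αn n (i + 1))
        (uEn K n χ (2 * n - i - 1))
        (ubrE K n χ (degA n i) (αn n (i + 1)) (Aseq i) (uEn K n χ (i + 1)))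

/-- The scalars `a_i`. -/
def aScal : ℕ → K
  | 0 => 1
  | i + 1 =>
      aScal i * (χ (hatδ n) (αn n (2 * n - i - 1)) : K)
        * (χ (-αn n (i + 1)) (∑ t ∈ Finset.Icc (i + 2) (2 * n - i - 2), αn n t) : K)
        * (χ (∑ t ∈ Finset.Icc (i + 1) (2 * n - i - 2), αn n t) (-αn n (2 * n - i - 1)) : K)

/-- The element `Z = Σ_{i=0}^{n−1} a_i ⌊A_i, B_i⌋` of `U^♮_χ`. -/
def Zel : Unat K n χ :=
  ∑ i ∈ Finset.range n,
    aScal K n χ i • ubrE K n χ (degA n i) (degB n i) (Aseq K n χ i) (Bseq K n χ i)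

end Defs


namespace QAux

/-- sign -/
def dsg (n t : ℕ) : ℤ := if t < n then 1 else -1
def wv (n i t : ℕ) : ℤ :=
  if i = 0 then (if t = 0 then -2 else 0)
  else if i = 2 * n then (if t = 2 * n - 1 then 2 else 0)
  else (if t = i - 1 then 1 else 0) - (if t = i then 1 else 0)
def pr (n : ℕ) (f : ℕ → ℤ) (j : ℕ) : ℤ :=
  if j = 0 then -2 * f 0 else if j = 2 * n then -2 * f (2 * n - 1)
  else dsg n (j - 1) * f (j - 1) - dsg n j * f j
def cart (n i j : ℕ) : ℤ := pr n (wv n i) j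

/-- the data -/
structure QA (k A Λ : Type) [Field k] [Ring A] [Algebra k A] [AddCommGroup Λ] where
  n : ℕ
  hn : 2 ≤ n
  q : k
  hq0 : q ≠ 0
  hq : ∀ m : ℕ, 0 < m → q ^ m ≠ 1
  two : (2 : k) ≠ 0
  χ : Λ → Λ → k
  χne : ∀ a b, χ a b ≠ 0
  χl : ∀ a b c, χ (a + b) c = χ a c * χ b c
  χr : ∀ a b c, χ a (b + c) = χ a b * χ a c
  α : ℕ → Λ
  χd : ∀ i, i ≤ 2 * n → i ≠ n → χ (α i) (α i) = q ^ cart n i i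
  χn : χ (α n) (α n) = -1
  χp : ∀ i j, i ≤ 2 * n → j ≤ 2 * n → i ≠ j → χ (α i) (α j) * χ (α j) (α i) = q ^ (2 * cart n i j)
  Kg : Λ → A
  Lg : Λ → A
  E : ℕ → A
  F : ℕ → A
  K0 : Kg 0 = 1
  L0 : Lg 0 = 1
  KK : ∀ a b, Kg a * Kg b = Kg (a + b)
  LL : ∀ a b, Lg a * Lg b = Lg (a + b)
  KE : ∀ a i, i ≤ 2 * n → Kg a * E i = χ a (α i) • (E i * Kg a)
  LE : ∀ a i, i ≤ 2 * n → Lg a * E i = (χ (α i) a)⁻¹ • (E i * Lg a)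
  EFs : ∀ i, i ≤ 2 * n → E i * F i - F i * E i = -Kg (α i) + Lg (α i)
  EFn : ∀ i j, i ≤ 2 * n → j ≤ 2 * n → i ≠ j → E i * F j - F j * E i = 0
  S1 : ∀ i j, i ≤ 2 * n → j ≤ 2 * n → cart n i j = 0 → E i * E j - (χ (α j) (α i))⁻¹ • (E j * E i) = 0
  S2 : ∀ i j, i ≤ 2 * n → j ≤ 2 * n → i ≠ j → -(2 * cart n i j) = cart n i i → cart n i i ≠ 0 →
    E i * (E i * E j - (χ (α j) (α i))⁻¹ • (E j * E i))
      - (χ (α i + α j) (α i))⁻¹ • ((E i * E j - (χ (α j) (α i))⁻¹ • (E j * E i)) * E i) = 0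
  S3 : ∀ i j, i ≤ 2 * n → j ≤ 2 * n → i ≠ j → -(cart n i j) = cart n i i → cart n i i ≠ 0 →
    E i * (E i * (E i * E j - (χ (α j) (α i))⁻¹ • (E j * E i))
      - (χ (α i + α j) (α i))⁻¹ • ((E i * E j - (χ (α j) (α i))⁻¹ • (E j * E i)) * E i))
     - (χ (α i + (α i + α j)) (α i))⁻¹ • ((E i * (E i * E j - (χ (α j) (α i))⁻¹ • (E j * E i))
      - (χ (α i + α j) (α i))⁻¹ • ((E i * E j - (χ (α j) (α i))⁻¹ • (E j * E i)) * E i)) * E i) = 0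
  S4 : (E n * E (n - 1) - (χ (α (n - 1)) (α n))⁻¹ • (E (n - 1) * E n)) *
      (E n * E (n + 1) - (χ (α (n + 1)) (α n))⁻¹ • (E (n + 1) * E n))
     - (χ (α n + α (n + 1)) (α n + α (n - 1)))⁻¹ •
      ((E n * E (n + 1) - (χ (α (n + 1)) (α n))⁻¹ • (E (n + 1) * E n)) *
       (E n * E (n - 1) - (χ (α (n - 1)) (α n))⁻¹ • (E (n - 1) * E n))) = 0

section nil
variable {k A : Type} [Field k] [Ring A] [Algebra k A]

theorem pow_tw (D σ : A →ₗ[k] A) (c : k) (hσ : ∀ x, σ (D x) = c • D (σ x)) (hc : c ≠ 0)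
    (a : ℕ) : ∀ x, (D ^ a) x = 0 → (D ^ a) (σ x) = 0 := by
  induction a with
  | zero => intro x hx; simp at hx; simp [hx]
  | succ a ih =>
    intro x hx
    rw [pow_succ, Module.End.mul_apply] at hx ⊢
    have := ih _ hx
    rw [hσ, map_smul] at this
    exact (smul_eq_zero.mp this).resolve_left hc

theorem nil_mul_aux (D σ τ : A →ₗ[k] A) (c d : k) (hc : c ≠ 0) (hd : d ≠ 0)
    (hσ : ∀ x, σ (D x) = c • D (σ x)) (hτ : ∀ x, τ (D x) = d • D (τ x))
    (hD : ∀ x y, D (x * y) = D x * τ y + σ x * D y) (m : ℕ) :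
    ∀ a b x y, a + b = m → (D ^ a) x = 0 → (D ^ b) y = 0 → (D ^ m) (x * y) = 0 := by
  induction m with
  | zero =>
    intro a b x y h hx hy
    have : a = 0 := by omega
    subst this; simp at hx; simp [hx]
  | succ m ih =>
    intro a b x y h hx hy
    rcases a with _ | a
    · simp at hx; simp [hx]
    rcases b with _ | b
    · simp at hy; simp [hy]
    rw [pow_succ, Module.End.mul_apply, hD, map_add]
    rw [ih a (b+1) (D x) (τ y) (by omega) (by rw [pow_succ, Module.End.mul_apply] at hx; exact hx)
      (pow_tw D τ d hτ hd _ _ hy)]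
    rw [ih (a+1) b (σ x) (D y) (by omega) (pow_tw D σ c hσ hc _ _ hx)
      (by rw [pow_succ, Module.End.mul_apply] at hy; exact hy)]
    simp

/-- nilpotent elements -/
def Nil (D : A →ₗ[k] A) (x : A) : Prop := ∃ a, (D ^ a) x = 0

theorem pow_mono0 (D : A →ₗ[k] A) (x : A) (a b : ℕ) (h : (D ^ a) x = 0) (hab : a ≤ b) :
    (D ^ b) x = 0 := by
  obtain ⟨c, rfl⟩ := Nat.exists_eq_add_of_le' hab
  rw [pow_add, Module.End.mul_apply, h, map_zero]

theorem Nil.sub {D : A →ₗ[k] A} {x y : A} (hx : Nil D x) (hy : Nil D y) : Nil D (x - y) := by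
  obtain ⟨a, ha⟩ := hx; obtain ⟨b, hb⟩ := hy
  refine ⟨a + b, ?_⟩
  rw [map_sub, pow_mono0 D x a _ ha (by omega), pow_mono0 D y b _ hb (by omega), sub_zero]

theorem Nil.add {D : A →ₗ[k] A} {x y : A} (hx : Nil D x) (hy : Nil D y) : Nil D (x + y) := by
  obtain ⟨a, ha⟩ := hx; obtain ⟨b, hb⟩ := hy
  refine ⟨a + b, ?_⟩
  rw [map_add, pow_mono0 D x a _ ha (by omega), pow_mono0 D y b _ hb (by omega), add_zero]

theorem Nil.smul {D : A →ₗ[k] A} {x : A} (c : k) (hx : Nil D x) : Nil D (c • x) := by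
  obtain ⟨a, ha⟩ := hx
  exact ⟨a, by rw [map_smul, ha, smul_zero]⟩

theorem Nil.D {D : A →ₗ[k] A} {x : A} (hx : Nil D x) : Nil D (D x) := by
  obtain ⟨a, ha⟩ := hx
  exact ⟨a, by rw [← Module.End.mul_apply, ← pow_succ]; exact pow_mono0 D x a _ ha (by omega)⟩

theorem nil_desc (D : A →ₗ[k] A) (x : A) (m : ℕ) (hN : Nil D x)
    (h : ∀ j, m < j → (D ^ (j + 1)) x = 0 → (D ^ j) x = 0) : (D ^ (m + 1)) x = 0 := by
  obtain ⟨a, ha⟩ := hN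
  induction a with
  | zero => exact pow_mono0 D x 0 _ ha (by omega)
  | succ a ih =>
    by_cases hm : m < a
    · exact ih (h a hm ha)
    · exact pow_mono0 D x _ _ ha (by omega)
end nil

namespace QA
variable {k A Λ : Type} [Field k] [Ring A] [Algebra k A] [AddCommGroup Λ] (S : QA k A Λ)

theorem χ0l (a : Λ) : S.χ 0 a = 1 := by
  have := S.χl 0 0 a
  rw [add_zero] at this
  exact (mul_eq_left₀ (S.χne 0 a)).mp this.symm
theorem χ0r (a : Λ) : S.χ a 0 = 1 := by
  have := S.χr a 0 0
  rw [add_zero] at this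
  exact (mul_eq_left₀ (S.χne a 0)).mp this.symm
theorem χnl (a b : Λ) : S.χ (-a) b = (S.χ a b)⁻¹ := by
  apply eq_inv_of_mul_eq_one_left
  rw [← S.χl, neg_add_cancel, S.χ0l]
theorem χnr (a b : Λ) : S.χ a (-b) = (S.χ a b)⁻¹ := by
  apply eq_inv_of_mul_eq_one_left
  rw [← S.χr, neg_add_cancel, S.χ0r]
theorem KKn (a : Λ) : S.Kg a * S.Kg (-a) = 1 := by rw [S.KK, add_neg_cancel, S.K0]
theorem KnK (a : Λ) : S.Kg (-a) * S.Kg a = 1 := by rw [S.KK, neg_add_cancel, S.K0]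
theorem LLn (a : Λ) : S.Lg a * S.Lg (-a) = 1 := by rw [S.LL, add_neg_cancel, S.L0]
theorem LnL (a : Λ) : S.Lg (-a) * S.Lg a = 1 := by rw [S.LL, neg_add_cancel, S.L0]

theorem mulK_inj {x : A} (a : Λ) (h : x * S.Kg a = 0) : x = 0 := by
  have := congrArg (· * S.Kg (-a)) h
  simpa [mul_assoc, S.KKn] using this
theorem mulL_inj {x : A} (a : Λ) (h : x * S.Lg a = 0) : x = 0 := by
  have := congrArg (· * S.Lg (-a)) h
  simpa [mul_assoc, S.LLn] using this

/-- homogeneous of degree μ -/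
def Dg (μ : Λ) (x : A) : Prop :=
  (∀ a, S.Kg a * x = S.χ a μ • (x * S.Kg a)) ∧ (∀ a, S.Lg a * x = (S.χ μ a)⁻¹ • (x * S.Lg a))

theorem Dg.mul {S : QA k A Λ} {μ ν : Λ} {x y : A} (hx : S.Dg μ x) (hy : S.Dg ν y) : S.Dg (μ + ν) (x * y) := by
  constructor <;> intro a
  · rw [← mul_assoc, hx.1, smul_mul_assoc, mul_assoc, hy.1, mul_smul_comm, smul_smul, S.χr, mul_assoc]
  · rw [← mul_assoc, hx.2, smul_mul_assoc, mul_assoc, hy.2, mul_smul_comm, smul_smul, S.χl, mul_assoc, mul_inv]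
theorem Dg.mul' {S : QA k A Λ} {μ ν : Λ} {x y : A} (hx : S.Dg μ x) (hy : S.Dg ν y) : S.Dg (ν + μ) (x * y) := by
  rw [add_comm]; exact hx.mul hy
theorem Dg.sub {S : QA k A Λ} {μ : Λ} {x y : A} (hx : S.Dg μ x) (hy : S.Dg μ y) : S.Dg μ (x - y) := by
  constructor <;> intro a
  · rw [mul_sub, hx.1, hy.1, sub_mul, smul_sub]
  · rw [mul_sub, hx.2, hy.2, sub_mul, smul_sub]
theorem Dg.add {S : QA k A Λ} {μ : Λ} {x y : A} (hx : S.Dg μ x) (hy : S.Dg μ y) : S.Dg μ (x + y) := by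
  constructor <;> intro a
  · rw [mul_add, hx.1, hy.1, add_mul, smul_add]
  · rw [mul_add, hx.2, hy.2, add_mul, smul_add]
theorem Dg.zero (μ : Λ) : S.Dg μ 0 := by
  constructor <;> intro a <;> simp
theorem Dg.smul {S : QA k A Λ} {μ : Λ} {x : A} (c : k) (hx : S.Dg μ x) : S.Dg μ (c • x) := by
  constructor <;> intro a
  · rw [mul_smul_comm, hx.1, smul_mul_assoc, smul_comm]
  · rw [mul_smul_comm, hx.2, smul_mul_assoc, smul_comm]
theorem DgE {i : ℕ} (h : i ≤ 2 * S.n) : S.Dg (S.α i) (S.E i) :=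
  ⟨fun a => S.KE a i h, fun a => S.LE a i h⟩

/-- conj by L -/
def cL (i : ℕ) : A →ₗ[k] A :=
  (LinearMap.mulLeft k (S.Lg (S.α i))) ∘ₗ (LinearMap.mulRight k (S.Lg (-S.α i)))
/-- conj by K inverse -/
def cK (i : ℕ) : A →ₗ[k] A :=
  (LinearMap.mulLeft k (S.Kg (-S.α i))) ∘ₗ (LinearMap.mulRight k (S.Kg (S.α i)))
/-- left bracket -/
def adL (i : ℕ) : A →ₗ[k] A :=
  LinearMap.mulLeft k (S.E i) - (LinearMap.mulRight k (S.E i)) ∘ₗ S.cL i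
def adR (i : ℕ) : A →ₗ[k] A :=
  LinearMap.mulRight k (S.E i) - (LinearMap.mulLeft k (S.E i)) ∘ₗ S.cK i

theorem cL_apply (i : ℕ) (x : A) : S.cL i x = S.Lg (S.α i) * (x * S.Lg (-S.α i)) := rfl
theorem cK_apply (i : ℕ) (x : A) : S.cK i x = S.Kg (-S.α i) * (x * S.Kg (S.α i)) := rfl
theorem adL_apply (i : ℕ) (x : A) : S.adL i x = S.E i * x - S.cL i x * S.E i := rfl
theorem adR_apply (i : ℕ) (x : A) : S.adR i x = x * S.E i - S.E i * S.cK i x := rfl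

theorem cL_mul (i : ℕ) (x y : A) : S.cL i (x * y) = S.cL i x * S.cL i y := by
  simp only [cL_apply]
  rw [show S.Lg (S.α i) * (x * S.Lg (-S.α i)) * (S.Lg (S.α i) * (y * S.Lg (-S.α i)))
    = S.Lg (S.α i) * (x * (S.Lg (-S.α i) * S.Lg (S.α i)) * (y * S.Lg (-S.α i))) by simp only [mul_assoc], S.LnL]
  simp only [mul_assoc, mul_one, one_mul]
theorem cK_mul (i : ℕ) (x y : A) : S.cK i (x * y) = S.cK i x * S.cK i y := by
  simp only [cK_apply]
  rw [show S.Kg (-S.α i) * (x * S.Kg (S.α i)) * (S.Kg (-S.α i) * (y * S.Kg (S.α i)))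
    = S.Kg (-S.α i) * (x * (S.Kg (S.α i) * S.Kg (-S.α i)) * (y * S.Kg (S.α i))) by simp only [mul_assoc], S.KKn]
  simp only [mul_assoc, mul_one, one_mul]

theorem cL_deg (i : ℕ) {μ : Λ} {x : A} (h : S.Dg μ x) : S.cL i x = (S.χ μ (S.α i))⁻¹ • x := by
  rw [cL_apply, ← mul_assoc, h.2, smul_mul_assoc, mul_assoc, S.LLn, mul_one]
theorem cK_deg (i : ℕ) {μ : Λ} {x : A} (h : S.Dg μ x) : S.cK i x = (S.χ (S.α i) μ)⁻¹ • x := by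
  rw [cK_apply, ← mul_assoc, h.1, smul_mul_assoc, mul_assoc, S.KnK, mul_one, S.χnl]

theorem adL_deg (i : ℕ) {μ : Λ} {x : A} (h : S.Dg μ x) :
    S.adL i x = S.E i * x - (S.χ μ (S.α i))⁻¹ • (x * S.E i) := by
  rw [adL_apply, S.cL_deg i h, smul_mul_assoc]
theorem adR_deg (i : ℕ) {μ : Λ} {x : A} (h : S.Dg μ x) :
    S.adR i x = x * S.E i - (S.χ (S.α i) μ)⁻¹ • (S.E i * x) := by
  rw [adR_apply, S.cK_deg i h, mul_smul_comm]

theorem DgL {i : ℕ} (hi : i ≤ 2 * S.n) {μ : Λ} {x : A} (h : S.Dg μ x) : S.Dg (μ + S.α i) (S.adL i x) := by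
  rw [S.adL_deg i h]
  exact Dg.sub ((S.DgE hi).mul' h) (Dg.smul _ (h.mul (S.DgE hi)))
theorem DgR {i : ℕ} (hi : i ≤ 2 * S.n) {μ : Λ} {x : A} (h : S.Dg μ x) : S.Dg (μ + S.α i) (S.adR i x) := by
  rw [S.adR_deg i h]
  exact Dg.sub (h.mul (S.DgE hi)) (Dg.smul _ ((S.DgE hi).mul' h))

theorem adL_mul (i : ℕ) (x y : A) : S.adL i (x * y) = S.adL i x * y + S.cL i x * S.adL i y := by
  simp only [adL_apply, cL_mul, mul_sub, sub_mul, mul_assoc]; abel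
theorem adR_mul (i : ℕ) (x y : A) : S.adR i (x * y) = S.adR i x * S.cK i y + x * S.adR i y := by
  simp only [adR_apply, cK_mul, mul_sub, sub_mul, mul_assoc]; abel

theorem cL_adL {i : ℕ} (hi : i ≤ 2 * S.n) (x : A) :
    S.cL i (S.adL i x) = (S.χ (S.α i) (S.α i))⁻¹ • S.adL i (S.cL i x) := by
  simp only [adL_apply, map_sub, cL_mul, S.cL_deg i (S.DgE hi), smul_sub, smul_mul_assoc, mul_smul_comm]
theorem cK_adR {i : ℕ} (hi : i ≤ 2 * S.n) (x : A) :
    S.cK i (S.adR i x) = (S.χ (S.α i) (S.α i))⁻¹ • S.adR i (S.cK i x) := by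
  simp only [adR_apply, map_sub, cK_mul, S.cK_deg i (S.DgE hi), smul_sub, smul_mul_assoc, mul_smul_comm]

theorem NL_mul {i : ℕ} (hi : i ≤ 2 * S.n) {x y : A} (hx : Nil (S.adL i) x) (hy : Nil (S.adL i) y) :
    Nil (S.adL i) (x * y) := by
  obtain ⟨a, ha⟩ := hx; obtain ⟨b, hb⟩ := hy
  exact ⟨a + b, nil_mul_aux (S.adL i) (S.cL i) LinearMap.id _ 1 (inv_ne_zero (S.χne (S.α i) (S.α i)))
    one_ne_zero (S.cL_adL hi) (by simp) (S.adL_mul i) _ a b x y rfl ha hb⟩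
theorem NR_mul {i : ℕ} (hi : i ≤ 2 * S.n) {x y : A} (hx : Nil (S.adR i) x) (hy : Nil (S.adR i) y) :
    Nil (S.adR i) (x * y) := by
  obtain ⟨a, ha⟩ := hx; obtain ⟨b, hb⟩ := hy
  exact ⟨a + b, nil_mul_aux (S.adR i) LinearMap.id (S.cK i) 1 _ one_ne_zero (inv_ne_zero (S.χne (S.α i) (S.α i)))
    (by simp) (S.cK_adR hi) (S.adR_mul i) _ a b x y rfl ha hb⟩

/-- kernel closure -/
theorem kerL_mul {i : ℕ} {x y : A} (hx : S.adL i x = 0) (hy : S.adL i y = 0) : S.adL i (x * y) = 0 := by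
  rw [adL_mul, hx, hy]; simp
theorem kerR_mul {i : ℕ} {x y : A} (hx : S.adR i x = 0) (hy : S.adR i y = 0) : S.adR i (x * y) = 0 := by
  rw [adR_mul, hx, hy]; simp

/-- commutator with F -/
def C (i : ℕ) : A →ₗ[k] A := LinearMap.mulRight k (S.F i) - LinearMap.mulLeft k (S.F i)
theorem C_apply (i : ℕ) (x : A) : S.C i x = x * S.F i - S.F i * x := rfl
theorem C_mul (i : ℕ) (x y : A) : S.C i (x * y) = S.C i x * y + x * S.C i y := by
  simp only [C_apply, mul_sub, sub_mul, mul_assoc]; abel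
theorem CEs {i : ℕ} (hi : i ≤ 2 * S.n) : S.C i (S.E i) = -S.Kg (S.α i) + S.Lg (S.α i) := S.EFs i hi
theorem CEn {i j : ℕ} (hi : i ≤ 2 * S.n) (hj : j ≤ 2 * S.n) (h : j ≠ i) : S.C i (S.E j) = 0 :=
  S.EFn j i hj hi h

theorem C_L {i : ℕ} (hi : i ≤ 2 * S.n) {μ : Λ} {x : A} (h : S.Dg μ x) :
    S.C i (S.adL i x) = ((S.χ μ (S.α i))⁻¹ - S.χ (S.α i) μ) • (x * S.Kg (S.α i))
      + (S.E i * S.C i x - (S.χ μ (S.α i))⁻¹ • (S.C i x * S.E i)) := by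
  rw [S.adL_deg i h, map_sub, map_smul, C_mul, C_mul, S.CEs hi, add_mul, neg_mul, h.1, h.2]
  simp only [mul_add, mul_neg]
  module
theorem C_R {i : ℕ} (hi : i ≤ 2 * S.n) {μ : Λ} {x : A} (h : S.Dg μ x) :
    S.C i (S.adR i x) = (1 - (S.χ (S.α i) μ)⁻¹ * (S.χ μ (S.α i))⁻¹) • (x * S.Lg (S.α i))
      + (S.C i x * S.E i - (S.χ (S.α i) μ)⁻¹ • (S.E i * S.C i x)) := by
  rw [S.adR_deg i h, map_sub, map_smul, C_mul, C_mul, S.CEs hi, add_mul, neg_mul, h.1, h.2]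
  simp only [mul_add, mul_neg, smul_add, smul_neg, smul_smul]
  rw [inv_mul_cancel₀ (S.χne _ _)]
  module
theorem C_Ln {i j : ℕ} (hi : i ≤ 2 * S.n) (hj : j ≤ 2 * S.n) (hij : j ≠ i) {μ : Λ} {x : A} (h : S.Dg μ x) :
    S.C i (S.adL j x) = S.E j * S.C i x - (S.χ μ (S.α j))⁻¹ • (S.C i x * S.E j) := by
  rw [S.adL_deg j h, map_sub, map_smul, C_mul, C_mul, S.CEn hi hj hij]
  simp
theorem C_Rn {i j : ℕ} (hi : i ≤ 2 * S.n) (hj : j ≤ 2 * S.n) (hij : j ≠ i) {μ : Λ} {x : A} (h : S.Dg μ x) :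
    S.C i (S.adR j x) = S.C i x * S.E j - (S.χ (S.α j) μ)⁻¹ • (S.E j * S.C i x) := by
  rw [S.adR_deg j h, map_sub, map_smul, C_mul, C_mul, S.CEn hi hj hij]
  simp

/-- pairing -/
def Q (a b : Λ) : k := S.χ a b * S.χ b a

theorem Q_comm (a b : Λ) : S.Q a b = S.Q b a := mul_comm _ _
theorem Q_ne (a b : Λ) : S.Q a b ≠ 0 := mul_ne_zero (S.χne _ _) (S.χne _ _)
theorem χ_inv (a b : Λ) : (S.χ a b)⁻¹ = S.χ b a * (S.Q a b)⁻¹ := by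
  have := S.χne a b; have := S.χne b a
  rw [Q]; field_simp

/-- E_j * (y K), moving -/
theorem br_LK {i j : ℕ} (hj : j ≤ 2 * S.n) {ν : Λ} {y : A} (h : S.Dg ν y) :
    S.E j * (y * S.Kg (S.α i)) - (S.χ (ν + S.α i) (S.α j))⁻¹ • (y * S.Kg (S.α i) * S.E j)
      = S.adL j y * S.Kg (S.α i) := by
  rw [S.adL_deg j h, mul_assoc y, S.KE _ _ hj, S.χl]
  simp only [sub_mul, mul_assoc, smul_mul_assoc, mul_smul_comm, smul_smul]
  have := S.χne (S.α i) (S.α j); have := S.χne ν (S.α j)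
  match_scalars <;> field_simp
theorem br_LL {i j : ℕ} (hj : j ≤ 2 * S.n) (hQ : S.Q (S.α i) (S.α j) = 1) {ν : Λ} {y : A} (h : S.Dg ν y) :
    S.E j * (y * S.Lg (S.α i)) - (S.χ (ν + S.α i) (S.α j))⁻¹ • (y * S.Lg (S.α i) * S.E j)
      = S.adL j y * S.Lg (S.α i) := by
  rw [S.adL_deg j h, mul_assoc y, S.LE _ _ hj, S.χl]
  simp only [sub_mul, mul_assoc, smul_mul_assoc, mul_smul_comm, smul_smul]
  have := S.χne (S.α i) (S.α j); have := S.χne ν (S.α j); have := S.χne (S.α j) (S.α i)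
  rw [Q] at hQ
  match_scalars
  · field_simp
  · field_simp; rw [hQ]
theorem br_RL {i j : ℕ} (hj : j ≤ 2 * S.n) {ν : Λ} {y : A} (h : S.Dg ν y) :
    (y * S.Lg (S.α i)) * S.E j - (S.χ (S.α j) (ν + S.α i))⁻¹ • (S.E j * (y * S.Lg (S.α i)))
      = (S.χ (S.α j) (S.α i))⁻¹ • (S.adR j y * S.Lg (S.α i)) := by
  rw [S.adR_deg j h, mul_assoc y, S.LE _ _ hj, S.χr]
  simp only [sub_mul, mul_assoc, smul_mul_assoc, mul_smul_comm, smul_smul]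
  have := S.χne (S.α j) (S.α i); have := S.χne (S.α j) ν
  match_scalars <;> field_simp
theorem br_RK {i j : ℕ} (hj : j ≤ 2 * S.n) (hQ : S.Q (S.α i) (S.α j) = 1) {ν : Λ} {y : A} (h : S.Dg ν y) :
    (y * S.Kg (S.α i)) * S.E j - (S.χ (S.α j) (ν + S.α i))⁻¹ • (S.E j * (y * S.Kg (S.α i)))
      = (S.χ (S.α i) (S.α j)) • (S.adR j y * S.Kg (S.α i)) := by
  rw [S.adR_deg j h, mul_assoc y, S.KE _ _ hj, S.χr]
  simp only [sub_mul, mul_assoc, smul_mul_assoc, mul_smul_comm, smul_smul]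
  have := S.χne (S.α j) (S.α i); have := S.χne (S.α j) ν; have := S.χne (S.α i) (S.α j)
  rw [Q] at hQ
  match_scalars
  · field_simp
  · field_simp; linear_combination hQ

theorem powLdeg {i : ℕ} (hi : i ≤ 2 * S.n) {μ : Λ} {x : A} (h : S.Dg μ x) (j : ℕ) :
    S.Dg (μ + j • S.α i) ((S.adL i ^ j) x) := by
  induction j with
  | zero => simpa using h
  | succ j ih =>
    rw [pow_succ', Module.End.mul_apply, succ_nsmul, ← add_assoc]; exact S.DgL hi ih
theorem powRdeg {i : ℕ} (hi : i ≤ 2 * S.n) {μ : Λ} {x : A} (h : S.Dg μ x) (j : ℕ) :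
    S.Dg (μ + j • S.α i) ((S.adR i ^ j) x) := by
  induction j with
  | zero => simpa using h
  | succ j ih =>
    rw [pow_succ', Module.End.mul_apply, succ_nsmul, ← add_assoc]; exact S.DgR hi ih
theorem χnsl (a b : Λ) (j : ℕ) : S.χ (j • a) b = S.χ a b ^ j := by
  induction j with
  | zero => simp [S.χ0l]
  | succ j ih => rw [succ_nsmul, S.χl, ih, pow_succ]
theorem χnsr (a b : Λ) (j : ℕ) : S.χ a (j • b) = S.χ a b ^ j := by
  induction j with
  | zero => simp [S.χ0r]
  | succ j ih => rw [succ_nsmul, S.χr, ih, pow_succ]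

theorem CpowL {i : ℕ} (hi : i ≤ 2 * S.n) {μ : Λ} {x : A} (h : S.Dg μ x) (hC : S.C i x = 0)
    {p : k} (hp : S.χ (S.α i) (S.α i) = p) (hp1 : p ≠ 1) (j : ℕ) :
    S.C i ((S.adL i ^ (j + 1)) x) = ((S.χ μ (S.α i))⁻¹ * ((1 - p ^ (j + 1)) * ((p ^ j)⁻¹ - S.Q μ (S.α i)) / (1 - p)))
      • ((S.adL i ^ j) x * S.Kg (S.α i)) := by
  have hp0 : p ≠ 0 := hp ▸ S.χne _ _
  have h1 : 1 - p ≠ 0 := sub_ne_zero.mpr (Ne.symm hp1)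
  have hm := S.χne μ (S.α i)
  induction j with
  | zero =>
    simp only [zero_add, pow_one, pow_zero, Module.End.one_apply]
    rw [S.C_L hi h, hC]
    simp only [mul_zero, zero_mul, smul_zero, sub_zero, add_zero]
    congr 1
    rw [Q]; field_simp
  | succ j ih =>
    rw [pow_succ' _ (j + 1), Module.End.mul_apply, S.C_L hi (S.powLdeg hi h _), ih, mul_smul_comm, smul_mul_assoc,
      smul_comm _ (_ * _ : k), ← smul_sub, succ_nsmul, ← add_assoc, S.br_LK hi (S.powLdeg hi h _),
      ← Module.End.mul_apply, ← pow_succ', ← add_smul]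
    congr 1
    simp only [S.χl, S.χr, χnsl, χnsr, hp, Q]
    field_simp
    ring
theorem CpowR {i : ℕ} (hi : i ≤ 2 * S.n) {μ : Λ} {x : A} (h : S.Dg μ x) (hC : S.C i x = 0)
    {p : k} (hp : S.χ (S.α i) (S.α i) = p) (hp1 : p ≠ 1) (j : ℕ) :
    S.C i ((S.adR i ^ (j + 1)) x) = ((p ^ j)⁻¹ * ((1 - p ^ (j + 1)) * (1 - (S.Q μ (S.α i))⁻¹ * (p ^ j)⁻¹) / (1 - p)))
      • ((S.adR i ^ j) x * S.Lg (S.α i)) := by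
  have hp0 : p ≠ 0 := hp ▸ S.χne _ _
  have h1 : 1 - p ≠ 0 := sub_ne_zero.mpr (Ne.symm hp1)
  have hm := S.χne μ (S.α i)
  have hm' := S.χne (S.α i) μ
  induction j with
  | zero =>
    simp only [zero_add, pow_one, pow_zero, Module.End.one_apply]
    rw [S.C_R hi h, hC]
    simp only [mul_zero, zero_mul, smul_zero, sub_zero, add_zero]
    congr 1
    rw [Q]; field_simp
  | succ j ih =>
    rw [pow_succ' _ (j + 1), Module.End.mul_apply, S.C_R hi (S.powRdeg hi h _), ih, mul_smul_comm, smul_mul_assoc,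
      smul_comm _ (_ * _ : k), ← smul_sub, succ_nsmul, ← add_assoc, S.br_RL hi (S.powRdeg hi h _),
      ← Module.End.mul_apply, ← pow_succ', smul_smul, ← add_smul]
    congr 1
    simp only [S.χl, S.χr, χnsl, χnsr, hp, Q]
    field_simp
    ring

/-- sl2 lemma -/
theorem slL {i : ℕ} (hi : i ≤ 2 * S.n) {μ : Λ} {x : A} (h : S.Dg μ x) (hC : S.C i x = 0)
    (hN : Nil (S.adL i) x) (hp : ∀ m : ℕ, 0 < m → S.χ (S.α i) (S.α i) ^ m ≠ 1)
    (m : ℕ) (hm : S.Q μ (S.α i) * S.χ (S.α i) (S.α i) ^ m = 1) : (S.adL i ^ (m + 1)) x = 0 := by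
  apply nil_desc _ _ _ hN
  intro j hj h0
  have hp1 : S.χ (S.α i) (S.α i) ≠ 1 := by simpa using hp 1 one_pos
  have := S.CpowL hi h hC rfl hp1 j
  rw [h0, map_zero] at this
  have h2 := (smul_eq_zero.mp this.symm)
  refine S.mulK_inj _ (h2.resolve_left ?_)
  have hp0 := S.χne (S.α i) (S.α i)
  set p := S.χ (S.α i) (S.α i) with hpd
  refine mul_ne_zero (inv_ne_zero (S.χne _ _)) (div_ne_zero (mul_ne_zero ?_ ?_) (sub_ne_zero.mpr (Ne.symm hp1)))
  · exact sub_ne_zero.mpr (Ne.symm (hp _ (by omega)))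
  · intro h3
    apply hp (j - m) (by omega)
    obtain ⟨t, rfl⟩ := Nat.exists_eq_add_of_lt hj
    rw [show m + t + 1 - m = t + 1 by omega]
    have h4 := sub_eq_zero.mp h3
    rw [← h4] at hm
    rw [show m + t + 1 = m + (t + 1) by omega, pow_add] at hm
    have : p ^ m ≠ 0 := pow_ne_zero _ hp0
    have : p ^ (t+1) ≠ 0 := pow_ne_zero _ hp0
    field_simp at hm
    exact hm.symm
theorem slR {i : ℕ} (hi : i ≤ 2 * S.n) {μ : Λ} {x : A} (h : S.Dg μ x) (hC : S.C i x = 0)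
    (hN : Nil (S.adR i) x) (hp : ∀ m : ℕ, 0 < m → S.χ (S.α i) (S.α i) ^ m ≠ 1)
    (m : ℕ) (hm : S.Q μ (S.α i) * S.χ (S.α i) (S.α i) ^ m = 1) : (S.adR i ^ (m + 1)) x = 0 := by
  apply nil_desc _ _ _ hN
  intro j hj h0
  have hp1 : S.χ (S.α i) (S.α i) ≠ 1 := by simpa using hp 1 one_pos
  have := S.CpowR hi h hC rfl hp1 j
  rw [h0, map_zero] at this
  have h2 := (smul_eq_zero.mp this.symm)
  refine S.mulL_inj _ (h2.resolve_left ?_)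
  have hp0 := S.χne (S.α i) (S.α i)
  set p := S.χ (S.α i) (S.α i) with hpd
  refine mul_ne_zero (inv_ne_zero (pow_ne_zero _ hp0)) (div_ne_zero (mul_ne_zero ?_ ?_) (sub_ne_zero.mpr (Ne.symm hp1)))
  · exact sub_ne_zero.mpr (Ne.symm (hp _ (by omega)))
  · intro h3
    apply hp (j - m) (by omega)
    obtain ⟨t, rfl⟩ := Nat.exists_eq_add_of_lt hj
    rw [show m + t + 1 - m = t + 1 by omega]
    have h4 := sub_eq_zero.mp h3
    have h5 : (S.Q μ (S.α i))⁻¹ = p ^ m := inv_eq_of_mul_eq_one_right hm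
    rw [h5] at h4
    rw [show m + t + 1 = m + (t + 1) by omega, pow_add] at h4
    have : p ^ m ≠ 0 := pow_ne_zero _ hp0
    have : p ^ (t+1) ≠ 0 := pow_ne_zero _ hp0
    field_simp at h4
    exact h4
end QA
end QAux

namespace QAux
/-- index sequence -/
def ls (n s : ℕ) : ℕ := (n - 1 - s) + (s - (n - 1))
def rs (n s : ℕ) : ℕ := 2 * n - ls n s
def fX (n s t : ℕ) : ℤ :=
  if s < n then (if t = n - 1 - s then 1 else 0) - (if t = n + s then 1 else 0)
  else (if t = 3 * n - 1 - s then 1 else 0) - (if t = s - n then 1 else 0)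

theorem cart_LR {n i j : ℕ} (hi : i < n) (hj : n < j) (hj2 : j ≤ 2 * n) : cart n i j = 0 := by
  unfold cart pr wv dsg; grind
theorem cart_RL {n i j : ℕ} (hi : i < n) (hj : n < j) (hj2 : j ≤ 2 * n) : cart n j i = 0 := by
  unfold cart pr wv dsg; grind
theorem cart_self {n i : ℕ} (hn : 2 ≤ n) (hi : i ≤ 2 * n) : cart n i i =
    if i = 0 then 4 else if i < n then 2 else if i = n then 0 else if i < 2 * n then -2 else -4 := by
  unfold cart pr wv dsg; grind
theorem cart_nn {n : ℕ} (hn : 2 ≤ n) : cart n n n = 0 := by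
  unfold cart pr wv dsg; grind
theorem cart_far {n i j : ℕ} (hi : i + 1 < j) (hj2 : j ≤ 2 * n) : cart n i j = 0 := by
  unfold cart pr wv dsg; grind
theorem cart_far' {n i j : ℕ} (hi : i + 1 < j) (hj2 : j ≤ 2 * n) : cart n j i = 0 := by
  unfold cart pr wv dsg; grind
theorem cart_next {n i : ℕ} (hn : 2 ≤ n) (hi : i + 1 ≤ 2 * n) : cart n i (i + 1) =
    if i = 0 then -2 else if i < n then -1 else if i + 1 < 2 * n then 1 else 2 := by
  unfold cart pr wv dsg; grind
theorem cart_prev {n i : ℕ} (hn : 2 ≤ n) (hi : i + 1 ≤ 2 * n) : cart n (i + 1) i =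
    if i = 0 then -2 else if i < n then -1 else if i + 1 < 2 * n then 1 else 2 := by
  unfold cart pr wv dsg; grind
theorem cart_cases {n i j : ℕ} (hn : 2 ≤ n) (hi : i ≤ 2 * n) (hj : j ≤ 2 * n) (hin : i ≠ n) (hij : i ≠ j) :
    cart n i j = 0 ∨ -(2 * cart n i j) = cart n i i ∨ -(cart n i j) = cart n i i := by
  rcases Nat.lt_trichotomy (i + 1) j with h | h | h
  · exact Or.inl (cart_far h hj)
  · subst h; rw [cart_next hn hj, cart_self hn hi]; grind
  · rcases Nat.lt_trichotomy (j + 1) i with h' | h' | h'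
    · exact Or.inl (cart_far' h' hi)
    · subst h'; rw [cart_prev hn hi, cart_self hn hi]; grind
    · omega
theorem cart_self_ne {n i : ℕ} (hn : 2 ≤ n) (hi : i ≤ 2 * n) (hin : i ≠ n) : cart n i i ≠ 0 := by
  rw [cart_self hn hi]; split_ifs <;> omega

theorem ls_lt {n s : ℕ} (hs : s < 2 * n - 1) : ls n s < n := by unfold ls; omega
theorem rs_gt {n s : ℕ} (hs : s < 2 * n - 1) : n < rs n s := by unfold rs ls; omega
theorem rs_le {n s : ℕ} : rs n s ≤ 2 * n := by unfold rs; omega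

theorem f3l {n s : ℕ} (hn : 2 ≤ n) (hs : s + 1 < 2 * n - 1) (h : s + 1 ≠ n) : pr n (fX n s) (ls n (s + 1)) = 0 := by
  unfold pr fX ls dsg; grind
theorem f3r {n s : ℕ} (hn : 2 ≤ n) (hs : s + 1 < 2 * n - 1) (h : s + 1 ≠ n) : pr n (fX n s) (rs n (s + 1)) = 0 := by
  unfold pr fX rs ls dsg; grind
theorem f4l {n s : ℕ} (hn : 2 ≤ n) (hs : s < 2 * n - 1) : pr n (fX n s) (ls n s) = if s + 1 = n then -2 else -1 := by
  unfold pr fX ls dsg; grind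
theorem f4r {n s : ℕ} (hn : 2 ≤ n) (hs : s < 2 * n - 1) : pr n (fX n s) (rs n s) = if s + 1 = n then 2 else 1 := by
  unfold pr fX rs ls dsg; grind
theorem fXA {n i j : ℕ} (hn : 2 ≤ n) (hi : i < n) (hij : i + 1 < j) (hj : j + i + 1 < 2 * n)  :
    pr n (fX n (n + i)) j = 0 := by
  unfold pr fX dsg; grind
theorem fX_n {n : ℕ} (hn : 2 ≤ n) : pr n (fX n (2 * n - 1)) n = 0 := by
  unfold pr fX dsg; grind
theorem fa {n s t : ℕ} (h1 : s + 1 < n) :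
    fX n (s+1) t = fX n s t + wv n (n - 1 - s) t + wv n (n + 1 + s) t := by
  unfold fX wv; grind
theorem fb {n s t : ℕ} (h1 : s + 1 = n) (ht : t < 2 * n) :
    fX n (s+1) t = fX n s t + wv n 0 t + wv n (2 * n) t := by
  unfold fX wv; grind
theorem fc {n s t : ℕ} (h1 : n < s + 1) (hs : s < 2 * n - 1) (ht : t < 2 * n) :
    fX n (s+1) t = fX n s t + wv n (s + 1 - n) t + wv n (3 * n - 1 - s) t := by
  unfold fX wv; grind
theorem fX_step {n s : ℕ} (hn : 2 ≤ n) (hs : s < 2 * n - 1) (j : ℕ) (hj : j ≤ 2 * n) :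
    pr n (fX n (s + 1)) j = pr n (fX n s) j + cart n (ls n s) j + cart n (rs n s) j := by
  have key : ∀ t, t < 2 * n → fX n (s+1) t = fX n s t + wv n (ls n s) t + wv n (rs n s) t := by
    intro t ht
    by_cases h1 : s + 1 < n
    · have e : ls n s = n - 1 - s := by unfold ls; omega
      have e2 : rs n s = n + 1 + s := by unfold rs; omega
      rw [e, e2]; exact fa h1
    · by_cases h2 : s + 1 = n
      · have e : ls n s = 0 := by unfold ls; omega
        have e2 : rs n s = 2 * n := by unfold rs; omega
        rw [e, e2]; exact fb h2 ht
      · have e : ls n s = s + 1 - n := by unfold ls; omega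
        have e2 : rs n s = 3 * n - 1 - s := by unfold rs; omega
        rw [e, e2]; exact fc (by omega) hs ht
  unfold cart pr
  split_ifs
  · rw [key 0 (by omega)]; ring
  · rw [key _ (by omega)]; ring
  · rw [key _ (by omega), key _ (by omega)]; ring
theorem fX_sum {n i j : ℕ} (hi : i < n) : pr n (fX n (n + i)) j + pr n (fX n (n - 1 - i)) j = 0 := by
  have : ∀ t, fX n (n + i) t = - fX n (n - 1 - i) t := by
    intro t; unfold fX; grind
  unfold pr; simp only [this]; split_ifs <;> ring

namespace QA
variable {k A Λ : Type} [Field k] [Ring A] [Algebra k A] [AddCommGroup Λ] (S : QA k A Λ)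

theorem hqz {m : ℤ} (hm : m ≠ 0) : S.q ^ m ≠ 1 := by
  intro h
  rcases lt_or_gt_of_ne hm with h1 | h1
  · obtain ⟨a, ha⟩ := Int.eq_ofNat_of_zero_le (show 0 ≤ -m by omega)
    apply S.hq a (by omega)
    rw [show m = -(a : ℤ) by omega, zpow_neg, zpow_natCast, inv_eq_one] at h
    exact h
  · obtain ⟨a, ha⟩ := Int.eq_ofNat_of_zero_le (show 0 ≤ m by omega)
    apply S.hq a (by omega)
    rw [ha, zpow_natCast] at h
    exact h

theorem Qp {i j : ℕ} (hi : i ≤ 2 * S.n) (hj : j ≤ 2 * S.n) :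
    S.Q (S.α i) (S.α j) = S.q ^ (2 * cart S.n i j) := by
  by_cases h : i = j
  · subst h
    by_cases h2 : i = S.n
    · rw [h2, Q, S.χn, cart_nn S.hn]; simp
    · rw [Q, S.χd i hi h2, ← zpow_add₀ S.hq0]; congr 1; ring
  · exact S.χp i j hi hj h
theorem Q0 {i j : ℕ} (hi : i ≤ 2 * S.n) (hj : j ≤ 2 * S.n) (h : cart S.n i j = 0) :
    S.Q (S.α i) (S.α j) = 1 := by rw [S.Qp hi hj, h]; simp
theorem Q_add (a b c : Λ) : S.Q (a + b) c = S.Q a c * S.Q b c := by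
  unfold Q; rw [S.χl, S.χr]; ring
theorem hpp {i : ℕ} (hi : i ≤ 2 * S.n) (hin : i ≠ S.n) (m : ℕ) (hm : 0 < m) :
    S.χ (S.α i) (S.α i) ^ m ≠ 1 := by
  rw [S.χd i hi hin, ← zpow_natCast, ← zpow_mul]
  exact S.hqz (mul_ne_zero (cart_self_ne S.hn hi hin) (by omega))

def dg : ℕ → Λ
  | 0 => S.α S.n
  | s + 1 => dg s + S.α (ls S.n s) + S.α (rs S.n s)
def X : ℕ → A
  | 0 => S.E S.n
  | s + 1 => S.adL (rs S.n s) (S.adR (ls S.n s) (X s))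

theorem Qdg {s j : ℕ} (hs : s ≤ 2 * S.n - 1) (hj : j ≤ 2 * S.n) :
    S.Q (S.dg s) (S.α j) = S.q ^ (2 * pr S.n (fX S.n s) j) := by
  induction s with
  | zero =>
    have hn := S.hn
    rw [dg, S.Qp (by omega) hj]
    congr 2
    have key : ∀ t, fX S.n 0 t = wv S.n S.n t := by
      intro t; unfold fX wv; grind
    unfold cart pr; simp only [key]
  | succ s ih =>
    rw [dg, Q_add, Q_add, ih (by omega), S.Qp (by have := ls_lt (n := S.n) (s := s) (by omega); omega) hj,
      S.Qp rs_le hj, ← zpow_add₀ S.hq0, ← zpow_add₀ S.hq0, fX_step S.hn (by omega) j hj]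
    congr 1; ring

theorem Dgl {s : ℕ} (hs : s < 2 * S.n - 1) : ls S.n s ≤ 2 * S.n := by
  have := ls_lt (n := S.n) (s := s) (by omega); omega
theorem DgX {s : ℕ} (hs : s ≤ 2 * S.n - 1) : S.Dg (S.dg s) (S.X s) := by
  induction s with
  | zero => exact S.DgE (by omega)
  | succ s ih => exact S.DgL rs_le (S.DgR (S.Dgl (by omega)) (ih (by omega)))

theorem comL {i j : ℕ} (hi : i ≤ 2 * S.n) (hj : j ≤ 2 * S.n) (h : cart S.n i j = 0) : S.adL i (S.E j) = 0 := by
  rw [S.adL_deg i (S.DgE hj)]; exact S.S1 i j hi hj h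
theorem comR {i j : ℕ} (hi : i ≤ 2 * S.n) (hj : j ≤ 2 * S.n) (h : cart S.n j i = 0) : S.adR i (S.E j) = 0 := by
  rw [S.adR_deg i (S.DgE hj)]; exact S.S1 j i hj hi h

theorem kerL_L {i j : ℕ} {x : A} {μ : Λ} (hd : S.Dg μ x) (hx : S.adL i x = 0) (hj : S.adL i (S.E j) = 0) :
    S.adL i (S.adL j x) = 0 := by
  rw [S.adL_deg j hd, map_sub, map_smul, S.kerL_mul hj hx, S.kerL_mul hx hj]; simp
theorem kerL_R {i j : ℕ} {x : A} {μ : Λ} (hd : S.Dg μ x) (hx : S.adL i x = 0) (hj : S.adL i (S.E j) = 0) :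
    S.adL i (S.adR j x) = 0 := by
  rw [S.adR_deg j hd, map_sub, map_smul, S.kerL_mul hj hx, S.kerL_mul hx hj]; simp
theorem kerR_L {i j : ℕ} {x : A} {μ : Λ} (hd : S.Dg μ x) (hx : S.adR i x = 0) (hj : S.adR i (S.E j) = 0) :
    S.adR i (S.adL j x) = 0 := by
  rw [S.adL_deg j hd, map_sub, map_smul, S.kerR_mul hj hx, S.kerR_mul hx hj]; simp
theorem kerR_R {i j : ℕ} {x : A} {μ : Λ} (hd : S.Dg μ x) (hx : S.adR i x = 0) (hj : S.adR i (S.E j) = 0) :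
    S.adR i (S.adR j x) = 0 := by
  rw [S.adR_deg j hd, map_sub, map_smul, S.kerR_mul hj hx, S.kerR_mul hx hj]; simp

theorem NL_E {i j : ℕ} (hi : i ≤ 2 * S.n) (hj : j ≤ 2 * S.n) (hin : i ≠ S.n) (hij : i ≠ j) :
    Nil (S.adL i) (S.E j) := by
  have hne := cart_self_ne S.hn hi hin
  have d1 := S.DgE hj
  have d2 := S.DgL hi d1
  have d3 := S.DgL hi d2
  rcases cart_cases S.hn hi hj hin hij with h | h | h
  · exact ⟨1, by simpa using S.comL hi hj h⟩
  · refine ⟨2, ?_⟩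
    rw [pow_two, Module.End.mul_apply, S.adL_deg i d2, S.adL_deg i d1, add_comm (S.α j)]
    exact S.S2 i j hi hj hij h hne
  · refine ⟨3, ?_⟩
    rw [pow_succ, pow_two, Module.End.mul_apply, Module.End.mul_apply, S.adL_deg i d3, S.adL_deg i d2,
      S.adL_deg i d1, add_comm (S.α j), add_comm _ (S.α i)]
    exact S.S3 i j hi hj hij h hne

theorem NR_E {i j : ℕ} (hi : i ≤ 2 * S.n) (hj : j ≤ 2 * S.n) (hin : i ≠ S.n) (hij : i ≠ j)  :
    Nil (S.adR i) (S.E j) := by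
  have hne := cart_self_ne S.hn hi hin
  have d1 := S.DgE hj
  have d2 := S.DgR hi d1
  have d3 := S.DgR hi d2
  have n1 := S.χne (S.α i) (S.α i)
  have n2 := S.χne (S.α i) (S.α j)
  have n3 := S.χne (S.α j) (S.α i)
  have hQ := S.χp i j hi hj hij
  have hp := S.χd i hi hin
  rcases cart_cases S.hn hi hj hin hij with h | h | h
  · refine ⟨1, ?_⟩
    have h1 := S.S1 i j hi hj h
    rw [h] at hQ
    simp only [mul_zero, zpow_zero] at hQ
    simp only [pow_one]
    rw [S.adR_deg i d1]
    have : S.E j * S.E i - (S.χ (S.α i) (S.α j))⁻¹ • (S.E i * S.E j)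
      = (-(S.χ (S.α i) (S.α j))⁻¹) • (S.E i * S.E j - (S.χ (S.α j) (S.α i))⁻¹ • (S.E j * S.E i)) := by
      match_scalars
      · field_simp; exact hQ
      · field_simp
    rw [this, h1, smul_zero]
  · refine ⟨2, ?_⟩
    have h1 := S.S2 i j hi hj hij h hne
    rw [pow_two, Module.End.mul_apply, S.adR_deg i d2, S.adR_deg i d1]
    have hQ' : S.χ (S.α i) (S.α j) * S.χ (S.α j) (S.α i) * S.χ (S.α i) (S.α i) = 1 := by
      rw [hQ, hp, ← zpow_add₀ S.hq0, ← h]; simp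
    rw [S.χl] at h1
    rw [S.χr]
    generalize S.χ (S.α i) (S.α j) = b at *
    generalize S.χ (S.α j) (S.α i) = a at *
    generalize S.χ (S.α i) (S.α i) = p at *
    rw [← smul_zero ((b ^ 2 * p)⁻¹), ← h1]
    have hb : b = (a * p)⁻¹ := by field_simp; linear_combination hQ'
    subst hb
    simp only [mul_sub, sub_mul, smul_mul_assoc, mul_smul_comm, mul_assoc]
    match_scalars <;> field_simp
  · refine ⟨3, ?_⟩
    have h1 := S.S3 i j hi hj hij h hne
    rw [pow_succ, pow_two, Module.End.mul_apply, Module.End.mul_apply, S.adR_deg i d3, S.adR_deg i d2,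
      S.adR_deg i d1]
    have hQ' : S.χ (S.α i) (S.α j) * S.χ (S.α j) (S.α i) * S.χ (S.α i) (S.α i) ^ 2 = 1 := by
      rw [hQ, hp, ← zpow_natCast, ← zpow_mul, ← zpow_add₀ S.hq0, ← h]
      convert zpow_zero _ using 2
      push_cast; ring
    simp only [S.χl] at h1
    simp only [S.χr]
    generalize S.χ (S.α i) (S.α j) = b at *
    generalize S.χ (S.α j) (S.α i) = a at *
    generalize S.χ (S.α i) (S.α i) = p at *
    rw [← smul_zero (-(b ^ 3 * p ^ 3)⁻¹), ← h1]
    have hb : b = (a * p ^ 2)⁻¹ := by field_simp; linear_combination hQ'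
    subst hb
    simp only [mul_sub, sub_mul, smul_mul_assoc, mul_smul_comm, mul_assoc]
    match_scalars <;> field_simp <;> ring

theorem NL_br {i : ℕ} (hi : i ≤ 2 * S.n) {x y : A} (c : k) (hx : Nil (S.adL i) x) (hy : Nil (S.adL i) y) :
    Nil (S.adL i) (x * y - c • (y * x)) := (S.NL_mul hi hx hy).sub ((S.NL_mul hi hy hx).smul c)
theorem NR_br {i : ℕ} (hi : i ≤ 2 * S.n) {x y : A} (c : k) (hx : Nil (S.adR i) x) (hy : Nil (S.adR i) y) :
    Nil (S.adR i) (x * y - c • (y * x)) := (S.NR_mul hi hx hy).sub ((S.NR_mul hi hy hx).smul c)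

theorem NL_X {i s : ℕ} (hi : i ≤ 2 * S.n) (hin : S.n < i) (hs : s ≤ 2 * S.n - 1) : Nil (S.adL i) (S.X s) := by
  induction s with
  | zero => exact S.NL_E hi (by omega) (by omega) (by omega)
  | succ s ih =>
    have h0 := ih (by omega)
    have hl := ls_lt (n := S.n) (s := s) (by omega)
    have h1 : Nil (S.adL i) (S.adR (ls S.n s) (S.X s)) := by
      rw [S.adR_deg _ (S.DgX (by omega))]
      exact S.NL_br hi _ h0 (S.NL_E hi (by omega) (by omega) (by omega))
    rw [X]
    by_cases h : rs S.n s = i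
    · rw [h]; exact h1.D
    · rw [S.adL_deg _ (S.DgR (by omega) (S.DgX (by omega)))]
      exact S.NL_br hi _ (S.NL_E hi rs_le (by omega) (by omega)) h1
theorem NR_X {i s : ℕ} (hin : i < S.n) (hs : s ≤ 2 * S.n - 1) : Nil (S.adR i) (S.X s) := by
  have hi : i ≤ 2 * S.n := by omega
  induction s with
  | zero => exact S.NR_E hi (by omega) (by omega) (by omega)
  | succ s ih =>
    have h0 := ih (by omega)
    have hl := ls_lt (n := S.n) (s := s) (by omega)
    have hr := rs_gt (n := S.n) (s := s) (by omega)
    have h1 : Nil (S.adR i) (S.adR (ls S.n s) (S.X s)) := by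
      by_cases h : ls S.n s = i
      · rw [h]; exact h0.D
      rw [S.adR_deg _ (S.DgX (by omega))]
      exact S.NR_br hi _ h0 (S.NR_E hi (by omega) (by omega) (by omega))
    rw [X]
    rw [S.adL_deg _ (S.DgR (by omega) (S.DgX (by omega)))]
    exact S.NR_br hi _ (S.NR_E hi rs_le (by omega) (by omega)) h1
end QA
end QAux

namespace QAux
theorem wt_l {n s : ℕ} (hn : 2 ≤ n) (hs : s < 2 * n - 1) :
    2 * pr n (fX n s) (ls n s) + cart n (ls n s) (ls n s) = 0 := by
  have := ls_lt hs
  rw [f4l hn hs, cart_self hn (by omega)]; unfold ls; grind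
theorem wt_r {n s : ℕ} (hn : 2 ≤ n) (hs : s < 2 * n - 1) :
    2 * pr n (fX n s) (rs n s) + cart n (rs n s) (rs n s) = 0 := by
  rw [f4r hn hs, cart_self hn rs_le]; unfold rs ls; grind

namespace QA
variable {k A Λ : Type} [Field k] [Ring A] [Algebra k A] [AddCommGroup Λ] (S : QA k A Λ)

def T (s : ℕ) : Prop := ∀ i, i ≤ 2 * S.n → (s = 0 → i ≠ S.n) →
  (0 < s → i ≠ ls S.n (s - 1) ∧ i ≠ rs S.n (s - 1)) → S.C i (S.X s) = 0

theorem T_l {s : ℕ} (h : S.T s) (hs : s < 2 * S.n - 1) : S.C (ls S.n s) (S.X s) = 0 := by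
  have hn := S.hn
  apply h <;> simp only [rs, ls] <;> omega
theorem T_r {s : ℕ} (h : S.T s) (hs : s < 2 * S.n - 1) : S.C (rs S.n s) (S.X s) = 0 := by
  have hn := S.hn
  apply h <;> simp only [rs, ls] <;> omega

theorem QLR {i j : ℕ} (hi : i < S.n) (hj : S.n < j) (hj2 : j ≤ 2 * S.n) : S.Q (S.α i) (S.α j) = 1 :=
  S.Q0 (by omega) hj2 (cart_LR hi hj hj2)

theorem C_R_r {s : ℕ} (h : S.T s) (hs : s < 2 * S.n - 1) :
    S.C (rs S.n s) (S.adR (ls S.n s) (S.X s)) = 0 := by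
  have hl := ls_lt hs
  have hr := rs_gt hs
  rw [S.C_Rn rs_le (by omega) (by omega) (S.DgX (by omega)), S.T_r h hs]; simp

theorem Ca {s : ℕ} (h : S.T s) (hs : s < 2 * S.n - 1) :
    S.C (ls S.n s) (S.X (s + 1)) = (1 - (S.Q (S.dg s) (S.α (ls S.n s)))⁻¹) •
      (S.adL (rs S.n s) (S.X s) * S.Lg (S.α (ls S.n s))) := by
  have hl := ls_lt hs
  have hr := rs_gt hs
  have d := S.DgX (s := s) (by omega)
  rw [X, S.C_Ln (by omega) rs_le (by omega) (S.DgR (by omega) d), S.C_R (by omega) d, S.T_l h hs]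
  simp only [mul_zero, zero_mul, smul_zero, sub_zero, add_zero]
  rw [mul_smul_comm, smul_mul_assoc, smul_comm _ (1 - _ : k), ← smul_sub,
    S.br_LL rs_le (S.QLR hl hr rs_le) d, Q, mul_inv_rev]
theorem Cb {s : ℕ} (h : S.T s) (hs : s < 2 * S.n - 1) :
    S.C (rs S.n s) (S.X (s + 1)) = ((S.χ (S.dg s + S.α (ls S.n s)) (S.α (rs S.n s)))⁻¹ *
       (1 - S.Q (S.dg s) (S.α (rs S.n s)))) •
      (S.adR (ls S.n s) (S.X s) * S.Kg (S.α (rs S.n s))) := by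
  have hl := ls_lt hs
  have hr := rs_gt hs
  have d := S.DgX (s := s) (by omega)
  rw [X, S.C_L rs_le (S.DgR (by omega) d), S.C_R_r h hs]
  simp only [mul_zero, zero_mul, smul_zero, sub_zero, add_zero]
  congr 1
  have hQ := S.QLR hl hr rs_le
  have e : S.Q (S.dg s) (S.α (rs S.n s)) = S.Q (S.dg s + S.α (ls S.n s)) (S.α (rs S.n s)) := by
    rw [Q_add, hQ, mul_one]
  have := S.χne (S.dg s + S.α (ls S.n s)) (S.α (rs S.n s))
  rw [e, Q]
  field_simp

theorem W1 {s : ℕ} (h : S.T s) (hs : s < 2 * S.n - 1) :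
    S.adR (ls S.n s) (S.adR (ls S.n s) (S.X s)) = 0 := by
  have hl := ls_lt hs
  have d := S.DgX (s := s) (by omega)
  have := S.slR (i := ls S.n s) (by omega) d (S.T_l h hs) (S.NR_X hl (by omega)) (S.hpp (by omega) (by omega)) 1
    (by rw [S.Qdg (by omega) (by omega), S.χd _ (by omega) (by omega), pow_one, ← zpow_add₀ S.hq0,
          wt_l S.hn hs, zpow_zero])
  simpa [pow_two] using this
theorem NL_R {i s : ℕ} (hi : i ≤ 2 * S.n) (hin : S.n < i) (hs : s < 2 * S.n - 1) :
    Nil (S.adL i) (S.adR (ls S.n s) (S.X s)) := by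
  have hl := ls_lt hs
  rw [S.adR_deg _ (S.DgX (by omega))]
  exact S.NL_br hi _ (S.NL_X hi hin (by omega)) (S.NL_E hi (by omega) (by omega) (by omega))
theorem W2 {s : ℕ} (h : S.T s) (hs : s < 2 * S.n - 1) :
    S.adL (rs S.n s) (S.adL (rs S.n s) (S.adR (ls S.n s) (S.X s))) = 0 := by
  have hl := ls_lt hs
  have hr := rs_gt hs
  have d := S.DgX (s := s) (by omega)
  have := S.slL (i := rs S.n s) rs_le (S.DgR (by omega) d) (S.C_R_r h hs) (S.NL_R rs_le hr hs)
    (S.hpp rs_le (by omega)) 1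
    (by rw [Q_add, S.QLR hl hr rs_le, mul_one, S.Qdg (by omega) rs_le, S.χd _ rs_le (by omega), pow_one,
          ← zpow_add₀ S.hq0, wt_r S.hn hs, zpow_zero])
  simpa [pow_two] using this

theorem sl0R {i s : ℕ} (hi : i < S.n) (hs : s ≤ 2 * S.n - 1) (hC : S.C i (S.X s) = 0)
    (hw : pr S.n (fX S.n s) i = 0) : S.adR i (S.X s) = 0 := by
  have := S.slR (i := i) (by omega) (S.DgX hs) hC (S.NR_X hi hs) (S.hpp (by omega) (by omega)) 0
    (by rw [S.Qdg hs (by omega), hw]; simp)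
  simpa using this
theorem sl0L {i s : ℕ} (hi : S.n < i) (hi2 : i ≤ 2 * S.n) (hs : s ≤ 2 * S.n - 1) (hC : S.C i (S.X s) = 0)
    (hw : pr S.n (fX S.n s) i = 0) : S.adL i (S.X s) = 0 := by
  have := S.slL (i := i) (by omega) (S.DgX hs) hC (S.NL_X hi2 hi hs) (S.hpp (by omega) (by omega)) 0
    (by rw [S.Qdg hs (by omega), hw]; simp)
  simpa using this

/-- P -/
theorem PR {s : ℕ} (hT : ∀ t ≤ s, S.T t) (hs : s + 1 < 2 * S.n - 1) : S.adR (ls S.n (s + 1)) (S.X s) = 0 := by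
  have hn := S.hn
  have hl := ls_lt hs
  by_cases h : s + 1 = S.n
  · obtain ⟨t, rfl⟩ : ∃ t, s = t + 1 := ⟨s - 1, by omega⟩
    have e : ls S.n (t + 1 + 1) = ls S.n t := by unfold ls; omega
    have hl' := ls_lt (n := S.n) (s := t) (by omega)
    have hr' := rs_gt (n := S.n) (s := t) (by omega)
    rw [e, X]
    exact S.kerR_L (S.DgR (by omega) (S.DgX (by omega))) (S.W1 (hT t (by omega)) (by omega))
      (S.comR (by omega) rs_le (cart_RL hl' hr' rs_le))
  · refine S.sl0R hl (by omega) ?_ (f3l hn hs h)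
    apply hT s le_rfl <;> simp only [rs, ls] <;> omega
theorem PL {s : ℕ} (hT : ∀ t ≤ s, S.T t) (hs : s + 1 < 2 * S.n - 1) : S.adL (rs S.n (s + 1)) (S.X s) = 0 := by
  have hn := S.hn
  have hl := rs_gt hs
  by_cases h : s + 1 = S.n
  · obtain ⟨t, rfl⟩ : ∃ t, s = t + 1 := ⟨s - 1, by omega⟩
    have e : rs S.n (t + 1 + 1) = rs S.n t := by unfold rs ls; omega
    rw [e, X]
    exact S.W2 (hT t (by omega)) (by omega)
  · refine S.sl0L hl rs_le (by omega) ?_ (f3r hn hs h)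
    apply hT s le_rfl <;> simp only [rs, ls] <;> omega

theorem T0 : S.T 0 := fun i hi h _ => S.CEn hi (by omega) (h rfl).symm

theorem T_gen {s i : ℕ} (hs : s < 2 * S.n - 1) (hi : i ≤ 2 * S.n) (h1 : i ≠ ls S.n s) (h2 : i ≠ rs S.n s)
    (h : S.C i (S.X s) = 0) : S.C i (S.X (s + 1)) = 0 := by
  have hl := ls_lt hs
  have d := S.DgX (s := s) (by omega)
  rw [X, S.C_Ln hi rs_le h2.symm (S.DgR (by omega) d), S.C_Rn hi (by omega) h1.symm d, h]
  simp

theorem T1 : S.T 1 := by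
  intro i hi _ h
  have hn := S.hn
  obtain ⟨h1, h2⟩ := h one_pos
  simp only [Nat.sub_self] at h1 h2
  by_cases hin : i = S.n
  · subst hin
    have hs : 0 < 2 * S.n - 1 := by omega
    have hl := ls_lt hs
    have hr := rs_gt hs
    have dl := S.DgE (i := ls S.n 0) (by omega)
    have d := S.DgX (s := 0) (by omega)
    have key : S.C S.n (S.adR (ls S.n 0) (S.X 0)) = ((S.χ (S.α (ls S.n 0)) (S.α S.n))⁻¹ - S.χ (S.α S.n) (S.α (ls S.n 0)))
       • (S.E (ls S.n 0) * S.Kg (S.α S.n)) := by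
      rw [S.C_Rn hi (by omega) h1.symm d, X, S.CEs hi, add_mul, neg_mul, dl.1, dl.2]
      simp only [mul_add, mul_neg, dg]
      module
    rw [X, S.C_Ln hi rs_le h2.symm (S.DgR (by omega) d), key]
    rw [mul_smul_comm, smul_mul_assoc, smul_comm _ (_ - _ : k), ← smul_sub, dg, add_comm (S.α S.n),
      S.br_LK rs_le dl, S.comL rs_le (by omega) (cart_RL hl hr rs_le)]
    simp
  · exact S.T_gen (by omega) hi h1 h2 (S.T0 i hi (fun _ => hin) (by omega))

theorem T_step {s : ℕ} (hT : ∀ t ≤ s + 1, S.T t) (hs : s + 1 < 2 * S.n - 1) : S.T (s + 2) := by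
  intro i hi _ h
  have hn := S.hn
  obtain ⟨h1, h2⟩ := h (by omega)
  simp only [show s + 2 - 1 = s + 1 by omega] at h1 h2
  have hl := ls_lt hs
  have hr := rs_gt hs
  have hl' := ls_lt (n := S.n) (s := s) (by omega)
  have hr' := rs_gt (n := S.n) (s := s) (by omega)
  have d := S.DgX (s := s) (by omega)
  have d1 := S.DgX (s := s + 1) (by omega)
  have pR := S.PR (fun t ht => hT t (by omega)) hs
  have pL := S.PL (fun t ht => hT t (by omega)) hs
  by_cases e1 : i = ls S.n s
  · have key : S.C i (S.adR (ls S.n (s + 1)) (S.X (s + 1))) = 0 := by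
      rw [S.C_Rn hi (by omega) h1.symm d1, e1, S.Ca (hT s (by omega)) (by omega), dg, add_right_comm]
      rw [mul_smul_comm, smul_mul_assoc, smul_comm _ (1 - _ : k), ← smul_sub,
        S.br_RL (by omega) (S.DgL rs_le d),
        S.kerR_L d pR (S.comR (by omega) rs_le (cart_RL hl hr' rs_le))]
      simp
    rw [X, S.C_Ln hi rs_le h2.symm (S.DgR (by omega) d1), key]
    simp
  by_cases e2 : i = rs S.n s
  · have dR := S.DgR (i := ls S.n s) (by omega) d
    have key : ∃ c : k, S.C i (S.adR (ls S.n (s + 1)) (S.X (s + 1))) =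
        c • (S.adR (ls S.n (s + 1)) (S.adR (ls S.n s) (S.X s)) * S.Kg (S.α (rs S.n s))) := by
      rw [S.C_Rn hi (by omega) h1.symm d1, e2, S.Cb (hT s (by omega)) (by omega), dg]
      rw [mul_smul_comm, smul_mul_assoc, smul_comm _ (_ * _ : k), ← smul_sub,
        S.br_RK (by omega) (by rw [Q_comm]; exact S.QLR hl hr' rs_le) dR, smul_smul]
      exact ⟨_, rfl⟩
    obtain ⟨c, hc⟩ := key
    rw [X, S.C_Ln hi rs_le h2.symm (S.DgR (by omega) d1), hc, dg, add_right_comm]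
    rw [mul_smul_comm, smul_mul_assoc, smul_comm _ c, ← smul_sub,
      S.br_LK rs_le (S.DgR (by omega) dR),
      S.kerL_R dR (S.kerL_R d pL (S.comL rs_le (by omega) (cart_RL hl' hr rs_le)))
        (S.comL rs_le (by omega) (cart_RL hl hr rs_le))]
    simp
  · exact S.T_gen hs hi h1 h2 (hT (s + 1) le_rfl i hi (by omega) (fun _ => ⟨e1, e2⟩))

theorem Tall (s : ℕ) : s ≤ 2 * S.n - 1 → S.T s := by
  induction s using Nat.strong_induction_on with
  | _ s ih =>
    intro hs
    match s, ih, hs with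
    | 0, _, _ => exact S.T0
    | 1, _, _ => exact S.T1
    | s + 2, ih, hs => exact S.T_step (fun t ht => ih t (by omega) (by omega)) (by omega)

theorem CX0 {s i : ℕ} (hs : s + 1 ≤ 2 * S.n - 1) (hi : i ≤ 2 * S.n) (h1 : i ≠ ls S.n s) (h2 : i ≠ rs S.n s) :
    S.C i (S.X (s + 1)) = 0 := S.Tall (s + 1) hs i hi (by omega) (fun _ => ⟨h1, h2⟩)

/-- E_n commutes with the middle X's -/
theorem En2 : S.E S.n * S.E S.n = 0 := by
  have h := S.S1 S.n S.n (by omega) (by omega) (cart_nn S.hn)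
  rw [S.χn] at h
  have h2 : (2 : k) • (S.E S.n * S.E S.n) = 0 := by
    rw [← h]; match_scalars; norm_num
  exact (smul_eq_zero.mp h2).resolve_left S.two

theorem En_X1 : S.adR S.n (S.X 1) = 0 := by
  have hn := S.hn
  have e1 : ls S.n 0 = S.n - 1 := by unfold ls; omega
  have e2 : rs S.n 0 = S.n + 1 := by unfold rs ls; omega
  have dn := S.DgE (i := S.n) (by omega)
  have dl := S.DgR (i := S.n - 1) (by omega) dn
  have h4 := S.S4
  have hE := S.En2
  have hGH := S.S1 (S.n - 1) (S.n + 1) (by omega) (by omega) (cart_far (by omega) (by omega))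
  have q1 := S.χp (S.n - 1) (S.n + 1) (by omega) (by omega) (by omega)
  rw [cart_far (by omega) (by omega)] at q1
  have q2 := S.χp (S.n - 1) S.n (by omega) (by omega) (by omega)
  have c2 : cart S.n (S.n - 1) S.n = -1 := by
    have := cart_next (i := S.n - 1) hn (by omega)
    rw [show S.n - 1 + 1 = S.n by omega] at this
    rw [this]; grind
  have q3 := S.χp S.n (S.n + 1) (by omega) (by omega) (by omega)
  have c3 : cart S.n S.n (S.n + 1) = 1 := by
    rw [cart_next hn (by omega)]; grind
  rw [c2] at q2
  rw [c3] at q3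
  have hnn := S.χn
  have d1 := S.DgX (s := 1) (by omega)
  rw [S.adR_deg S.n d1, X, X, e1, e2, S.adL_deg _ dl, S.adR_deg _ dn, dg, dg, e1, e2]
  simp only [S.χl, S.χr] at h4 ⊢
  have n1 := S.χne (S.α S.n) (S.α (S.n - 1))
  have n2 := S.χne (S.α (S.n - 1)) (S.α S.n)
  have n3 := S.χne (S.α S.n) (S.α (S.n + 1))
  have n4 := S.χne (S.α (S.n + 1)) (S.α S.n)
  have n5 := S.χne (S.α (S.n + 1)) (S.α (S.n - 1))
  have n6 := S.χne (S.α (S.n - 1)) (S.α (S.n + 1))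
  rw [hnn] at h4 ⊢
  generalize S.χ (S.α S.n) (S.α (S.n - 1)) = a at *
  generalize S.χ (S.α (S.n - 1)) (S.α S.n) = b at *
  generalize S.χ (S.α S.n) (S.α (S.n + 1)) = c at *
  generalize S.χ (S.α (S.n + 1)) (S.α S.n) = d at *
  generalize S.χ (S.α (S.n + 1)) (S.α (S.n - 1)) = e at *
  generalize S.χ (S.α (S.n - 1)) (S.α (S.n + 1)) = f at *
  have hq0 := S.hq0
  generalize S.q = q at *
  generalize S.E S.n = E at *
  generalize S.E (S.n - 1) = G at *
  generalize S.E (S.n + 1) = H at *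
  have hf : f = e⁻¹ := by
    simp at q1; exact eq_inv_of_mul_eq_one_left q1
  have hb : b = q⁻¹ ^ 2 * a⁻¹ := by
    field_simp
    have : q ^ (2 * (-1 : ℤ)) = (q ^ 2)⁻¹ := by
      rw [show (2 * (-1 : ℤ)) = -((2 : ℕ) : ℤ) by norm_num, zpow_neg, zpow_natCast]
    rw [this] at q2
    field_simp at q2
    linear_combination q2
  have hd : d = q ^ 2 * c⁻¹ := by
    field_simp
    rw [show (2 * (1 : ℤ)) = ((2 : ℕ) : ℤ) by norm_num, zpow_natCast] at q3
    linear_combination q3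
  subst hf hb hd
  have hGH' : G * H = e⁻¹ • (H * G) := sub_eq_zero.mp hGH
  have hGH2 : ∀ z, G * (H * z) = e⁻¹ • (H * (G * z)) := by
    intro z; rw [← mul_assoc, hGH', smul_mul_assoc, mul_assoc]
  have hE2 : ∀ z, E * (E * z) = 0 := by
    intro z; rw [← mul_assoc, hE, zero_mul]
  simp only [mul_sub, sub_mul, smul_mul_assoc, mul_smul_comm, mul_assoc, hE, hE2, hGH', hGH2, mul_zero, smul_zero, sub_zero, zero_sub] at h4 ⊢
  rw [← smul_zero (a * (q ^ 2 * c⁻¹) * e * (q ^ 2 * c⁻¹) * (q⁻¹ ^ 2 * a⁻¹)), ← h4]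
  match_scalars <;> field_simp <;> ring
end QA
end QAux

namespace QAux
namespace QA
variable {k A Λ : Type} [Field k] [Ring A] [Algebra k A] [AddCommGroup Λ] (S : QA k A Λ)

theorem En_X {s : ℕ} (hs : s + 1 ≤ 2 * S.n - 2) : S.adR S.n (S.X (s + 1)) = 0 := by
  have hn := S.hn
  induction s with
  | zero => exact S.En_X1
  | succ s ih =>
    have hl : ls S.n (s + 1) + 1 < S.n := by unfold ls; omega
    have hr : S.n + 1 < rs S.n (s + 1) := by unfold rs; omega
    have d := S.DgX (s := s + 1) (by omega)
    rw [X]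
    exact S.kerR_L (S.DgR (by omega) d)
      (S.kerR_R d (ih (by omega)) (S.comR (by omega) (by omega) (cart_far hl (by omega))))
      (S.comR (by omega) rs_le (cart_far' hr rs_le))

theorem sqR {i : ℕ} (hi : i ≤ 2 * S.n) {μ : Λ} {x : A} (h : S.Dg μ x) (hx : x * x = 0)
    (hD : S.adR i (S.adR i x) = 0) (hp : S.χ (S.α i) (S.α i) ^ 2 ≠ 1) : S.adR i x * S.adR i x = 0 := by
  have h1 := congrArg (fun z => S.adR i (S.adR i z)) hx
  simp only [adR_mul, map_zero, map_add, hD, S.cK_deg i h, S.cK_deg i (S.DgR hi h), S.χr, mul_smul_comm,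
    map_smul, zero_mul, mul_zero, smul_zero, zero_add, add_zero] at h1
  rw [← add_smul] at h1
  refine (smul_eq_zero.mp h1).resolve_left ?_
  have n1 := S.χne (S.α i) μ
  have n2 := S.χne (S.α i) (S.α i)
  intro h2
  field_simp at h2
  apply hp
  linear_combination (S.χ (S.α i) (S.α i) - 1) * h2
theorem sqL {i : ℕ} (hi : i ≤ 2 * S.n) {μ : Λ} {x : A} (h : S.Dg μ x) (hx : x * x = 0)
    (hD : S.adL i (S.adL i x) = 0) (hp : S.χ (S.α i) (S.α i) ^ 2 ≠ 1) : S.adL i x * S.adL i x = 0 := by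
  have h1 := congrArg (fun z => S.adL i (S.adL i z)) hx
  simp only [adL_mul, map_zero, map_add, hD, S.cL_deg i h, S.cL_deg i (S.DgL hi h), S.χl, mul_smul_comm,
    smul_mul_assoc, map_smul, zero_mul, mul_zero, smul_zero, zero_add, add_zero] at h1
  rw [← add_smul] at h1
  refine (smul_eq_zero.mp h1).resolve_left ?_
  have n1 := S.χne μ (S.α i)
  have n2 := S.χne (S.α i) (S.α i)
  intro h2
  field_simp at h2
  apply hp
  linear_combination (S.χ (S.α i) (S.α i) - 1) * h2

theorem X_sq {s : ℕ} (hs : s ≤ 2 * S.n - 1) : S.X s * S.X s = 0 := by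
  induction s with
  | zero => exact S.En2
  | succ s ih =>
    have hl := ls_lt (n := S.n) (s := s) (by omega)
    have hr := rs_gt (n := S.n) (s := s) (by omega)
    have hT := S.Tall s (by omega)
    have d := S.DgX (s := s) (by omega)
    rw [X]
    exact S.sqL rs_le (S.DgR (by omega) d)
      (S.sqR (by omega) d (ih (by omega)) (S.W1 hT (by omega)) (S.hpp (by omega) (by omega) 2 (by omega)))
      (S.W2 hT (by omega)) (S.hpp rs_le (by omega) 2 (by omega))

theorem Qll {s : ℕ} (hs : s < 2 * S.n - 1) :
    S.Q (S.dg s) (S.α (ls S.n s)) * S.χ (S.α (ls S.n s)) (S.α (ls S.n s)) = 1 := by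
  have hl := ls_lt hs
  rw [S.Qdg (by omega) (by omega), S.χd _ (by omega) (by omega), ← zpow_add₀ S.hq0, wt_l S.hn hs, zpow_zero]
theorem Qrr {s : ℕ} (hs : s < 2 * S.n - 1) :
    S.Q (S.dg s) (S.α (rs S.n s)) * S.χ (S.α (rs S.n s)) (S.α (rs S.n s)) = 1 := by
  have hl := rs_gt hs
  rw [S.Qdg (by omega) rs_le, S.χd _ rs_le (by omega), ← zpow_add₀ S.hq0, wt_r S.hn hs, zpow_zero]
theorem QlQr {s : ℕ} (hs : s < 2 * S.n - 1) :
    S.Q (S.dg s) (S.α (ls S.n s)) * S.Q (S.dg s) (S.α (rs S.n s)) = 1 := by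
  have hl := ls_lt hs
  rw [S.Qdg (by omega) (by omega), S.Qdg (by omega) rs_le, ← zpow_add₀ S.hq0, f4l S.hn hs, f4r S.hn hs]
  split_ifs <;> simp

theorem χdg {s : ℕ} (hs : s ≤ 2 * S.n - 1) : S.χ (S.dg s) (S.dg s) = -1 := by
  induction s with
  | zero => exact S.χn
  | succ s ih =>
    have hl := ls_lt (n := S.n) (s := s) (by omega)
    have hr := rs_gt (n := S.n) (s := s) (by omega)
    have h1 := S.Qll (s := s) (by omega)
    have h2 := S.Qrr (s := s) (by omega)
    have h3 := S.QLR hl hr rs_le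
    have h0 := ih (by omega)
    unfold Q at h1 h2 h3
    rw [dg]
    simp only [S.χl, S.χr, h0]
    linear_combination (-1 : k) * h1 - S.χ (S.dg s) (S.α (ls S.n s)) * S.χ (S.α (ls S.n s)) (S.dg s) * S.χ (S.α (ls S.n s)) (S.α (ls S.n s)) * h2
      - S.χ (S.dg s) (S.α (ls S.n s)) * S.χ (S.α (ls S.n s)) (S.dg s) * S.χ (S.α (ls S.n s)) (S.α (ls S.n s)) *
      S.χ (S.dg s) (S.α (rs S.n s)) * S.χ (S.α (rs S.n s)) (S.dg s) * S.χ (S.α (rs S.n s)) (S.α (rs S.n s)) * h3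

/-- degree of Z -/
def δ : Λ := S.dg S.n + S.dg (S.n - 1)
theorem δ_eq {j : ℕ} (hj : j < S.n) : S.dg (S.n + j) + S.dg (S.n - 1 - j) = S.δ := by
  induction j with
  | zero => rfl
  | succ j ih =>
    rw [← ih (by omega)]
    obtain ⟨t, ht⟩ : ∃ t, S.n = t + 2 + j := ⟨S.n - 2 - j, by omega⟩
    have e1 : S.n - 1 - j = (S.n - 1 - (j + 1)) + 1 := by omega
    have e2 : ls S.n (S.n + j) = ls S.n (S.n - 1 - (j + 1)) := by unfold ls; omega
    rw [e1, ← add_assoc, dg, dg, rs, rs, e2]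
    abel
def a : ℕ → k
  | 0 => 1
  | j + 1 => a j * S.χ S.δ (S.α (2 * S.n - 1 - j)) * (S.χ (S.α (j + 1)) (S.dg (S.n - 2 - j)))⁻¹ *
      (S.χ (S.α (j + 1) + S.dg (S.n - 2 - j)) (S.α (2 * S.n - 1 - j)))⁻¹
def W (j : ℕ) : A := S.X (S.n + j) * S.X (S.n - 1 - j) -
   (S.χ (S.dg (S.n - 1 - j)) (S.dg (S.n + j)))⁻¹ • (S.X (S.n - 1 - j) * S.X (S.n + j))
def Z : A := ∑ j ∈ Finset.range S.n, S.a j • S.W j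

theorem DgW {j : ℕ} (hj : j < S.n) : S.Dg S.δ (S.W j) := by
  rw [← S.δ_eq hj]
  have d1 := S.DgX (s := S.n + j) (by omega)
  have d2 := S.DgX (s := S.n - 1 - j) (by omega)
  exact (d1.mul d2).sub ((d2.mul' d1).smul _)
theorem DgZ : S.Dg S.δ S.Z := by
  unfold Z
  apply Finset.sum_induction _ (fun z => S.Dg S.δ z) (fun _ _ h1 h2 => h1.add h2) (Dg.zero S _)
  intro j hj
  exact (S.DgW (Finset.mem_range.mp hj)).smul _
theorem NLZ {i : ℕ} (hi : i ≤ 2 * S.n) (hin : S.n < i) : Nil (S.adL i) S.Z := by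
  unfold Z
  apply Finset.sum_induction _ (fun z => Nil (S.adL i) z) (fun _ _ h1 h2 => h1.add h2) ⟨0, by simp⟩
  intro j hj
  have := Finset.mem_range.mp hj
  exact (S.NL_br hi _ (S.NL_X hi hin (by omega)) (S.NL_X hi hin (by omega))).smul _
theorem NRZ {i : ℕ} (hin : i < S.n) : Nil (S.adR i) S.Z := by
  unfold Z
  apply Finset.sum_induction _ (fun z => Nil (S.adR i) z) (fun _ _ h1 h2 => h1.add h2) ⟨0, by simp⟩
  intro j hj
  have := Finset.mem_range.mp hj
  exact (S.NR_br (by omega) _ (S.NR_X hin (by omega)) (S.NR_X hin (by omega))).smul _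

theorem Qδ {i : ℕ} (hi : i ≤ 2 * S.n) : S.Q S.δ (S.α i) = 1 := by
  have hn := S.hn
  have h := fX_sum (n := S.n) (i := 0) (j := i) (by omega)
  rw [← S.δ_eq (j := 0) (by omega), Q_add, S.Qdg (by omega) hi, S.Qdg (by omega) hi, ← zpow_add₀ S.hq0,
    ← mul_add, h]
  simp

theorem Cup {i j : ℕ} (hi : i ≤ 2 * S.n) (hj : j < S.n) (h1 : i ≠ j) (h2 : i ≠ 2 * S.n - j) :
    S.C i (S.X (S.n + j)) = 0 := by
  have hn := S.hn
  have e : ls S.n (S.n + j - 1) = j := by unfold ls; omega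
  have := S.CX0 (s := S.n + j - 1) (i := i) (by omega) hi (by rw [e]; exact h1) (by rw [rs, e]; exact h2)
  rwa [show S.n + j - 1 + 1 = S.n + j by omega] at this
theorem Cdn {i j : ℕ} (hi : i ≤ 2 * S.n) (hj : j < S.n) (h1 : i ≠ j + 1) (h2 : i ≠ 2 * S.n - 1 - j) :
    S.C i (S.X (S.n - 1 - j)) = 0 := by
  have hn := S.hn
  by_cases h : j = S.n - 1
  · rw [show S.n - 1 - j = 0 by omega, X]
    exact S.CEn hi (by omega) (by omega)
  · have e : ls S.n (S.n - 2 - j) = j + 1 := by unfold ls; omega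
    have := S.CX0 (s := S.n - 2 - j) (i := i) (by omega) hi (by rw [e]; exact h1) (by rw [rs, e]; omega)
    rwa [show S.n - 2 - j + 1 = S.n - 1 - j by omega] at this
theorem CW0 {i j : ℕ} (hi : i ≤ 2 * S.n) (hj : j < S.n) (h1 : i ≠ j) (h2 : i ≠ 2 * S.n - j)
    (h3 : i ≠ j + 1) (h4 : i ≠ 2 * S.n - 1 - j) : S.C i (S.W j) = 0 := by
  rw [W, map_sub, map_smul, C_mul, C_mul, S.Cup hi hj h1 h2, S.Cdn hi hj h3 h4]; simp

/-- q-commutation -/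
def qc (x : A) (ν : Λ) (y : A) (μ : Λ) : Prop := x * y = (S.χ μ ν)⁻¹ • (y * x)
theorem qc.mul {S : QA k A Λ} {x y z : A} {ν μ κ : Λ} (h1 : S.qc x ν y μ) (h2 : S.qc x ν z κ) :
    S.qc x ν (y * z) (μ + κ) := by
  unfold qc at *
  rw [← mul_assoc, h1, smul_mul_assoc, mul_assoc, h2, mul_smul_comm, smul_smul, S.χl, mul_assoc, mul_inv]
theorem qc.br {S : QA k A Λ} {x y z : A} {ν μ κ : Λ} (c : k) (h1 : S.qc x ν y μ) (h2 : S.qc x ν z κ) :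
    S.qc x ν (y * z - c • (z * y)) (μ + κ) := by
  have h3 := h1.mul h2
  have h4 := h2.mul h1
  rw [add_comm] at h4
  unfold qc at *
  rw [mul_sub, mul_smul_comm, h3, h4, sub_mul, smul_sub, smul_mul_assoc, smul_comm c]

theorem qcE {j i : ℕ} (hj : j + 1 < S.n) (h1 : j + 1 < i) (h2 : i + j + 1 < 2 * S.n) :
    S.qc (S.X (S.n + j)) (S.dg (S.n + j)) (S.E i) (S.α i) := by
  have hn := S.hn
  have d := S.DgX (s := S.n + j) (by omega)
  unfold qc
  rcases Nat.lt_trichotomy i S.n with h | h | h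
  · have := S.sl0R h (by omega) (S.Cup (i := i) (by omega) (by omega) (by omega) (by omega)) (fXA hn (by omega) h1 h2)
    rw [S.adR_deg i d] at this
    exact sub_eq_zero.mp this
  · subst h
    have := S.En_X (s := S.n + j - 1) (by omega)
    rw [show S.n + j - 1 + 1 = S.n + j by omega, S.adR_deg _ d] at this
    exact sub_eq_zero.mp this
  · have := S.sl0L h (by omega) (by omega) (S.Cup (i := i) (by omega) (by omega) (by omega) (by omega)) (fXA hn (by omega) h1 h2)
    rw [S.adL_deg i d] at this
    have hQ := S.Qdg (s := S.n + j) (j := i) (by omega) (by omega)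
    rw [fXA hn (by omega) h1 h2, mul_zero, zpow_zero] at hQ
    unfold Q at hQ
    rw [sub_eq_zero.mp this, smul_smul]
    have n1 := S.χne (S.dg (S.n + j)) (S.α i)
    have n2 := S.χne (S.α i) (S.dg (S.n + j))
    rw [← mul_inv, mul_comm (S.χ (S.α i) _), hQ, inv_one, one_smul]
theorem qcX {j t : ℕ} (hj : j + 1 < S.n) (ht : t + j + 2 ≤ S.n) :
    S.qc (S.X (S.n + j)) (S.dg (S.n + j)) (S.X t) (S.dg t) := by
  induction t with
  | zero => exact S.qcE hj (by omega) (by omega)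
  | succ t ih =>
    have h0 := ih (by omega)
    have d := S.DgX (s := t) (by omega)
    have e : ls S.n t = S.n - 1 - t := by unfold ls; omega
    have hl := S.qcE hj (i := ls S.n t) (by omega) (by omega)
    have hr := S.qcE hj (i := rs S.n t) (by rw [rs]; omega) (by rw [rs]; omega)
    rw [X, S.adL_deg _ (S.DgR (by omega) d), S.adR_deg _ d, dg, add_comm (_ + _) (S.α (rs _ _))]
    exact qc.br _ hr (qc.br _ h0 hl)
end QA
end QAux

namespace QAux
namespace QA
variable {k A Λ : Type} [Field k] [Ring A] [Algebra k A] [AddCommGroup Λ] (S : QA k A Λ)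

theorem a_step {j s t : ℕ} (hj : j + 1 < S.n) (hs : s = S.n + j) (ht : t = S.n - 2 - j) :
    S.a (j + 1) = S.a j * S.χ (S.dg s) (S.α (rs S.n s)) * S.χ (S.dg t) (S.α (ls S.n s)) := by
  have hn := S.hn
  have e1 : ls S.n s = j + 1 := by unfold ls; omega
  have e1' : ls S.n t = j + 1 := by unfold ls; omega
  have e2 : rs S.n s = 2 * S.n - 1 - j := by unfold rs; omega
  have e2' : rs S.n t = 2 * S.n - 1 - j := by unfold rs; omega
  have hd := S.δ_eq (j := j) (by omega)
  rw [show S.n - 1 - j = t + 1 by omega, dg, e1', e2', ← hs] at hd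
  have h1 := S.Qll (s := t) (by omega)
  have h2 := S.Qrr (s := t) (by omega)
  have h3 := S.QlQr (s := t) (by omega)
  rw [e1'] at h1 h3
  rw [e2'] at h2 h3
  rw [e1, e2, a, ← hd, ← ht]
  simp only [S.χl]
  unfold Q at *
  have n1 := S.χne (S.α (j + 1)) (S.dg t)
  have n2 := S.χne (S.α (j + 1)) (S.α (2 * S.n - 1 - j))
  have n3 := S.χne (S.dg t) (S.α (2 * S.n - 1 - j))
  have n4 := S.χne (S.α (2 * S.n - 1 - j)) (S.dg t)
  field_simp
  have h4 : S.χ (S.α (2 * S.n - 1 - j)) (S.α (2 * S.n - 1 - j)) =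
    S.χ (S.dg t) (S.α (j + 1)) * S.χ (S.α (j + 1)) (S.dg t) := by
    have n5 := mul_ne_zero n3 n4
    apply mul_left_cancel₀ n5
    rw [h2, mul_comm, h3]
  rw [h4]
  ring

theorem pairL {i r : ℕ} {x b A' B' : A} {ν β : Λ} (hx : S.Dg ν x) (hb : S.Dg β b)
    (hqc : S.qc x ν b β) (hQ : S.Q ν (S.α i) * S.Q ν (S.α r) = 1)
    (cx : S.C i x = 0) (cb : S.C i b = 0) (κ : k)
    (cA : S.C i A' = κ • (S.adL r x * S.Lg (S.α i)))
    (cB : S.C i B' = κ • (S.adL r b * S.Lg (S.α i))) :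
    S.C i (x * B' - (S.χ (β + S.α i + S.α r) ν)⁻¹ • (B' * x)) +
    (S.χ ν (S.α r) * S.χ β (S.α i)) •
      S.C i (A' * b - (S.χ β (ν + S.α i + S.α r))⁻¹ • (b * A')) = 0 := by
  have n1 := S.χne ν (S.α r)
  have n2 := S.χne (S.α r) ν
  have n3 := S.χne ν (S.α i)
  have n4 := S.χne (S.α i) ν
  have n5 := S.χne β (S.α i)
  have n6 := S.χne β (S.α r)
  have n7 := S.χne β ν
  have h := congrArg (fun z => S.χ ν (S.α r) • (S.adL r z * S.Lg (S.α i))) hqc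
  simp only [adL_mul, map_smul, S.cL_deg r hx, S.cL_deg r hb] at h
  simp only [map_sub, map_smul, C_mul, cx, cb, cA, cB, S.χl, S.χr]
  generalize S.adL r x = yx at *
  generalize S.adL r b = yb at *
  simp only [zero_mul, mul_zero, add_zero, zero_add, smul_mul_assoc, mul_smul_comm, mul_assoc, hx.2, hb.2, add_mul, smul_add, smul_smul] at h ⊢
  rw [mul_inv_cancel₀ n1, one_smul, add_comm, ← eq_sub_iff_add_eq] at h
  rw [h]
  unfold Q at hQ
  match_scalars
  · field_simp; linear_combination κ * hQ
  · field_simp; ring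
  · field_simp; ring

theorem pairR {i r : ℕ} {x b A' B' : A} {ν β : Λ} (hx : S.Dg ν x) (hb : S.Dg β b)
    (hqc : S.qc x ν b β) (hQ : S.Q β (S.α i) * S.Q β (S.α r) = 1)
    (cx : S.C r x = 0) (cb : S.C r b = 0) (κ : k)
    (cA : S.C r A' = ((S.χ (ν + S.α i) (S.α r))⁻¹ * κ) • (S.adR i x * S.Kg (S.α r)))
    (cB : S.C r B' = ((S.χ (β + S.α i) (S.α r))⁻¹ * κ) • (S.adR i b * S.Kg (S.α r))) :
    S.C r (x * B' - (S.χ (β + S.α i + S.α r) ν)⁻¹ • (B' * x)) +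
    (S.χ ν (S.α r) * S.χ β (S.α i)) •
      S.C r (A' * b - (S.χ β (ν + S.α i + S.α r))⁻¹ • (b * A')) = 0 := by
  have n1 := S.χne ν (S.α r)
  have n2 := S.χne (S.α r) ν
  have n3 := S.χne (S.α i) (S.α r)
  have n4 := S.χne (S.α i) ν
  have n5 := S.χne β (S.α i)
  have n6 := S.χne β (S.α r)
  have n7 := S.χne β ν
  have n8 := S.χne (S.α i) β
  have n9 := S.χne (S.α r) β
  have h := congrArg (fun z => (S.adR i z * S.Kg (S.α r))) hqc
  simp only [adR_mul, map_smul, S.cK_deg i hx, S.cK_deg i hb] at h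
  simp only [map_sub, map_smul, C_mul, cx, cb, cA, cB, S.χl, S.χr]
  generalize S.adR i x = yx at *
  generalize S.adR i b = yb at *
  simp only [zero_mul, mul_zero, add_zero, zero_add, smul_mul_assoc, mul_smul_comm, mul_assoc, hx.1, hb.1, add_mul, smul_add, smul_smul] at h ⊢
  rw [add_comm, ← eq_sub_iff_add_eq] at h
  rw [h]
  unfold Q at hQ
  match_scalars
  · field_simp; ring
  · field_simp; ring
  · field_simp; linear_combination κ * hQ

theorem CZ0 {i r : ℕ} {b A' : A} {β : Λ} (hb : S.Dg β b)
    (hb2 : b * b = 0) (hβ : S.χ β β = -1)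
    (cb : S.C i b = 0) (κ : k)
    (cA : S.C i A' = κ • (S.adL r b * S.Lg (S.α i))) :
      S.C i (A' * b - (S.χ β (β + S.α i + S.α r))⁻¹ • (b * A')) = 0 := by
  have n5 := S.χne β (S.α i)
  have n6 := S.χne β (S.α r)
  have h := congrArg (fun z => (S.adL r z * S.Lg (S.α i))) hb2
  simp only [adL_mul, map_zero, zero_mul, S.cL_deg r hb] at h
  simp only [map_sub, map_smul, C_mul, cb, cA, S.χr, hβ]
  generalize S.adL r b = yb at *
  simp only [zero_mul, mul_zero, add_zero, zero_add, smul_mul_assoc, mul_smul_comm, mul_assoc, hb.2, add_mul] at h ⊢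
  rw [add_eq_zero_iff_eq_neg] at h
  rw [h]
  match_scalars
  field_simp; ring

theorem CZN {i r : ℕ} {b A' : A} {β : Λ} (hb : S.Dg β b)
    (hb2 : b * b = 0) (hβ : S.χ β β = -1) (hQ : S.Q β (S.α i) * S.Q β (S.α r) = 1)
    (cb : S.C r b = 0) (κ : k)
    (cA : S.C r A' = κ • (S.adR i b * S.Kg (S.α r))) :
      S.C r (A' * b - (S.χ β (β + S.α i + S.α r))⁻¹ • (b * A')) = 0 := by
  have n5 := S.χne β (S.α i)
  have n6 := S.χne β (S.α r)
  have n7 := S.χne (S.α i) β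
  have h := congrArg (fun z => (S.adR i z * S.Kg (S.α r))) hb2
  simp only [adR_mul, map_zero, zero_mul, S.cK_deg i hb] at h
  simp only [map_sub, map_smul, C_mul, cb, cA, S.χr, hβ]
  generalize S.adR i b = yb at *
  simp only [zero_mul, mul_zero, add_zero, zero_add, smul_mul_assoc, mul_smul_comm, mul_assoc, hb.1, add_mul] at h ⊢
  rw [add_comm, add_eq_zero_iff_eq_neg] at h
  rw [h]
  unfold Q at hQ
  match_scalars
  field_simp; linear_combination κ * hQ

theorem CW_pairL {j : ℕ} (hj : j + 1 < S.n) :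
    S.C (j + 1) (S.a j • S.W j) + S.C (j + 1) (S.a (j + 1) • S.W (j + 1)) = 0 := by
  have hn := S.hn
  obtain ⟨s, hs⟩ : ∃ s, s = S.n + j := ⟨_, rfl⟩
  obtain ⟨t, ht⟩ : ∃ t, t = S.n - 2 - j := ⟨_, rfl⟩
  have e1 : ls S.n s = j + 1 := by unfold ls; omega
  have e1' : ls S.n t = j + 1 := by unfold ls; omega
  have e2 : rs S.n t = rs S.n s := by unfold rs; omega
  have q := S.qcX hj (t := t) (by omega)
  have cx := S.Cup (i := j + 1) (j := j) (by omega) (by omega) (by omega) (by omega)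
  have cb := S.Cdn (i := j + 1) (j := j + 1) (by omega) (by omega) (by omega) (by omega)
  rw [show S.n - 1 - (j + 1) = t by omega] at cb
  rw [← hs] at cx q
  have hQ := S.QlQr (s := s) (by omega)
  have hA := S.Ca (S.Tall s (by omega)) (by omega)
  have hB := S.Ca (S.Tall t (by omega)) (by omega)
  have hκ : S.Q (S.dg t) (S.α (ls S.n t)) = S.Q (S.dg s) (S.α (ls S.n s)) := by
    have := ls_lt (n := S.n) (s := s) (by omega)
    have := ls_lt (n := S.n) (s := t) (by omega)
    rw [S.Qdg (by omega) (by omega), S.Qdg (by omega) (by omega), f4l hn (by omega), f4l hn (by omega),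
      if_neg (by omega), if_neg (by omega)]
  rw [hκ] at hB
  rw [e1', e2] at hB
  rw [e1] at hA hB hQ
  have := S.pairL (S.DgX (by omega)) (S.DgX (by omega)) q hQ cx cb _ hA hB
  rw [S.a_step hj hs ht, W, W, show S.n - 1 - j = t + 1 by omega, show S.n - 1 - (j + 1) = t by omega, ← add_assoc,
    ← hs, dg, dg, e1', e1, e2, mul_assoc, mul_smul, map_smul, map_smul, map_smul, ← smul_add, this, smul_zero]

theorem CW_pairR {j : ℕ} (hj : j + 1 < S.n) :
    S.C (2 * S.n - 1 - j) (S.a j • S.W j) + S.C (2 * S.n - 1 - j) (S.a (j + 1) • S.W (j + 1)) = 0 := by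
  have hn := S.hn
  obtain ⟨s, hs⟩ : ∃ s, s = S.n + j := ⟨_, rfl⟩
  obtain ⟨t, ht⟩ : ∃ t, t = S.n - 2 - j := ⟨_, rfl⟩
  have e1 : ls S.n s = j + 1 := by unfold ls; omega
  have e1' : ls S.n t = ls S.n s := by unfold ls; omega
  have e2 : rs S.n t = 2 * S.n - 1 - j := by unfold rs; omega
  have e2' : rs S.n s = 2 * S.n - 1 - j := by unfold rs; omega
  have q := S.qcX hj (t := t) (by omega)
  have cx := S.Cup (i := 2 * S.n - 1 - j) (j := j) (by omega) (by omega) (by omega) (by omega)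
  have cb := S.Cdn (i := 2 * S.n - 1 - j) (j := j + 1) (by omega) (by omega) (by omega) (by omega)
  rw [show S.n - 1 - (j + 1) = t by omega] at cb
  rw [← hs] at cx q
  have hQ := S.QlQr (s := t) (by omega)
  have hA := S.Cb (S.Tall s (by omega)) (by omega)
  have hB := S.Cb (S.Tall t (by omega)) (by omega)
  have hκ : S.Q (S.dg t) (S.α (rs S.n t)) = S.Q (S.dg s) (S.α (rs S.n s)) := by
    rw [S.Qdg (by omega) rs_le, S.Qdg (by omega) rs_le, f4r hn (by omega), f4r hn (by omega),
      if_neg (by omega), if_neg (by omega)]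
  rw [hκ] at hB
  rw [e2, e1'] at hB hQ
  rw [e2'] at hA hB
  have := S.pairR (S.DgX (by omega)) (S.DgX (by omega)) q hQ cx cb _ hA hB
  rw [S.a_step hj hs ht, W, W, show S.n - 1 - j = t + 1 by omega, show S.n - 1 - (j + 1) = t by omega, ← add_assoc,
    ← hs, dg, dg, e1', e2, e2', mul_assoc, mul_smul, map_smul, map_smul, map_smul, ← smul_add, this, smul_zero]

theorem CW0_0 : S.C 0 (S.W 0) = 0 := by
  have hn := S.hn
  obtain ⟨s, hs⟩ : ∃ s, S.n = s + 1 := ⟨S.n - 1, by omega⟩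
  have e1 : ls S.n s = 0 := by unfold ls; omega
  have cb := S.Cdn (i := 0) (j := 0) (by omega) (by omega) (by omega) (by omega)
  rw [show S.n - 1 - 0 = s by omega] at cb
  have hA := S.Ca (S.Tall s (by omega)) (by omega)
  rw [e1] at hA
  have := S.CZ0 (S.DgX (by omega)) (S.X_sq (by omega)) (S.χdg (by omega)) cb _ hA
  rw [W, show S.n - 1 - 0 = s by omega, show S.n + 0 = s + 1 by omega, dg, e1]
  exact this
theorem CW0_N : S.C (2 * S.n) (S.W 0) = 0 := by
  have hn := S.hn
  obtain ⟨s, hs⟩ : ∃ s, S.n = s + 1 := ⟨S.n - 1, by omega⟩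
  have e1 : rs S.n s = 2 * S.n := by unfold rs ls; omega
  have cb := S.Cdn (i := 2 * S.n) (j := 0) (by omega) (by omega) (by omega) (by omega)
  rw [show S.n - 1 - 0 = s by omega] at cb
  have hQ := S.QlQr (s := s) (by omega)
  have hA := S.Cb (S.Tall s (by omega)) (by omega)
  rw [e1] at hA hQ
  have := S.CZN (S.DgX (by omega)) (S.X_sq (by omega)) (S.χdg (by omega)) hQ cb _ hA
  rw [W, show S.n - 1 - 0 = s by omega, show S.n + 0 = s + 1 by omega, dg, e1]
  exact this
theorem W_last : S.W (S.n - 1) = S.adR S.n (S.X (2 * S.n - 1)) := by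
  have hn := S.hn
  rw [W, show S.n - 1 - (S.n - 1) = 0 by omega, show S.n + (S.n - 1) = 2 * S.n - 1 by omega,
    S.adR_deg _ (S.DgX (by omega))]
  rfl
theorem CWn : S.C S.n (S.W (S.n - 1)) = 0 := by
  have hn := S.hn
  have cx := S.Cup (i := S.n) (j := S.n - 1) (by omega) (by omega) (by omega) (by omega)
  rw [show S.n + (S.n - 1) = 2 * S.n - 1 by omega] at cx
  have hQ := S.Qdg (s := 2 * S.n - 1) (j := S.n) (by omega) (by omega)
  rw [fX_n hn, mul_zero, zpow_zero, Q] at hQ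
  rw [W_last, S.C_R (by omega) (S.DgX (by omega)), cx, ← mul_inv, mul_comm (S.χ _ _), hQ]
  simp

theorem CZ {i : ℕ} (hi : i ≤ 2 * S.n) : S.C i S.Z = 0 := by
  have hn := S.hn
  unfold Z
  rw [map_sum]
  by_cases h0 : i = 0 ∨ i = 2 * S.n
  · rw [Finset.sum_eq_single 0]
    · rw [map_smul]
      rcases h0 with rfl | rfl
      · rw [S.CW0_0, smul_zero]
      · rw [S.CW0_N, smul_zero]
    · intro j hj hj0
      have := Finset.mem_range.mp hj
      rw [map_smul, S.CW0 hi this (by omega) (by omega) (by omega) (by omega), smul_zero]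
    · intro h; exact absurd (Finset.mem_range.mpr (by omega)) h
  by_cases h1 : i = S.n
  · rw [Finset.sum_eq_single (S.n - 1)]
    · rw [map_smul, h1, S.CWn, smul_zero]
    · intro j hj hj0
      have := Finset.mem_range.mp hj
      rw [map_smul, S.CW0 hi this (by omega) (by omega) (by omega) (by omega), smul_zero]
    · intro h; exact absurd (Finset.mem_range.mpr (by omega)) h
  obtain ⟨j, hj, hij⟩ : ∃ j, j + 1 < S.n ∧ (i = j + 1 ∨ i = 2 * S.n - 1 - j) := by
    by_cases h : i < S.n
    · exact ⟨i - 1, by omega, by omega⟩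
    · exact ⟨2 * S.n - 1 - i, by omega, by omega⟩
  rw [Finset.sum_eq_add j (j + 1) (by omega)]
  · rcases hij with rfl | rfl
    · exact S.CW_pairL hj
    · exact S.CW_pairR hj
  · intro c hc hcj
    have := Finset.mem_range.mp hc
    rw [map_smul, S.CW0 hi this (by omega) (by omega) (by omega) (by omega), smul_zero]
  · intro h; exact absurd (Finset.mem_range.mpr (by omega)) h
  · intro h; exact absurd (Finset.mem_range.mpr (by omega)) h

theorem FZ {i : ℕ} (hi : i ≤ 2 * S.n) : S.Z * S.F i - S.F i * S.Z = 0 := S.CZ hi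

theorem EnZ : S.adR S.n S.Z = 0 := by
  have hn := S.hn
  unfold Z
  rw [map_sum]
  apply Finset.sum_eq_zero
  intro j hj
  have hj := Finset.mem_range.mp hj
  rw [map_smul]
  by_cases h : j = S.n - 1
  · have d := S.DgX (s := 2 * S.n - 1) (by omega)
    rw [h, W_last, S.adR_deg _ (S.DgR (by omega) d), S.adR_deg _ d, S.χr, S.χn]
    have hE := S.En2
    have hE2 : ∀ z, S.E S.n * (S.E S.n * z) = 0 := by
      intro z; rw [← mul_assoc, hE, zero_mul]
    simp only [mul_sub, sub_mul, smul_mul_assoc, mul_smul_comm, mul_assoc, hE, hE2, mul_zero, smul_zero]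
    have : (S.χ (S.α S.n) (S.dg (2 * S.n - 1)) * -1)⁻¹ = - (S.χ (S.α S.n) (S.dg (2 * S.n - 1)))⁻¹ := by
      rw [mul_neg_one, inv_neg]
    rw [this]
    simp
  · have h1 := S.En_X (s := S.n + j - 1) (by omega)
    have h2 := S.En_X (s := S.n - 1 - j - 1) (by omega)
    rw [show S.n + j - 1 + 1 = S.n + j by omega] at h1
    rw [show S.n - 1 - j - 1 + 1 = S.n - 1 - j by omega] at h2
    rw [W, map_sub, map_smul, S.kerR_mul h1 h2, S.kerR_mul h2 h1]
    simp

theorem EZ {i : ℕ} (hi : i ≤ 2 * S.n) :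
    S.Z * S.E i - (S.χ (S.α i) S.δ)⁻¹ • (S.E i * S.Z) = 0 := by
  rw [← S.adR_deg i S.DgZ]
  rcases Nat.lt_trichotomy i S.n with h | h | h
  · have := S.slR hi S.DgZ (S.CZ hi) (S.NRZ h) (S.hpp hi (by omega)) 0 (by simp [S.Qδ hi])
    simpa using this
  · rw [h]; exact S.EnZ
  · have := S.slL hi S.DgZ (S.CZ hi) (S.NLZ hi h) (S.hpp hi (by omega)) 0 (by simp [S.Qδ hi])
    have h1 : S.adL i S.Z = 0 := by simpa using this
    rw [S.adL_deg i S.DgZ] at h1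
    have hQ := S.Qδ hi
    unfold Q at hQ
    rw [S.adR_deg i S.DgZ, sub_eq_zero.mp h1, smul_smul, ← mul_inv, mul_comm (S.χ (S.α i) _), hQ]
    simp
end QA
end QAux

namespace QAux
theorem Bfm_eq {n i j : ℕ} (hn : 2 ≤ n) (hj : j ≤ 2 * n) : Bfm n i j = cart n i j := by
  have h1 : Bfm n i j = ∑ t ∈ Finset.range (2 * n), dsg n t * wv n i t * wv n j t := by
    rw [← Fin.sum_univ_eq_sum_range (fun t => dsg n t * wv n i t * wv n j t)]
    rfl
  rw [h1]
  unfold cart pr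
  have key : ∀ (u : ℕ) (f : ℕ → ℤ), u < 2 * n → ∑ t ∈ Finset.range (2 * n), f t * (if t = u then 1 else 0) = f u := by
    intro u f hu
    simp [Finset.sum_ite_eq', hu]
  split_ifs with a b
  · subst a
    rw [Finset.sum_congr rfl (g := fun t => (-2 * wv n i t) * (if t = 0 then 1 else 0)), key 0 _ (by omega)]
    intro t ht
    simp only [wv.eq_def n 0, if_true, dsg]
    split_ifs <;> first | omega | ring
  · subst b
    rw [Finset.sum_congr rfl (g := fun t => (-2 * wv n i t) * (if t = 2 * n - 1 then 1 else 0)), key _ _ (by omega)]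
    intro t ht
    simp only [wv.eq_def n (2 * n), if_true, if_neg a, dsg]
    split_ifs <;> first | omega | ring
  · rw [← key (j - 1) (fun t => dsg n t * wv n i t) (by omega), ← key j (fun t => dsg n t * wv n i t) (by omega),
      ← Finset.sum_sub_distrib]
    apply Finset.sum_congr rfl
    intro t ht
    simp only [wv.eq_def n j, if_neg b, if_neg a]
    ring

theorem sumIcc {M : Type} [AddCommMonoid M] (f : ℕ → M) {a b : ℕ} (h : a ≤ b) :
    ∑ t ∈ Finset.Icc a b, f t = f a + ∑ t ∈ Finset.Icc (a + 1) b, f t := by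
  rw [← Finset.add_sum_Ioc_eq_sum_Icc h]
  congr 1
  refine Finset.sum_congr ?_ (fun _ _ => rfl)
  ext t
  simp only [Finset.mem_Ioc, Finset.mem_Icc]
  omega
theorem sumIcc' {M : Type} [AddCommMonoid M] (f : ℕ → M) {a b : ℕ} (h : a ≤ b + 1) :
    ∑ t ∈ Finset.Icc a (b + 1), f t = ∑ t ∈ Finset.Icc a b, f t + f (b + 1) := Finset.sum_Icc_succ_top h f

section
variable (K : Type) [Field K] [CharZero K] (n : ℕ) (hn : 2 ≤ n)
    (q : Kˣ) (hq : ∀ m : ℕ, 0 < m → (q : K) ^ m ≠ 1)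
    (χ : Lam n → Lam n → Kˣ)
    (hχ1 : ∀ a b c : Lam n, χ (a + b) c = χ a c * χ b c)
    (hχ2 : ∀ a b c : Lam n, χ a (b + c) = χ a b * χ a c)
    (hχd : ∀ i : Fin (2 * n + 1), Bfm n i i ≠ 0 → χ (αr n i) (αr n i) = q ^ (Bfm n i i))
    (hχ0 : ∀ i : Fin (2 * n + 1), Bfm n i i = 0 → ((χ (αr n i) (αr n i) : Kˣ) : K) = -1)
    (hχij : ∀ i j : Fin (2 * n + 1), i ≠ j →
      χ (αr n i) (αr n j) * χ (αr n j) (αr n i) = q ^ (2 * Bfm n i j))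

theorem αn_of {i : ℕ} (hi : i < 2 * n + 1) : αn n i = αr n ⟨i, hi⟩ := dif_pos hi
theorem uEn_of {i : ℕ} (hi : i < 2 * n + 1) : uEn K n χ i = uE K n χ ⟨i, hi⟩ := dif_pos hi
def uFn (t : ℕ) : Unat K n χ := if h : t < 2 * n + 1 then uF K n χ ⟨t, h⟩ else 0
theorem uFn_of {i : ℕ} (hi : i < 2 * n + 1) : uFn K n χ i = uF K n χ ⟨i, hi⟩ := dif_pos hi

/-- the instance -/
def inst : QA K (Unat K n χ) (Lam n) where
  n := n
  hn := hn
  q := q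
  hq0 := q.ne_zero
  hq := hq
  two := two_ne_zero
  χ := fun a b => (χ a b : K)
  χne := fun a b => (χ a b).ne_zero
  χl := fun a b c => by rw [hχ1, Units.val_mul]
  χr := fun a b c => by rw [hχ2, Units.val_mul]
  α := αn n
  χd := by
    intro i hi hin
    have hi' : i < 2 * n + 1 := by omega
    have := hχd ⟨i, hi'⟩
    simp only [Bfm_eq hn hi] at this
    rw [αn_of n hi', this (cart_self_ne hn hi hin), Units.val_zpow_eq_zpow_val]
  χn := by
    have hi' : n < 2 * n + 1 := by omega
    have := hχ0 ⟨n, hi'⟩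
    simp only [Bfm_eq hn (show n ≤ 2 * n by omega)] at this
    rw [αn_of n hi', this (cart_nn hn)]
  χp := by
    intro i j hi hj hij
    have hi' : i < 2 * n + 1 := by omega
    have hj' : j < 2 * n + 1 := by omega
    have := hχij ⟨i, hi'⟩ ⟨j, hj'⟩ (by simpa using hij)
    simp only [Bfm_eq hn hj] at this
    rw [αn_of n hi', αn_of n hj', ← Units.val_mul, this, Units.val_zpow_eq_zpow_val]
  Kg := uK K n χ
  Lg := uL K n χ
  E := uEn K n χ
  F := uFn K n χ
  K0 := by simpa [uK] using RingQuot.mkAlgHom_rel K (NRel.K0 (K := K) (n := n) (χ := χ))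
  L0 := by simpa [uL] using RingQuot.mkAlgHom_rel K (NRel.L0 (K := K) (n := n) (χ := χ))
  KK := fun a b => by simpa [uK] using RingQuot.mkAlgHom_rel K (NRel.KK (K := K) (n := n) (χ := χ) a b)
  LL := fun a b => by simpa [uL] using RingQuot.mkAlgHom_rel K (NRel.LL (K := K) (n := n) (χ := χ) a b)
  KE := by
    intro a i hi
    have hi' : i < 2 * n + 1 := by omega
    rw [αn_of n hi', uEn_of K n χ hi']
    have := RingQuot.mkAlgHom_rel K (NRel.KE (K := K) (n := n) (χ := χ) a ⟨i, hi'⟩)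
    simp only [map_mul, map_smul] at this
    exact this
  LE := by
    intro a i hi
    have hi' : i < 2 * n + 1 := by omega
    rw [αn_of n hi', uEn_of K n χ hi']
    have := RingQuot.mkAlgHom_rel K (NRel.LE (K := K) (n := n) (χ := χ) a ⟨i, hi'⟩)
    simp only [map_mul, map_smul, Units.val_inv_eq_inv_val] at this
    exact this
  EFs := by
    intro i hi
    have hi' : i < 2 * n + 1 := by omega
    rw [αn_of n hi', uEn_of K n χ hi', uFn_of K n χ hi']
    have := RingQuot.mkAlgHom_rel K (NRel.EFsame (K := K) (n := n) (χ := χ) ⟨i, hi'⟩)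
    simp only [map_mul, map_sub, map_add, map_neg] at this
    exact this
  EFn := by
    intro i j hi hj hij
    have hi' : i < 2 * n + 1 := by omega
    have hj' : j < 2 * n + 1 := by omega
    rw [uEn_of K n χ hi', uFn_of K n χ hj']
    have := RingQuot.mkAlgHom_rel K (NRel.EFne (K := K) (n := n) (χ := χ) ⟨i, hi'⟩ ⟨j, hj'⟩ (by simpa using hij))
    simp only [map_mul, map_sub, map_zero] at this
    exact this
  S1 := by
    intro i j hi hj h
    have hi' : i < 2 * n + 1 := by omega
    have hj' : j < 2 * n + 1 := by omega
    rw [uEn_of K n χ hi', uEn_of K n χ hj', αn_of n hi', αn_of n hj']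
    have := RingQuot.mkAlgHom_rel K (NRel.SE1 (K := K) (n := n) (χ := χ) ⟨i, hi'⟩ ⟨j, hj'⟩
      (by simpa [Bfm_eq hn hj] using h))
    simp only [fbrE, map_mul, map_sub, map_smul, map_zero, Units.val_inv_eq_inv_val] at this
    exact this
  S2 := by
    intro i j hi hj hij h h2
    have hi' : i < 2 * n + 1 := by omega
    have hj' : j < 2 * n + 1 := by omega
    rw [uEn_of K n χ hi', uEn_of K n χ hj', αn_of n hi', αn_of n hj']
    have := RingQuot.mkAlgHom_rel K (NRel.SE2 (K := K) (n := n) (χ := χ) ⟨i, hi'⟩ ⟨j, hj'⟩ (by simpa using hij)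
      (by simpa only [Bfm_eq hn hj, Bfm_eq hn hi] using h) (by simpa only [Bfm_eq hn hi] using h2))
    simp only [fbrE, map_mul, map_sub, map_smul, map_zero, Units.val_inv_eq_inv_val] at this
    exact this
  S3 := by
    intro i j hi hj hij h h2
    have hi' : i < 2 * n + 1 := by omega
    have hj' : j < 2 * n + 1 := by omega
    rw [uEn_of K n χ hi', uEn_of K n χ hj', αn_of n hi', αn_of n hj']
    have := RingQuot.mkAlgHom_rel K (NRel.SE3 (K := K) (n := n) (χ := χ) ⟨i, hi'⟩ ⟨j, hj'⟩ (by simpa using hij)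
      (by simpa only [Bfm_eq hn hj, Bfm_eq hn hi] using h) (by simpa only [Bfm_eq hn hi] using h2))
    simp only [fbrE, map_mul, map_sub, map_smul, map_zero, Units.val_inv_eq_inv_val] at this
    exact this
  S4 := by
    have hi : n ≤ 2 * n := by omega
    have hj : n - 1 ≤ 2 * n := by omega
    have hk : n + 1 ≤ 2 * n := by omega
    have hi' : n < 2 * n + 1 := by omega
    have hj' : n - 1 < 2 * n + 1 := by omega
    have hk' : n + 1 < 2 * n + 1 := by omega
    rw [uEn_of K n χ hi', uEn_of K n χ hj', uEn_of K n χ hk', αn_of n hi', αn_of n hj', αn_of n hk']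
    have c1 : cart n n (n - 1) = -1 := by
      have := cart_prev (i := n - 1) hn (by omega)
      rw [show n - 1 + 1 = n by omega] at this
      rw [this]; grind
    have c2 : cart n n (n + 1) = 1 := by
      rw [cart_next hn hk]; grind
    have := RingQuot.mkAlgHom_rel K (NRel.SE4 (K := K) (n := n) (χ := χ) ⟨n, hi'⟩ ⟨n - 1, hj'⟩ ⟨n + 1, hk'⟩
      (by simp only [ne_eq, Fin.mk.injEq]; omega) (by simp only [ne_eq, Fin.mk.injEq]; omega)
      (by simp only [ne_eq, Fin.mk.injEq]; omega)
      (by simp only [Bfm_eq hn hi]; exact cart_nn hn)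
      (by simp only [Bfm_eq hn hk]; exact cart_far (by omega) hk)
      (by simp only [Bfm_eq hn hk, Bfm_eq hn hj, c1, c2]; norm_num)
      (by simp only [Bfm_eq hn hk, c2]; norm_num))
    simp only [fbrE, map_mul, map_sub, map_smul, map_zero, Units.val_inv_eq_inv_val] at this
    exact this
end
end QAux

namespace QAux
section
variable {K : Type} [Field K] {n : ℕ} {χ : Lam n → Lam n → Kˣ} (S : QA K (Unat K n χ) (Lam n))

theorem X_succ' {k A Λ : Type} [Field k] [Ring A] [Algebra k A] [AddCommGroup Λ] (S : QA k A Λ)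
    {s : ℕ} (hs : s < 2 * S.n - 1) : S.X (s + 1) =
    S.E (rs S.n s) * (S.X s * S.E (ls S.n s) - (S.χ (S.α (ls S.n s)) (S.dg s))⁻¹ • (S.E (ls S.n s) * S.X s))
    - (S.χ (S.dg s + S.α (ls S.n s)) (S.α (rs S.n s)))⁻¹ •
      ((S.X s * S.E (ls S.n s) - (S.χ (S.α (ls S.n s)) (S.dg s))⁻¹ • (S.E (ls S.n s) * S.X s)) * S.E (rs S.n s)) := by
  have hl := ls_lt hs
  have d := S.DgX (s := s) (by omega)
  rw [QA.X, S.adL_deg _ (S.DgR (by omega) d), S.adR_deg _ d]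

theorem degB_dg (hSn : S.n = n) (hα : S.α = αn n) (j : ℕ) (hj : j ≤ n - 1) : degB n (n - 1 - j) = S.dg j := by
  have hn := S.hn
  rw [hSn] at hn
  induction j with
  | zero =>
    rw [QA.dg, hα, hSn, degB, show n - 1 - 0 + 1 = n by omega, show 2 * n - (n - 1 - 0) - 1 = n by omega,
      Finset.Icc_self, Finset.sum_singleton]
  | succ j ih =>
    rw [QA.dg, ← ih (by omega), hα, hSn, degB, degB,
      show ls n j = n - 1 - j by unfold ls; omega, show rs n j = n + j + 1 by unfold rs ls; omega,
      show n - 1 - (j + 1) + 1 = n - 1 - j by omega,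
      show 2 * n - (n - 1 - (j + 1)) - 1 = n + j + 1 by omega,
      show 2 * n - (n - 1 - j) - 1 = n + j by omega, sumIcc' _ (by omega), sumIcc _ (by omega)]
    abel

theorem Cseq_X (hSn : S.n = n) (hE : S.E = uEn K n χ) (hα : S.α = αn n) (hc : ∀ a b, S.χ a b = (χ a b : K)) (j : ℕ) (hj : j ≤ n - 1) : Cseq K n χ j = S.X j := by
  have hn := S.hn
  rw [hSn] at hn
  induction j with
  | zero => rw [QA.X, hE, hSn, Cseq]
  | succ j ih =>
    rw [X_succ' S (by omega), Cseq, ih (by omega), degB_dg S hSn hα j (by omega), hα, hE, hSn,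
      show ls n j = n - 1 - j by unfold ls; omega, show rs n j = n + j + 1 by unfold rs ls; omega]
    simp only [ubrE, hc, Units.val_inv_eq_inv_val]

theorem degB_dg' (hSn : S.n = n) (hα : S.α = αn n) (i : ℕ) (hi : i ≤ n - 1) : degB n i = S.dg (n - 1 - i) := by
  rw [← degB_dg S hSn hα _ (by omega), show n - 1 - (n - 1 - i) = i by omega]

theorem degBm1_dg (hSn : S.n = n) (hα : S.α = αn n) : degBm1 n = S.dg n := by
  have hn := S.hn
  rw [hSn] at hn
  obtain ⟨m, rfl⟩ : ∃ m, n = m + 1 := ⟨n - 1, by omega⟩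
  rw [degBm1, degB_dg' S hSn hα 0 (by omega), QA.dg, hα, hSn,
    show ls (m + 1) m = 0 by unfold ls; omega, show rs (m + 1) m = 2 * (m + 1) by unfold rs ls; omega,
    show m + 1 - 1 - 0 = m by omega]
  abel

theorem Bm1_X (hSn : S.n = n) (hE : S.E = uEn K n χ) (hα : S.α = αn n) (hc : ∀ a b, S.χ a b = (χ a b : K)) : Bm1 K n χ = S.X n := by
  have hn := S.hn
  rw [hSn] at hn
  have h := X_succ' S (s := n - 1) (by omega)
  rw [show n - 1 + 1 = n by omega, hSn,
    show ls n (n - 1) = 0 by unfold ls; omega, show rs n (n - 1) = 2 * n by unfold rs ls; omega] at h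
  rw [h, Bm1, Bseq, degB_dg' S hSn hα 0 (by omega), Cseq_X S hSn hE hα hc _ (by omega),
    show n - 1 - 0 = n - 1 by omega, hα, hE]
  simp only [ubrE, hc, Units.val_inv_eq_inv_val]

theorem degA_dg (hSn : S.n = n) (hα : S.α = αn n) (i : ℕ) (hi : i < n) : degA n i = S.dg (n + i) := by
  have hn := S.hn
  rw [hSn] at hn
  induction i with
  | zero =>
    rw [degA, degBm1_dg S hSn hα, Finset.Icc_eq_empty (by omega), Finset.Icc_eq_empty (by omega)]
    simp
  | succ i ih =>
    rw [← add_assoc, QA.dg, ← ih (by omega), hα, hSn, degA, degA,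
      show ls n (n + i) = i + 1 by unfold ls; omega, show rs n (n + i) = 2 * n - (i + 1) by unfold rs ls; omega,
      sumIcc' _ (by omega), sumIcc (a := 2 * n - (i + 1)) _ (by omega),
      show 2 * n - (i + 1) + 1 = 2 * n - i by omega]
    abel

theorem Aseq_X (hSn : S.n = n) (hE : S.E = uEn K n χ) (hα : S.α = αn n) (hc : ∀ a b, S.χ a b = (χ a b : K)) (i : ℕ) (hi : i < n) : Aseq K n χ i = S.X (n + i) := by
  have hn := S.hn
  rw [hSn] at hn
  induction i with
  | zero => rw [Aseq, Bm1_X S hSn hE hα hc, add_zero]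
  | succ i ih =>
    rw [← add_assoc, X_succ' S (by omega), Aseq, ih (by omega), degA_dg S hSn hα i (by omega), hα, hE, hSn,
      show ls n (n + i) = i + 1 by unfold ls; omega, show rs n (n + i) = 2 * n - i - 1 by unfold rs ls; omega]
    simp only [ubrE, hc, Units.val_inv_eq_inv_val]

theorem hat_δ (hSn : S.n = n) (hα : S.α = αn n) : hatδ n = S.δ := by
  have hn := S.hn
  rw [hSn] at hn
  rw [QA.δ, hSn, ← degBm1_dg S hSn hα, show n - 1 = n - 1 - 0 by omega, ← degB_dg' S hSn hα 0 (by omega),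
    degBm1, hatδ, degB, show 2 * n - 0 - 1 = 2 * n - 1 by omega, zero_add, two_smul]
  abel

theorem aScal_a (hSn : S.n = n) (hα : S.α = αn n) (hc : ∀ a b, S.χ a b = (χ a b : K)) (i : ℕ) (hi : i < n) : aScal K n χ i = S.a i := by
  have hn := S.hn
  rw [hSn] at hn
  induction i with
  | zero => rw [aScal, QA.a]
  | succ i ih =>
    have h : ∑ t ∈ Finset.Icc (i + 2) (2 * n - i - 2), αn n t = S.dg (n - 2 - i) := by
      rw [show n - 2 - i = n - 1 - (i + 1) by omega, ← degB_dg' S hSn hα (i + 1) (by omega), degB,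
        show 2 * n - (i + 1) - 1 = 2 * n - i - 2 by omega]
    rw [aScal, QA.a, ih (by omega), sumIcc (a := i + 1) _ (by omega), h, hat_δ S hSn hα,
      ← hc, ← hc, ← hc, S.χnl, S.χnr, hα, hSn, show 2 * n - i - 1 = 2 * n - 1 - i by omega]

theorem Zel_Z (hSn : S.n = n) (hE : S.E = uEn K n χ) (hα : S.α = αn n) (hc : ∀ a b, S.χ a b = (χ a b : K)) : Zel K n χ = S.Z := by
  rw [Zel, QA.Z, hSn]
  refine Finset.sum_congr rfl fun i hi => ?_
  rw [Finset.mem_range] at hi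
  rw [aScal_a S hSn hα hc i hi, degA_dg S hSn hα i hi, degB_dg' S hSn hα i (by omega),
    Aseq_X S hSn hE hα hc i hi, Bseq, Cseq_X S hSn hE hα hc _ (by omega), QA.W, hSn]
  simp only [ubrE, hc, Units.val_inv_eq_inv_val]
end
end QAux

/-- the element `Z = Σ a_i ⌊A_i,B_i⌋ ∈ U^♮_χ` (case of
`sl^{(2)}(2n|2n)`) commutes with all `F_i` and `q`-commutes with all `E_i`. -/
theorem stmt13 (K : Type) [Field K] [CharZero K] (n : ℕ) (hn : 2 ≤ n)
    (q : Kˣ) (hq : ∀ m : ℕ, 0 < m → (q : K) ^ m ≠ 1)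
    (χ : Lam n → Lam n → Kˣ)
    (hχ1 : ∀ a b c : Lam n, χ (a + b) c = χ a c * χ b c)
    (hχ2 : ∀ a b c : Lam n, χ a (b + c) = χ a b * χ a c)
    (hχd : ∀ i : Fin (2 * n + 1), Bfm n i i ≠ 0 → χ (αr n i) (αr n i) = q ^ (Bfm n i i))
    (hχ0 : ∀ i : Fin (2 * n + 1), Bfm n i i = 0 → ((χ (αr n i) (αr n i) : Kˣ) : K) = -1)
    (hχij : ∀ i j : Fin (2 * n + 1), i ≠ j →
      χ (αr n i) (αr n j) * χ (αr n j) (αr n i) = q ^ (2 * Bfm n i j))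
    (hχdd : χ (dr n) (dr n) = 1)
    (hχdi : ∀ i : Fin (2 * n + 1),
      χ (dr n) (αr n i) = q ^ (if (i : ℕ) = 0 then (1 : ℕ) else 0) ∧
      χ (αr n i) (dr n) = q ^ (if (i : ℕ) = 0 then (1 : ℕ) else 0)) :
    ∀ i : Fin (2 * n + 1),
      Zel K n χ * uF K n χ i - uF K n χ i * Zel K n χ = 0 ∧
      Zel K n χ * uE K n χ i
        - ((((χ (αr n i) (hatδ n))⁻¹ : Kˣ) : K)) • (uE K n χ i * Zel K n χ) = 0 := by
  intro i
  let S := QAux.inst K n hn q hq χ hχ1 hχ2 hχd hχ0 hχij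
  have hZ : Zel K n χ = S.Z := QAux.Zel_Z S rfl rfl rfl (fun _ _ => rfl)
  have hd : hatδ n = S.δ := QAux.hat_δ S rfl rfl
  have hi : (i : ℕ) ≤ 2 * n := by omega
  have h1 := S.FZ (i := i) hi
  have h2 := S.EZ (i := i) hi
  have eE : S.E i = uE K n χ i := QAux.uEn_of K n χ i.2
  have eF : S.F i = uF K n χ i := QAux.uFn_of K n χ i.2
  have eα : S.α i = αr n i := QAux.αn_of n i.2
  rw [eF] at h1
  rw [eE, eα] at h2
  rw [hZ, hd, Units.val_inv_eq_inv_val]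
  exact ⟨h1, h2⟩
end

section
/- In U^♮_χ define root vectors, for 1 ≤ i < j ≤ N: E_{ε_i−ε_{i+1}} := E_i; E_{ε_i−ε_j} := ⌊E_{ε_i−ε_{j−1}}, E_{j−1}⌋ for j ≥ i+2; E_{ε_i+ε_N} := ⌊E_{ε_i−ε_N}, E_N⌋ for i ≤ N−1; and E_{ε_i+ε_j} := ⌊E_{ε_i+ε_{j+1}}, E_j⌋ for i ≤ N−2 and i+1 ≤ j ≤ N−1 (all q-brackets computed with the degrees inherited from the letters E_s, so that E_{ε_i−ε_j} has degree Σ_{t=i}^{j−1}α_t and E_{ε_i+ε_j} has degree Σ_{t=i}^{j−1}α_t + 2Σ_{t=j}^{N−1}α_t + α_N). Then: ⌊E_i, E_{ε_i−ε_j}⌋ = 0 and ⌊E_i, E_{ε_i+ε_j}⌋ = 0 for j ≥ i+2; ⌊E_{ε_i−ε_j}, E_{j−1}⌋ = 0 for j ≥ i+2; ⌊E_{ε_i+ε_j}, E_j⌋ = 0; and ⌊E_{ε_i−ε_j}, E_k⌋ = 0 and ⌊E_{ε_i+ε_j}, E_k⌋ = 0 for every k ∈ {1,…,N} with k ∉ {i−1,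 i, j−1, j}. -/
section RootVec

variable (K : Type) [Field K] (n : ℕ) (χ : Lam n → Lam n → Kˣ)

/-- `deg E_{ε_i−ε_j} = Σ_{t=i}^{j−1} α_t`. -/
def degEM (i j : ℕ) : Lam n := ∑ t ∈ Finset.Icc i (j - 1), αn n t

/-- `deg E_{ε_i+ε_j} = Σ_{t=i}^{j−1} α_t + 2Σ_{t=j}^{N−1} α_t + α_N`. -/
def degEP (i j : ℕ) : Lam n :=
  degEM n i j + (2 : ℤ) • (∑ t ∈ Finset.Icc j (2 * n - 1), αn n t) + αn n (2 * n)

/-- `EMseq i d = E_{ε_i − ε_{i+1+d}}` : `E_{ε_i−ε_{i+1}} := E_i` and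
`E_{ε_i−ε_j} := ⌊E_{ε_i−ε_{j−1}}, E_{j−1}⌋`. -/
def EMseq (i : ℕ) : ℕ → Unat K n χ
  | 0 => uEn K n χ i
  | d + 1 =>
      ubrE K n χ (degEM n i (i + d + 1)) (αn n (i + d + 1))
        (EMseq i d) (uEn K n χ (i + d + 1))

/-- The root vector `E_{ε_i−ε_j}` (for `1 ≤ i < j ≤ N`). -/
def EMrt (i j : ℕ) : Unat K n χ := EMseq K n χ i (j - i - 1)

/-- `EPseq i k = E_{ε_i + ε_{N−k}}` : `E_{ε_i+ε_N} := ⌊E_{ε_i−ε_N}, E_N⌋` and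
`E_{ε_i+ε_j} := ⌊E_{ε_i+ε_{j+1}}, E_j⌋`. -/
def EPseq (i : ℕ) : ℕ → Unat K n χ
  | 0 =>
      ubrE K n χ (degEM n i (2 * n)) (αn n (2 * n))
        (EMrt K n χ i (2 * n)) (uEn K n χ (2 * n))
  | k + 1 =>
      ubrE K n χ (degEP n i (2 * n - k)) (αn n (2 * n - k - 1))
        (EPseq i k) (uEn K n χ (2 * n - k - 1))

/-- The root vector `E_{ε_i+ε_j}` (for `1 ≤ i < j ≤ N`). -/
def EPrt (i j : ℕ) : Unat K n χ := EPseq K n χ i (2 * n - j)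

end RootVec

section QAlg
variable {K A : Type} [Field K] [Ring A] [Algebra K A]

theorem qa_commR (X Y Z : A) (u s t : K) (h1 : X * Z = s • (Z * X)) (h2 : Y * Z = t • (Z * Y)) :
    (X * Y - u • (Y * X)) * Z = (s * t) • (Z * (X * Y - u • (Y * X))) := by
  have e1 : X * (Y * Z) = t • (s • (Z * (X * Y))) := by
    rw [h2, mul_smul_comm, ← mul_assoc, h1, smul_mul_assoc, mul_assoc]
  have e2 : Y * (X * Z) = s • (t • (Z * (Y * X))) := by
    rw [h1, mul_smul_comm, ← mul_assoc, h2, smul_mul_assoc, mul_assoc]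
  simp only [sub_mul, smul_mul_assoc, mul_assoc, mul_sub, mul_smul_comm, e1, e2]
  module

theorem qa_commL (X Y Z : A) (u s t : K) (h1 : X * Y = s • (Y * X)) (h2 : X * Z = t • (Z * X)) :
    X * (Y * Z - u • (Z * Y)) = (s * t) • ((Y * Z - u • (Z * Y)) * X) := by
  have e1 : X * (Y * Z) = t • (s • (Y * (Z * X))) := by
    rw [← mul_assoc, h1, smul_mul_assoc, mul_assoc, h2, mul_smul_comm, smul_comm]
  have e2 : X * (Z * Y) = s • (t • (Z * (Y * X))) := by
    rw [← mul_assoc, h2, smul_mul_assoc, mul_assoc, h1, mul_smul_comm, smul_comm]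
  simp only [sub_mul, smul_mul_assoc, mul_assoc, mul_sub, mul_smul_comm, e1, e2]
  module

theorem qa_jac (X Y Z : A) (sxy sxz syz : K) (h1 : X * Z = sxz • (Z * X)) :
    (X * Y - sxy • (Y * X)) * Z - (sxz * syz) • (Z * (X * Y - sxy • (Y * X)))
    = X * (Y * Z - syz • (Z * Y)) - (sxy * sxz) • ((Y * Z - syz • (Z * Y)) * X) := by
  have e1 : X * (Z * Y) = sxz • (Z * (X * Y)) := by
    rw [← mul_assoc, h1, smul_mul_assoc, mul_assoc]
  simp only [sub_mul, smul_mul_assoc, mul_assoc, mul_sub, mul_smul_comm, e1, h1]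
  module

/-- even rank-three pattern -/
theorem qa_even (a b c : A) (sab sac sbb sbc scb : K) (hs : sbc * scb * sbb = 1)
    (hbb : 1 + sbb ≠ 0) (h1 : a * c = sac • (c * a))
    (h2 : (a * b - sab • (b * a)) * b - (sab * sbb) • (b * (a * b - sab • (b * a))) = 0)
    (h3 : b * (b * c - sbc • (c * b)) - (sbb * sbc) • ((b * c - sbc • (c * b)) * b) = 0) :
    ((a * b - sab • (b * a)) * c - (sac * sbc) • (c * (a * b - sab • (b * a)))) * b
     - (sab * sbb * scb) • (b * ((a * b - sab • (b * a)) * c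
        - (sac * sbc) • (c * (a * b - sab • (b * a))))) = 0 := by
  have e1 : ∀ x, a * (c * x) = sac • (c * (a * x)) := by
    intro x; rw [← mul_assoc, h1, smul_mul_assoc, mul_assoc]
  have r1 := congrArg (fun x => x * c) h2
  have r2 := congrArg (fun x => c * x) h2
  have r3 := congrArg (fun x => a * x) h3
  have r4 := congrArg (fun x => x * a) h3
  simp only [sub_mul, smul_mul_assoc, mul_assoc, mul_sub, mul_smul_comm, e1, h1, smul_sub, mul_zero, zero_mul] at r1 r2 r3 r4 ⊢
  have hc : sbc ≠ 0 := by rintro rfl; simp at hs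
  have hb : sbb ≠ 0 := by rintro rfl; simp at hs
  have hcb : scb = sbc⁻¹ * sbb⁻¹ := by field_simp; linear_combination hs
  subst hcb
  have key : (sbc * (1 + sbb)) ≠ 0 := mul_ne_zero hc hbb
  refine (smul_eq_zero_iff_right key).1 ?_
  linear_combination (norm := skip) r1 - r3 - (sac * sbc ^ 2) • r2 + (sab ^ 2 * sac) • r4
  match_scalars <;> field_simp <;> ring

/-- cubic pattern -/
theorem qa_cubic (X e f : A) (sxe sxf see sef sfe : K) (hs : sef * sfe * see ^ 2 = 1)
    (hee : 1 + see + see ^ 2 ≠ 0) (h1 : X * f = sxf • (f * X))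
    (h2 : (X * e - sxe • (e * X)) * e - (sxe * see) • (e * (X * e - sxe • (e * X))) = 0)
    (h3 : e * (e * (e * f - sef • (f * e)) - (see * sef) • ((e * f - sef • (f * e)) * e))
      - (see * (see * sef)) • ((e * (e * f - sef • (f * e))
        - (see * sef) • ((e * f - sef • (f * e)) * e)) * e) = 0)
    (Y : A) (hY : Y = (X * e - sxe • (e * X)) * f - (sxf * sef) • (f * (X * e - sxe • (e * X))))
    (Z : A) (hZ : Z = Y * e - (sxe * see * sfe) • (e * Y)) :
    Z * e - (sxe * see * sfe * see) • (e * Z) = 0 := by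
  subst hY hZ
  have e1 : ∀ x, X * (f * x) = sxf • (f * (X * x)) := by
    intro x; rw [← mul_assoc, h1, smul_mul_assoc, mul_assoc]
  have hc : sef ≠ 0 := by rintro rfl; simp at hs
  have hb : see ≠ 0 := by rintro rfl; simp at hs
  have hcb : sfe = sef⁻¹ * (see ^ 2)⁻¹ := by field_simp; linear_combination hs
  have r1 := congrArg (fun x => x * (f * e)) h2
  have r2 := congrArg (fun x => x * (e * f)) h2
  have r3 := congrArg (fun x => e * x * f) h2
  have r4 := congrArg (fun x => f * x * e) h2
  have r5 := congrArg (fun x => f * e * x) h2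
  have r6 := congrArg (fun x => e * f * x) h2
  have r7 := congrArg (fun x => X * x) h3
  have r8 := congrArg (fun x => x * X) h3
  simp only [sub_mul, smul_mul_assoc, mul_assoc, mul_sub, mul_smul_comm, e1, h1, smul_sub, mul_zero, zero_mul] at r1 r2 r3 r4 r5 r6 r7 r8 ⊢
  subst hcb
  refine (smul_eq_zero_iff_right hee).1 ?_
  linear_combination (norm := skip) ((1 + see + see ^ 2) * (see * sef)⁻¹) • r1
    - ((see * sef ^ 2)⁻¹) • r2 - ((1 + see) * sxe * (see * sef ^ 2)⁻¹) • r3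
    - ((1 + see) * sxf * sef) • r4 - (see * sxe * sxf * sef) • r5
    + ((1 + see + see ^ 2) * sxe * sxf * see⁻¹) • r6
    + ((see * sef ^ 2)⁻¹) • r7 - (sxe ^ 3 * sxf * (see * sef ^ 2)⁻¹) • r8
  match_scalars <;> field_simp <;> ring

/-- odd pattern -/
theorem qa_odd (a b c : A) (sab sba sac sbc scb : K) (hs : sab * sba * (sbc * scb) = 1)
    (h1 : a * c = sac • (c * a)) (hb : b * b = 0)
    (h2 : (b * a - sba • (a * b)) * (b * c - sbc • (c * b))
      - (-1 * sbc * (sab * sac)) • ((b * c - sbc • (c * b)) * (b * a - sba • (a * b))) = 0) :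
    ((a * b - sab • (b * a)) * c - (sac * sbc) • (c * (a * b - sab • (b * a)))) * b
     - (sab * -1 * scb) • (b * ((a * b - sab • (b * a)) * c
        - (sac * sbc) • (c * (a * b - sab • (b * a))))) = 0 := by
  have e1 : ∀ x, a * (c * x) = sac • (c * (a * x)) := by
    intro x; rw [← mul_assoc, h1, smul_mul_assoc, mul_assoc]
  have e2 : ∀ x, b * (b * x) = 0 := by
    intro x; rw [← mul_assoc, hb, zero_mul]
  simp only [sub_mul, smul_mul_assoc, mul_assoc, mul_sub, mul_smul_comm, e1, e2, hb, h1, smul_sub, mul_zero, smul_zero] at h2 ⊢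
  have n1 : sab ≠ 0 := by rintro rfl; simp at hs
  have n2 : sba ≠ 0 := by rintro rfl; simp at hs
  have n3 : sbc ≠ 0 := by rintro rfl; simp at hs
  have hcb : scb = sab⁻¹ * sba⁻¹ * sbc⁻¹ := by field_simp; linear_combination hs
  subst hcb
  refine (smul_eq_zero_iff_right (mul_ne_zero n2 n3)).1 ?_
  linear_combination (norm := skip) h2
  match_scalars <;> field_simp <;> ring

/-- left and right quadratic Serre -/
theorem qa_LR (X E : A) (a b c : K) (h : a * b * c = 1)
    (h1 : E * (E * X - a • (X * E)) - (c * a) • ((E * X - a • (X * E)) * E) = 0) :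
    (X * E - b • (E * X)) * E - (b * c) • (E * (X * E - b • (E * X))) = 0 := by
  simp only [sub_mul, smul_mul_assoc, mul_assoc, mul_sub, mul_smul_comm, smul_sub] at h1 ⊢
  have n1 : a ≠ 0 := by rintro rfl; simp at h
  have n2 : b ≠ 0 := by rintro rfl; simp at h
  have hcb : c = a⁻¹ * b⁻¹ := by field_simp; linear_combination h
  subst hcb
  linear_combination (norm := skip) (b ^ 2 * (a⁻¹ * b⁻¹)) • h1
  match_scalars <;> field_simp <;> ring

theorem qa_R0 (X E : A) (b : K) (h : E * E = 0) :
    (X * E - b • (E * X)) * E - (b * -1) • (E * (X * E - b • (E * X))) = 0 := by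
  have e2 : ∀ x, E * (E * x) = 0 := by
    intro x; rw [← mul_assoc, h, zero_mul]
  simp only [sub_mul, smul_mul_assoc, mul_assoc, mul_sub, mul_smul_comm, smul_sub, e2, h, mul_zero, smul_zero]
  module

theorem qa_L0 (X E : A) (b : K) (h : E * E = 0) :
    E * (E * X - b • (X * E)) - (-1 * b) • ((E * X - b • (X * E)) * E) = 0 := by
  have e2 : ∀ x, E * (E * x) = 0 := by
    intro x; rw [← mul_assoc, h, zero_mul]
  simp only [sub_mul, smul_mul_assoc, mul_assoc, mul_sub, mul_smul_comm, smul_sub, e2, h, mul_zero, smul_zero]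
  module
end QAlg
section QRel
variable {K : Type} [Field K] {n : ℕ} {χ : Lam n → Lam n → Kˣ}

theorem ubrE_mk (a b : Lam n) (X Y : FA K n) :
    ubrE K n χ a b (RingQuot.mkAlgHom K (NRel K n χ) X) (RingQuot.mkAlgHom K (NRel K n χ) Y)
      = RingQuot.mkAlgHom K (NRel K n χ) (fbrE K n χ a b X Y) := by
  simp [ubrE, fbrE]

theorem αn_lt {t : ℕ} (h : t < 2 * n + 1) : αn n t = αr n ⟨t, h⟩ := by simp [αn, h]

theorem uEn_lt {t : ℕ} (h : t < 2 * n + 1) :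
    uEn K n χ t = RingQuot.mkAlgHom K (NRel K n χ) (fE K n ⟨t, h⟩) := by simp [uEn, h, uE]

theorem rel_SE1 (i j : ℕ) (hi : i < 2 * n + 1) (hj : j < 2 * n + 1) (h : Bfm n i j = 0) :
    ubrE K n χ (αn n i) (αn n j) (uEn K n χ i) (uEn K n χ j) = 0 := by
  simp only [uEn_lt hi, uEn_lt hj, αn_lt hi, αn_lt hj, ubrE_mk]
  rw [RingQuot.mkAlgHom_rel K (NRel.SE1 (χ := χ) ⟨i, hi⟩ ⟨j, hj⟩ h), map_zero]

theorem rel_SE2 (i j : ℕ) (hi : i < 2 * n + 1) (hj : j < 2 * n + 1) (hne : i ≠ j)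
    (h1 : -(2 * Bfm n i j) = Bfm n i i) (h2 : Bfm n i i ≠ 0) :
    ubrE K n χ (αn n i) (αn n i + αn n j) (uEn K n χ i)
      (ubrE K n χ (αn n i) (αn n j) (uEn K n χ i) (uEn K n χ j)) = 0 := by
  simp only [uEn_lt hi, uEn_lt hj, αn_lt hi, αn_lt hj, ubrE_mk]
  rw [RingQuot.mkAlgHom_rel K (NRel.SE2 (χ := χ) ⟨i, hi⟩ ⟨j, hj⟩ (by simpa using hne) h1 h2),
    map_zero]

theorem rel_SE3 (i j : ℕ) (hi : i < 2 * n + 1) (hj : j < 2 * n + 1) (hne : i ≠ j)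
    (h1 : -(Bfm n i j) = Bfm n i i) (h2 : Bfm n i i ≠ 0) :
    ubrE K n χ (αn n i) (αn n i + (αn n i + αn n j)) (uEn K n χ i)
      (ubrE K n χ (αn n i) (αn n i + αn n j) (uEn K n χ i)
      (ubrE K n χ (αn n i) (αn n j) (uEn K n χ i) (uEn K n χ j))) = 0 := by
  simp only [uEn_lt hi, uEn_lt hj, αn_lt hi, αn_lt hj, ubrE_mk]
  rw [RingQuot.mkAlgHom_rel K (NRel.SE3 (χ := χ) ⟨i, hi⟩ ⟨j, hj⟩ (by simpa using hne) h1 h2),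
    map_zero]

theorem rel_SE4 (i j k : ℕ) (hi : i < 2 * n + 1) (hj : j < 2 * n + 1) (hk : k < 2 * n + 1)
    (h1 : i ≠ j) (h2 : j ≠ k) (h3 : k ≠ i)
    (h4 : Bfm n i i = 0) (h5 : Bfm n j k = 0)
    (h6 : -(Bfm n i j) = Bfm n i k) (h7 : Bfm n i k ≠ 0) :
    ubrE K n χ (αn n i + αn n j) (αn n i + αn n k)
      (ubrE K n χ (αn n i) (αn n j) (uEn K n χ i) (uEn K n χ j))
      (ubrE K n χ (αn n i) (αn n k) (uEn K n χ i) (uEn K n χ k)) = 0 := by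
  simp only [uEn_lt hi, uEn_lt hj, αn_lt hi, αn_lt hj, uEn_lt hk, αn_lt hk, ubrE_mk]
  rw [RingQuot.mkAlgHom_rel K (NRel.SE4 (χ := χ) ⟨i, hi⟩ ⟨j, hj⟩ ⟨k, hk⟩ (by simpa using h1)
    (by simpa using h2) (by simpa using h3) h4 h5 h6 h7), map_zero]

/-- the weights as functions on naturals -/
def wN (n j t : ℕ) : ℤ :=
  if j = 0 then (if t = 0 then -2 else 0)
  else if j = 2 * n then (if t = 2 * n - 1 then 2 else 0)
  else (if t = j - 1 then 1 else 0) - (if t = j then 1 else 0)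

def dN (n t : ℕ) : ℤ := if t < n then 1 else -1

theorem Bfm_range (n i j : ℕ) : Bfm n i j = ∑ t ∈ Finset.range (2 * n), dN n t * wN n i t * wN n j t := by
  rw [Finset.sum_range]; rfl

theorem Bfm_last (n j : ℕ) (hn : 1 ≤ n) :
    Bfm n (2 * n) j = 2 * dN n (2 * n - 1) * wN n j (2 * n - 1) := by
  rw [Bfm_range, Finset.sum_eq_single (2 * n - 1)]
  · simp [wN, show n ≠ 0 by omega]; ring
  · intro b _ hb; simp [wN, show n ≠ 0 by omega, hb]
  · intro h; exact absurd (Finset.mem_range.2 (by omega)) h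

theorem Bfm_mid (n i j : ℕ) (hi : 1 ≤ i) (hi2 : i < 2 * n) :
    Bfm n i j = dN n (i - 1) * wN n j (i - 1) - dN n i * wN n j i := by
  rw [Bfm_range]
  have : ∀ t, dN n t * wN n i t * wN n j t =
      (if t = i - 1 then dN n t * wN n j t else 0) - (if t = i then dN n t * wN n j t else 0) := by
    intro t
    simp only [wN, show i ≠ 0 by omega, show i ≠ 2 * n by omega, if_false]
    split_ifs <;> omega
  simp only [this, Finset.sum_sub_distrib, Finset.sum_ite_eq', Finset.mem_range]
  rw [if_pos (by omega), if_pos hi2]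

theorem Bfm_far (n i j : ℕ) (hi : 1 ≤ i) (hi2 : i ≤ 2 * n) (hj : 1 ≤ j) (hj2 : j ≤ 2 * n)
    (h : i + 2 ≤ j ∨ j + 2 ≤ i) : Bfm n i j = 0 := by
  rcases Nat.lt_or_ge i (2 * n) with h2 | h2
  · rw [Bfm_mid n i j hi h2]; simp only [wN, dN]; split_ifs <;> omega
  · obtain rfl : i = 2 * n := by omega
    rw [Bfm_last n j (by omega)]; simp only [wN, dN]; split_ifs <;> omega

theorem Bfm_diag (n i : ℕ) (hi : 1 ≤ i) (hi2 : i ≤ 2 * n) :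
    Bfm n i i = if i < n then 2 else if i = n then 0 else if i < 2 * n then -2 else -4 := by
  rcases Nat.lt_or_ge i (2 * n) with h2 | h2
  · rw [Bfm_mid n i i hi h2]; simp only [wN, dN]; split_ifs <;> omega
  · obtain rfl : i = 2 * n := by omega
    rw [Bfm_last n _ (by omega)]; simp only [wN, dN]; split_ifs <;> omega

theorem Bfm_up (n i : ℕ) (hi : 1 ≤ i) (hi2 : i + 1 ≤ 2 * n) :
    Bfm n i (i + 1) = if i + 1 = 2 * n then 2 else if i < n then -1 else 1 := by
  rw [Bfm_mid n i _ hi (by omega)]; simp only [wN, dN]; split_ifs <;> first | omega | (norm_num; done) | (norm_num; omega)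

theorem Bfm_symm (n i j : ℕ) : Bfm n i j = Bfm n j i := by
  simp only [Bfm_range]; exact Finset.sum_congr rfl fun t _ => by ring

end QRel
section QBr
variable {K : Type} [Field K] {n : ℕ} {χ : Lam n → Lam n → Kˣ}

/-- vanishing of the bracket -/
def PB (χ : Lam n → Lam n → Kˣ) (a b : Lam n) (X Y : Unat K n χ) : Prop := ubrE K n χ a b X Y = 0

theorem PB_iff (a b : Lam n) (X Y : Unat K n χ) :
    PB χ a b X Y ↔ X * Y = (((χ b a)⁻¹ : Kˣ) : K) • (Y * X) := by
  rw [PB, ubrE, sub_eq_zero]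

theorem PB_commR (hχ2 : ∀ a b c : Lam n, χ a (b + c) = χ a b * χ a c)
    {l m v : Lam n} {X Y Z : Unat K n χ} (h1 : PB χ l v X Z) (h2 : PB χ m v Y Z) :
    PB χ (l + m) v (ubrE K n χ l m X Y) Z := by
  rw [PB_iff] at *
  rw [ubrE, qa_commR _ _ _ _ _ _ h1 h2, hχ2, mul_inv, Units.val_mul]

theorem PB_commL (hχ1 : ∀ a b c : Lam n, χ (a + b) c = χ a c * χ b c)
    {l m v : Lam n} {X Y Z : Unat K n χ} (h1 : PB χ l m X Y) (h2 : PB χ l v X Z) :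
    PB χ l (m + v) X (ubrE K n χ m v Y Z) := by
  rw [PB_iff] at *
  rw [ubrE, qa_commL _ _ _ _ _ _ h1 h2, hχ1, mul_inv, Units.val_mul]

theorem PB_jac (hχ1 : ∀ a b c : Lam n, χ (a + b) c = χ a c * χ b c)
    (hχ2 : ∀ a b c : Lam n, χ a (b + c) = χ a b * χ a c)
    {l m v : Lam n} {X Y Z : Unat K n χ} (h1 : PB χ l v X Z) :
    ubrE K n χ (l + m) v (ubrE K n χ l m X Y) Z = ubrE K n χ l (m + v) X (ubrE K n χ m v Y Z) := by
  rw [PB_iff] at *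
  simp only [ubrE, hχ1, hχ2, mul_inv, Units.val_mul]
  exact qa_jac _ _ _ _ _ _ h1

theorem PB_commJ (hχ1 : ∀ a b c : Lam n, χ (a + b) c = χ a c * χ b c)
    (hχ2 : ∀ a b c : Lam n, χ a (b + c) = χ a b * χ a c)
    {l m v : Lam n} {X Y Z : Unat K n χ} (h1 : PB χ l v X Z)
    (h2 : PB χ (m + v) v (ubrE K n χ m v Y Z) Z) :
    PB χ (l + m + v) v (ubrE K n χ (l + m) v (ubrE K n χ l m X Y) Z) Z := by
  rw [PB_jac hχ1 hχ2 h1, add_assoc]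
  exact PB_commR hχ2 h1 h2

theorem PB_commJ3 (hχ1 : ∀ a b c : Lam n, χ (a + b) c = χ a c * χ b c)
    (hχ2 : ∀ a b c : Lam n, χ a (b + c) = χ a b * χ a c)
    {l m v w : Lam n} {X a b c : Unat K n χ} (h1 : PB χ l v X b) (h1' : PB χ l w X c)
    (h2 : PB χ (m + v + w) v (ubrE K n χ (m + v) w (ubrE K n χ m v a b) c) b) :
    PB χ (l + m + v + w) v (ubrE K n χ (l + m + v) w (ubrE K n χ (l + m) v
      (ubrE K n χ l m X a) b) c) b := by
  rw [PB_jac hχ1 hχ2 h1, add_assoc l m v, PB_jac hχ1 hχ2 h1', add_assoc l]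
  exact PB_commR hχ2 h1 h2

theorem PB_even (hχ1 : ∀ a b c : Lam n, χ (a + b) c = χ a c * χ b c)
    (hχ2 : ∀ a b c : Lam n, χ a (b + c) = χ a b * χ a c)
    {l m v : Lam n} {a b c : Unat K n χ}
    (hs : χ m v * χ v m * χ m m = 1) (hbb : 1 + (((χ m m)⁻¹ : Kˣ) : K) ≠ 0)
    (h1 : PB χ l v a c)
    (h2 : PB χ (l + m) m (ubrE K n χ l m a b) b)
    (h3 : PB χ m (m + v) b (ubrE K n χ m v b c)) :
    PB χ (l + m + v) m (ubrE K n χ (l + m) v (ubrE K n χ l m a b) c) b := by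
  rw [PB_iff] at h1
  simp only [PB, ubrE, hχ1, hχ2, mul_inv, Units.val_mul] at *
  refine qa_even a b c _ _ _ _ _ ?_ hbb h1 h2 h3
  rw [← Units.val_mul, ← Units.val_mul, ← mul_inv, ← mul_inv, mul_comm (χ v m), hs]; simp

theorem PB_odd (hχ1 : ∀ a b c : Lam n, χ (a + b) c = χ a c * χ b c)
    (hχ2 : ∀ a b c : Lam n, χ a (b + c) = χ a b * χ a c)
    {l m v : Lam n} {a b c : Unat K n χ}
    (hs : χ l m * χ m l * (χ m v * χ v m) = 1) (hmm : χ m m = -1)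
    (h1 : PB χ l v a c) (hb : b * b = 0)
    (h2 : PB χ (m + l) (m + v) (ubrE K n χ m l b a) (ubrE K n χ m v b c)) :
    PB χ (l + m + v) m (ubrE K n χ (l + m) v (ubrE K n χ l m a b) c) b := by
  rw [PB_iff] at h1
  have hv : (((-1 : Kˣ)⁻¹ : Kˣ) : K) = -1 := by simp
  simp only [PB, ubrE, hχ1, hχ2, mul_inv, Units.val_mul, hmm, hv] at *
  refine qa_odd a b c _ (((χ l m)⁻¹ : Kˣ) : K) _ _ _ ?_ h1 hb ?_
  · rw [← Units.val_mul, ← Units.val_mul, ← Units.val_mul, ← mul_inv, ← mul_inv, ← mul_inv,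
      mul_comm (χ m l), mul_comm (χ v m), hs]; simp
  · rw [← h2]; congr 2; ring

theorem PB_cubic (hχ1 : ∀ a b c : Lam n, χ (a + b) c = χ a c * χ b c)
    (hχ2 : ∀ a b c : Lam n, χ a (b + c) = χ a b * χ a c)
    {l m v : Lam n} {X e f : Unat K n χ}
    (hs : χ m v * χ v m * χ m m ^ 2 = 1)
    (hbb : 1 + (((χ m m)⁻¹ : Kˣ) : K) + (((χ m m)⁻¹ : Kˣ) : K) ^ 2 ≠ 0)
    (h1 : PB χ l v X f)
    (h2 : PB χ (l + m) m (ubrE K n χ l m X e) e)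
    (h3 : PB χ m (m + (m + v)) e (ubrE K n χ m (m + v) e (ubrE K n χ m v e f))) :
    PB χ (l + m + v + m) m (ubrE K n χ (l + m + v) m
      (ubrE K n χ (l + m) v (ubrE K n χ l m X e) f) e) e := by
  rw [PB_iff] at h1
  simp only [PB, ubrE, hχ1, hχ2, mul_inv, Units.val_mul] at *
  refine qa_cubic X e f _ _ _ _ _ ?_ hbb h1 h2 h3 _ rfl _ rfl
  rw [← Units.val_mul, ← Units.val_pow_eq_pow_val, ← Units.val_mul, ← mul_inv, inv_pow,
    ← mul_inv, mul_comm (χ v m), hs]; simp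

theorem PB_R_even (hχ1 : ∀ a b c : Lam n, χ (a + b) c = χ a c * χ b c)
    (hχ2 : ∀ a b c : Lam n, χ a (b + c) = χ a b * χ a c)
    {m v : Lam n} {b c : Unat K n χ} (hs : χ m v * χ v m * χ m m = 1)
    (h3 : PB χ m (m + v) b (ubrE K n χ m v b c)) :
    PB χ (v + m) m (ubrE K n χ v m c b) b := by
  simp only [PB, ubrE, hχ1, hχ2, mul_inv, Units.val_mul] at *
  refine qa_LR _ _ _ _ _ ?_ h3
  rw [← Units.val_mul, ← Units.val_mul, ← mul_inv, ← mul_inv, mul_comm (χ v m), hs]; simp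

theorem PB_R_odd (hχ2 : ∀ a b c : Lam n, χ a (b + c) = χ a b * χ a c)
    {m v : Lam n} {b c : Unat K n χ} (hmm : χ m m = -1) (hb : b * b = 0) :
    PB χ (v + m) m (ubrE K n χ v m c b) b := by
  have hv : (((-1 : Kˣ)⁻¹ : Kˣ) : K) = -1 := by simp
  simp only [PB, ubrE, hχ2, mul_inv, Units.val_mul, hmm, hv] at *
  exact qa_R0 _ _ _ hb

theorem PB_L_odd (hχ1 : ∀ a b c : Lam n, χ (a + b) c = χ a c * χ b c)
    {m v : Lam n} {b c : Unat K n χ} (hmm : χ m m = -1) (hb : b * b = 0) :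
    PB χ m (m + v) b (ubrE K n χ m v b c) := by
  have hv : (((-1 : Kˣ)⁻¹ : Kˣ) : K) = -1 := by simp
  simp only [PB, ubrE, hχ1, mul_inv, Units.val_mul, hmm, hv] at *
  exact qa_L0 _ _ _ hb
end QBr
section QMain
variable {K : Type} [Field K] {n : ℕ} {χ : Lam n → Lam n → Kˣ}

/-- ordered adjacent pairs for which the quadratic Serre relation holds -/
def Adj (n m k : ℕ) : Prop := 1 ≤ m ∧ 1 ≤ k ∧ ((k = m + 1 ∧ m + 2 ≤ 2 * n) ∨ (m = k + 1 ∧ m ≤ 2 * n))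

/-- the facts on simple root vectors that are used -/
structure GoodQ (K : Type) [Field K] (n : ℕ) (χ : Lam n → Lam n → Kˣ) : Prop where
  hn : 2 ≤ n
  b1 : ∀ a b c : Lam n, χ (a + b) c = χ a c * χ b c
  b2 : ∀ a b c : Lam n, χ a (b + c) = χ a b * χ a c
  far : ∀ i j, 1 ≤ i → i ≤ 2 * n → 1 ≤ j → j ≤ 2 * n → (i + 2 ≤ j ∨ j + 2 ≤ i) →
    PB χ (αn n i) (αn n j) (uEn K n χ i) (uEn K n χ j)
  serL : ∀ m k, Adj n m k → PB χ (αn n m) (αn n m + αn n k) (uEn K n χ m)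
    (ubrE K n χ (αn n m) (αn n k) (uEn K n χ m) (uEn K n χ k))
  serR : ∀ m k, Adj n m k → PB χ (αn n k + αn n m) (αn n m)
    (ubrE K n χ (αn n k) (αn n m) (uEn K n χ k) (uEn K n χ m)) (uEn K n χ m)
  prod : ∀ m k, Adj n m k → m ≠ n →
    χ (αn n m) (αn n k) * χ (αn n k) (αn n m) * χ (αn n m) (αn n m) = 1
  ne : ∀ m, 1 ≤ m → m ≤ 2 * n → m ≠ n → 1 + (((χ (αn n m) (αn n m))⁻¹ : Kˣ) : K) ≠ 0
  odd : ∀ c k l, c = n → (k + 1 = c ∧ l = c + 1) ∨ (k = c + 1 ∧ l + 1 = c) →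
    PB χ (αn n k + αn n c + αn n l) (αn n c)
    (ubrE K n χ (αn n k + αn n c) (αn n l)
      (ubrE K n χ (αn n k) (αn n c) (uEn K n χ k) (uEn K n χ c)) (uEn K n χ l)) (uEn K n χ c)
  cub : ∀ m, m + 1 = 2 * n →
    χ (αn n m) (αn n (2 * n)) * χ (αn n (2 * n)) (αn n m) * χ (αn n m) (αn n m) ^ 2 = 1 ∧
    1 + (((χ (αn n m) (αn n m))⁻¹ : Kˣ) : K) + (((χ (αn n m) (αn n m))⁻¹ : Kˣ) : K) ^ 2 ≠ 0 ∧
    PB χ (αn n m) (αn n m + (αn n m + αn n (2 * n))) (uEn K n χ m)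
      (ubrE K n χ (αn n m) (αn n m + αn n (2 * n)) (uEn K n χ m)
        (ubrE K n χ (αn n m) (αn n (2 * n)) (uEn K n χ m) (uEn K n χ (2 * n))))

theorem degEM_one (i : ℕ) (_hi : 1 ≤ i) : degEM n i (i + 1) = αn n i := by simp [degEM]

theorem degEM_succ (i j : ℕ) (hij : i < j) : degEM n i (j + 1) = degEM n i j + αn n j := by
  obtain ⟨j, rfl⟩ : ∃ k, j = k + 1 := ⟨j - 1, by omega⟩
  simp only [degEM, Nat.add_sub_cancel]
  rw [Finset.sum_Icc_succ_top (by omega)]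

theorem degEP_top (i : ℕ) (hn : 1 ≤ n) : degEP n i (2 * n) = degEM n i (2 * n) + αn n (2 * n) := by
  simp [degEP, show 2 * n - 1 < 2 * n by omega]

theorem degEP_step (i j : ℕ) (hij : i < j) (hj : j + 1 ≤ 2 * n) :
    degEP n i j = degEP n i (j + 1) + αn n j := by
  simp only [degEP, degEM_succ i j hij]
  rw [← Finset.add_sum_Ioc_eq_sum_Icc (show j ≤ 2 * n - 1 by omega)]
  have : Finset.Ioc j (2 * n - 1) = Finset.Icc (j + 1) (2 * n - 1) := by
    ext; simp
  rw [this, smul_add, two_smul ℤ (αn n j)]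
  abel

theorem EM_one (i : ℕ) : EMrt K n χ i (i + 1) = uEn K n χ i := by
  simp [EMrt, EMseq]

theorem EM_succ (i j : ℕ) (hij : i < j) : EMrt K n χ i (j + 1) =
    ubrE K n χ (degEM n i j) (αn n j) (EMrt K n χ i j) (uEn K n χ j) := by
  obtain ⟨d, rfl⟩ : ∃ d, j = i + d + 1 := ⟨j - i - 1, by omega⟩
  simp only [EMrt, show i + d + 1 + 1 - i - 1 = d + 1 by omega, show i + d + 1 - i - 1 = d by omega,
    EMseq]

theorem EP_top (i : ℕ) : EPrt K n χ i (2 * n) =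
    ubrE K n χ (degEM n i (2 * n)) (αn n (2 * n)) (EMrt K n χ i (2 * n)) (uEn K n χ (2 * n)) := by
  simp [EPrt, EPseq]

theorem EP_step (i j : ℕ) (hj : j + 1 ≤ 2 * n) : EPrt K n χ i j =
    ubrE K n χ (degEP n i (j + 1)) (αn n j) (EPrt K n χ i (j + 1)) (uEn K n χ j) := by
  simp only [EPrt, show 2 * n - j = (2 * n - (j + 1)) + 1 by omega, EPseq]
  rw [show 2 * n - (2 * n - (j + 1)) = j + 1 by omega, show j + 1 - 1 = j by omega]

theorem EM_far (G : GoodQ K n χ) (i j k : ℕ) (hi : 1 ≤ i) (hij : i < j) (hj : j ≤ 2 * n) (hk : 1 ≤ k)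
    (hk2 : k ≤ 2 * n) (h : k + 1 < i ∨ j < k) :
    PB χ (degEM n i j) (αn n k) (EMrt K n χ i j) (uEn K n χ k) := by
  induction j, hij using Nat.le_induction with
  | base =>
    rw [Nat.succ_eq_add_one, degEM_one i hi, EM_one]
    exact G.far _ _ hi (by omega) hk hk2 (by omega)
  | succ j hij ih =>
    rw [degEM_succ i j hij, EM_succ i j hij]
    exact PB_commR G.b2 (ih (by omega) (by omega)) (G.far _ _ (by omega) (by omega) hk hk2 (by omega))

theorem EM_R (G : GoodQ K n χ) (i m : ℕ) (hi : 1 ≤ i) (hij : i < m) (hj : m + 1 ≤ 2 * n) :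
    PB χ (degEM n i (m + 1)) (αn n m) (EMrt K n χ i (m + 1)) (uEn K n χ m) := by
  obtain ⟨m, rfl⟩ : ∃ k, m = k + 1 := ⟨m - 1, by omega⟩
  rw [degEM_succ i _ hij, EM_succ i _ hij]
  rcases Nat.lt_or_ge i m with h | h
  · rw [degEM_succ i m h, EM_succ i m h]
    exact PB_commJ G.b1 G.b2 (EM_far G i m _ hi h (by omega) (by omega) (by omega) (by omega))
      (G.serR _ _ ⟨by omega, by omega, by omega⟩)
  · obtain rfl : i = m := by omega
    rw [degEM_one i hi, EM_one]
    exact G.serR _ _ ⟨by omega, by omega, by omega⟩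

theorem EM_mid (G : GoodQ K n χ) (i j k : ℕ) (hi : 1 ≤ i) (hk : i < k) (hkj : k + 2 ≤ j) (hj : j ≤ 2 * n) :
    PB χ (degEM n i j) (αn n k) (EMrt K n χ i j) (uEn K n χ k) := by
  induction j, hkj using Nat.le_induction with
  | base =>
    rw [show k + 2 = k + 1 + 1 by omega, degEM_succ i (k + 1) (by omega),
      EM_succ i (k + 1) (by omega), degEM_succ i k hk, EM_succ i k hk]
    by_cases hkn : k = n
    · obtain ⟨m, rfl⟩ : ∃ m, k = m + 1 := ⟨k - 1, by omega⟩
      have ho := G.odd (m + 1) m (m + 1 + 1) hkn (by omega)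
      rcases Nat.lt_or_ge i m with h | h
      · rw [degEM_succ i m h, EM_succ i m h]
        exact PB_commJ3 G.b1 G.b2
          (EM_far G i m _ hi h (by omega) (by omega) (by omega) (by omega))
          (EM_far G i m _ hi h (by omega) (by omega) (by omega) (by omega)) ho
      · obtain rfl : i = m := by omega
        rw [degEM_one i hi, EM_one]
        exact ho
    · refine PB_even G.b1 G.b2 (G.prod k (k + 1) ⟨by omega, by omega, by omega⟩ hkn)
        (G.ne k (by omega) (by omega) hkn)
        (EM_far G i k _ hi hk (by omega) (by omega) (by omega) (by omega)) ?_
        (G.serL k (k + 1) ⟨by omega, by omega, by omega⟩)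
      have := EM_R G i k hi hk (by omega)
      rwa [degEM_succ i k hk, EM_succ i k hk] at this
  | succ j hkj ih =>
    rw [degEM_succ i j (by omega), EM_succ i j (by omega)]
    exact PB_commR G.b2 (ih (by omega)) (G.far _ _ (by omega) (by omega) (by omega) (by omega) (by omega))

theorem EM_L (G : GoodQ K n χ) (i j : ℕ) (hi : 1 ≤ i) (hij : i + 2 ≤ j) (hj : j ≤ 2 * n) :
    PB χ (αn n i) (degEM n i j) (uEn K n χ i) (EMrt K n χ i j) := by
  induction j, hij using Nat.le_induction with
  | base =>
    rw [show i + 2 = i + 1 + 1 by omega, degEM_succ i (i + 1) (by omega),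
      EM_succ i (i + 1) (by omega), degEM_one i hi, EM_one]
    exact G.serL _ _ ⟨by omega, by omega, by omega⟩
  | succ j hij ih =>
    rw [degEM_succ i j (by omega), EM_succ i j (by omega)]
    exact PB_commL G.b1 (ih (by omega)) (G.far _ _ (by omega) (by omega) (by omega) (by omega) (by omega))

/-- downward propagation for `EP` -/
theorem EP_down (G : GoodQ K n χ) (i j b k : ℕ) (hij : i < j) (hjb : j ≤ b) (hb : b ≤ 2 * n) (hk : 1 ≤ k)
    (hk2 : k ≤ 2 * n)
    (h0 : PB χ (degEP n i b) (αn n k) (EPrt K n χ i b) (uEn K n χ k))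
    (hs : ∀ t, j ≤ t → t < b → t + 2 ≤ k ∨ k + 2 ≤ t) :
    PB χ (degEP n i j) (αn n k) (EPrt K n χ i j) (uEn K n χ k) := by
  induction hjb using Nat.decreasingInduction with
  | self => exact h0
  | of_succ t ht ih =>
    rw [degEP_step i t hij (by omega), EP_step i t (by omega)]
    exact PB_commR G.b2 (ih (by omega) (fun s hs1 hs2 => hs s (by omega) hs2))
      (G.far _ _ (by omega) (by omega) hk hk2 (hs t le_rfl (by omega)))

theorem EP_L (G : GoodQ K n χ) (i j : ℕ) (hi : 1 ≤ i) (hij : i + 2 ≤ j) (hj : j ≤ 2 * n) :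
    PB χ (αn n i) (degEP n i j) (uEn K n χ i) (EPrt K n χ i j) := by
  have hn := G.hn
  induction hj using Nat.decreasingInduction with
  | self =>
    rw [degEP_top i (by omega), EP_top]
    exact PB_commL G.b1 (EM_L G i _ hi (by omega) le_rfl)
      (G.far _ _ (by omega) (by omega) (by omega) (by omega) (by omega))
  | of_succ t ht ih =>
    rw [degEP_step i t (by omega) (by omega), EP_step i t (by omega)]
    exact PB_commL G.b1 (ih (by omega))
      (G.far _ _ (by omega) (by omega) (by omega) (by omega) (by omega))

theorem EP_mid (G : GoodQ K n χ) (i j k : ℕ) (hi : 1 ≤ i) (hk : i < k) (hkj : k + 2 ≤ j) (hj : j ≤ 2 * n) :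
    PB χ (degEP n i j) (αn n k) (EPrt K n χ i j) (uEn K n χ k) := by
  have hn := G.hn
  refine EP_down G i j (2 * n) k (by omega) hj le_rfl (by omega) (by omega) ?_ (by omega)
  rw [degEP_top i (by omega), EP_top]
  exact PB_commR G.b2 (EM_mid G i _ k hi hk (by omega) le_rfl)
    (G.far _ _ (by omega) (by omega) (by omega) (by omega) (by omega))

theorem EP_far (G : GoodQ K n χ) (i j k : ℕ) (hij : i < j) (hj : j ≤ 2 * n) (hk : 1 ≤ k) (hki : k + 1 < i) :
    PB χ (degEP n i j) (αn n k) (EPrt K n χ i j) (uEn K n χ k) := by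
  have hn := G.hn
  refine EP_down G i j (2 * n) k (by omega) hj le_rfl (by omega) (by omega) ?_ (by omega)
  rw [degEP_top i (by omega), EP_top]
  exact PB_commR G.b2 (EM_far G i _ k (by omega) (by omega) le_rfl hk (by omega) (by omega))
    (G.far _ _ (by omega) (by omega) (by omega) (by omega) (by omega))

theorem EP_c (G : GoodQ K n χ) (i j : ℕ) (hi : 1 ≤ i) (hij : i < j) (hj : j ≤ 2 * n) :
    PB χ (degEP n i j) (αn n j) (EPrt K n χ i j) (uEn K n χ j) := by
  have hn := G.hn
  obtain ⟨m, hm⟩ : ∃ m, m + 1 = 2 * n := ⟨2 * n - 1, by omega⟩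
  rcases Nat.lt_trichotomy j m with h | h | h
  · rw [degEP_step i j hij (by omega), EP_step i j (by omega),
      degEP_step i (j + 1) (by omega) (by omega), EP_step i (j + 1) (by omega)]
    exact PB_commJ G.b1 G.b2 (EP_mid G i _ j hi hij (by omega) (by omega))
      (G.serR _ _ ⟨by omega, by omega, by omega⟩)
  · subst h
    obtain ⟨c1, c2, c3⟩ := G.cub j hm
    have h2 := EM_R G i j hi hij (by omega)
    rw [degEP_step i j hij (by omega), EP_step i j (by omega), hm, degEP_top i (by omega), EP_top]
    have hd := degEM_succ (n := n) i j hij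
    have hE := EM_succ (K := K) (χ := χ) i j hij
    rw [hd, hE] at h2
    rw [hm] at hd hE
    rw [hd, hE]
    exact PB_cubic G.b1 G.b2 c1 c2
      (EM_far G i j _ hi hij (by omega) (by omega) (by omega) (by omega)) h2 c3
  · obtain rfl : j = 2 * n := by omega
    rw [degEP_top i (by omega), EP_top]
    rcases Nat.lt_or_ge i m with h' | h'
    · have hd := degEM_succ (n := n) i m h'
      have hE := EM_succ (K := K) (χ := χ) i m h'
      rw [hm] at hd hE
      rw [hd, hE]
      exact PB_commJ G.b1 G.b2
        (EM_far G i m _ hi h' (by omega) (by omega) (by omega) (by omega))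
        (G.serR _ _ ⟨by omega, by omega, by omega⟩)
    · obtain rfl : i = m := by omega
      have hd := degEM_one (n := n) i hi
      have hE := EM_one (K := K) (χ := χ) i
      rw [hm] at hd hE
      rw [hd, hE]
      exact G.serR _ _ ⟨by omega, by omega, by omega⟩

theorem EP_N (G : GoodQ K n χ) (i j : ℕ) (hi : 1 ≤ i) (hij : i < j) (hj : j < 2 * n) :
    PB χ (degEP n i j) (αn n (2 * n)) (EPrt K n χ i j) (uEn K n χ (2 * n)) := by
  have hn := G.hn
  obtain ⟨m, hm⟩ : ∃ m, m + 1 = 2 * n := ⟨2 * n - 1, by omega⟩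
  refine EP_down G i j m (2 * n) hij (by omega) (by omega) (by omega) (by omega) ?_ (by omega)
  have h1 := EM_R G i m hi (by omega) (by omega)
  have h2 := EP_c G i (2 * n) hi (by omega) le_rfl
  rw [degEP_top i (by omega), EP_top] at h2
  rw [degEP_step i m (by omega) (by omega), EP_step i m (by omega), hm,
    degEP_top i (by omega), EP_top]
  rw [hm] at h1
  have had : Adj n (2 * n) m := ⟨by omega, by omega, by omega⟩
  exact PB_even G.b1 G.b2 (G.prod _ _ had (by omega)) (G.ne _ (by omega) le_rfl (by omega)) h1 h2
    (G.serL _ _ had)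

theorem EP_hi (G : GoodQ K n χ) (i j k : ℕ) (hi : 1 ≤ i) (hij : i < j) (hjk : j < k) (hk : k < 2 * n) :
    PB χ (degEP n i j) (αn n k) (EPrt K n χ i j) (uEn K n χ k) := by
  have hn := G.hn
  obtain ⟨m, rfl⟩ : ∃ m, k = m + 1 := ⟨k - 1, by omega⟩
  refine EP_down G i j m (m + 1) hij (by omega) (by omega) (by omega) (by omega) ?_ (by omega)
  have h2 := EP_c G i (m + 1) hi (by omega) (by omega)
  rw [degEP_step i m (by omega) (by omega), EP_step i m (by omega)]
  rw [degEP_step i (m + 1) (by omega) (by omega), EP_step i (m + 1) (by omega)] at h2 ⊢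
  by_cases hkn : m + 1 = n
  · have ho := G.odd (m + 1) (m + 1 + 1) m hkn (by omega)
    rw [degEP_step i (m + 1 + 1) (by omega) (by omega), EP_step i (m + 1 + 1) (by omega)]
    exact PB_commJ3 G.b1 G.b2
      (EP_mid G i _ _ hi (by omega) (by omega) (by omega))
      (EP_mid G i _ _ hi (by omega) (by omega) (by omega)) ho
  · have had : Adj n (m + 1) m := ⟨by omega, by omega, by omega⟩
    exact PB_even G.b1 G.b2 (G.prod _ _ had hkn) (G.ne _ (by omega) (by omega) hkn)
      (EP_mid G i _ _ hi (by omega) (by omega) (by omega)) h2 (G.serL _ _ had)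

theorem goodQ_final (G : GoodQ K n χ) : ∀ i j : ℕ, 1 ≤ i → i < j → j ≤ 2 * n →
      (i + 2 ≤ j →
        ubrE K n χ (αn n i) (degEM n i j) (uEn K n χ i) (EMrt K n χ i j) = 0 ∧
        ubrE K n χ (αn n i) (degEP n i j) (uEn K n χ i) (EPrt K n χ i j) = 0) ∧
      (i + 2 ≤ j →
        ubrE K n χ (degEM n i j) (αn n (j - 1)) (EMrt K n χ i j) (uEn K n χ (j - 1)) = 0) ∧
      (ubrE K n χ (degEP n i j) (αn n j) (EPrt K n χ i j) (uEn K n χ j) = 0) ∧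
      (∀ k : ℕ, 1 ≤ k → k ≤ 2 * n →
        k ≠ i - 1 → k ≠ i → k ≠ j - 1 → k ≠ j →
        ubrE K n χ (degEM n i j) (αn n k) (EMrt K n χ i j) (uEn K n χ k) = 0 ∧
        ubrE K n χ (degEP n i j) (αn n k) (EPrt K n χ i j) (uEn K n χ k) = 0) := by
  intro i j hi hij hj
  refine ⟨fun h => ⟨EM_L G i j hi h hj, EP_L G i j hi h hj⟩, fun h => ?_, EP_c G i j hi hij hj,
    fun k hk hk2 h1 h2 h3 h4 => ⟨?_, ?_⟩⟩
  · obtain ⟨m, rfl⟩ : ∃ m, j = m + 1 := ⟨j - 1, by omega⟩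
    exact EM_R G i m hi (by omega) hj
  · by_cases h : i < k ∧ k < j
    · exact EM_mid G i j k hi h.1 (by omega) hj
    · exact EM_far G i j k hi hij hj hk hk2 (by omega)
  · rcases Nat.lt_or_ge k i with h | h
    · exact EP_far G i j k hij hj hk (by omega)
    · rcases Nat.lt_or_ge k j with h' | h'
      · exact EP_mid G i j k hi (by omega) (by omega) hj
      · rcases Nat.lt_or_ge k (2 * n) with h'' | h''
        · exact EP_hi G i j k hi hij (by omega) h''
        · obtain rfl : k = 2 * n := by omega
          exact EP_N G i j hi hij (by omega)
end QMain
section QFin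
variable {K : Type} [Field K]

theorem q_zpow_ne (q : Kˣ) (hq : ∀ m : ℕ, 0 < m → (q : K) ^ m ≠ 1) (z : ℤ) (hz : z ≠ 0) :
    ((q ^ z : Kˣ) : K) ≠ 1 := by
  intro h
  have h' : q ^ z = 1 := Units.ext (by simpa using h)
  have h2 : q ^ z.natAbs = 1 := by
    rcases Int.natAbs_eq z with e | e
    · rw [e, zpow_natCast] at h'; exact h'
    · rw [e, zpow_neg, zpow_natCast, inv_eq_one] at h'; exact h'
  exact hq z.natAbs (by omega) (by rw [← Units.val_pow_eq_pow_val, h2]; rfl)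

theorem mkGoodQ [CharZero K] (n : ℕ) (hn : 2 ≤ n)
    (q : Kˣ) (hq : ∀ m : ℕ, 0 < m → (q : K) ^ m ≠ 1)
    (χ : Lam n → Lam n → Kˣ)
    (hχ1 : ∀ a b c : Lam n, χ (a + b) c = χ a c * χ b c)
    (hχ2 : ∀ a b c : Lam n, χ a (b + c) = χ a b * χ a c)
    (hχd : ∀ i : Fin (2 * n + 1), Bfm n i i ≠ 0 → χ (αr n i) (αr n i) = q ^ (Bfm n i i))
    (hχ0 : ∀ i : Fin (2 * n + 1), Bfm n i i = 0 → ((χ (αr n i) (αr n i) : Kˣ) : K) = -1)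
    (hχij : ∀ i j : Fin (2 * n + 1), i ≠ j →
      χ (αr n i) (αr n j) * χ (αr n j) (αr n i) = q ^ (2 * Bfm n i j)) :
    GoodQ K n χ := by
  have far : ∀ i j, 1 ≤ i → i ≤ 2 * n → 1 ≤ j → j ≤ 2 * n → (i + 2 ≤ j ∨ j + 2 ≤ i) →
      PB χ (αn n i) (αn n j) (uEn K n χ i) (uEn K n χ j) := fun i j h1 h2 h3 h4 h5 =>
    rel_SE1 i j (by omega) (by omega) (Bfm_far n i j h1 h2 h3 h4 h5)
  have hdiag : ∀ m, 1 ≤ m → m ≤ 2 * n → m ≠ n →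
      Bfm n m m ≠ 0 ∧ χ (αn n m) (αn n m) = q ^ (Bfm n m m) := by
    intro m h1 h2 h3
    have h0 : Bfm n m m ≠ 0 := by rw [Bfm_diag n m h1 h2]; split_ifs <;> omega
    refine ⟨h0, ?_⟩
    rw [αn_lt (show m < 2 * n + 1 by omega)]
    exact hχd ⟨m, by omega⟩ h0
  have hdn : Bfm n n n = 0 := by rw [Bfm_diag n n (by omega) (by omega)]; simp
  have hnn : ∀ c, c = n → χ (αn n c) (αn n c) = -1 := by
    intro c hc
    apply Units.ext
    rw [αn_lt (show c < 2 * n + 1 by omega)]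
    rw [hχ0 ⟨c, by omega⟩ (by simpa [hc] using hdn)]; simp
  have hij : ∀ i j, i ≤ 2 * n → j ≤ 2 * n → i ≠ j →
      χ (αn n i) (αn n j) * χ (αn n j) (αn n i) = q ^ (2 * Bfm n i j) := by
    intro i j h1 h2 h3
    rw [αn_lt (show i < 2 * n + 1 by omega), αn_lt (show j < 2 * n + 1 by omega)]
    exact hχij ⟨i, by omega⟩ ⟨j, by omega⟩ (by simpa using h3)
  have hsq : ∀ c, c = n → uEn K n χ c * uEn K n χ c = 0 := by
    intro c hc
    have h := rel_SE1 (K := K) (χ := χ) c c (by omega) (by omega) (by rw [hc]; exact hdn)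
    rw [ubrE, hnn c hc] at h
    have h' : (2 : K) • (uEn K n χ c * uEn K n χ c) = 0 := by
      rw [← h]; simp; module
    exact (smul_eq_zero_iff_right (two_ne_zero)).1 h'
  have hadj : ∀ m k, Adj n m k → m ≠ n → 2 * Bfm n m k + Bfm n m m = 0 := by
    rintro m k ⟨h1, h2, ⟨rfl, h3⟩ | ⟨rfl, h3⟩⟩ hmn
    · rw [Bfm_up n m h1 (by omega), Bfm_diag n m h1 (by omega)]; split_ifs <;> omega
    · rw [Bfm_symm, Bfm_up n k h2 (by omega), Bfm_diag n _ h1 (by omega)]; split_ifs <;> omega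
  have prod : ∀ m k, Adj n m k → m ≠ n →
      χ (αn n m) (αn n k) * χ (αn n k) (αn n m) * χ (αn n m) (αn n m) = 1 := by
    intro m k h hmn
    have h' := h
    obtain ⟨h1, h2, h3⟩ := h'
    rw [hij m k (by omega) (by omega) (by omega), (hdiag m (by omega) (by omega) hmn).2,
      ← zpow_add, hadj m k h hmn, zpow_zero]
  have serL : ∀ m k, Adj n m k → PB χ (αn n m) (αn n m + αn n k) (uEn K n χ m)
      (ubrE K n χ (αn n m) (αn n k) (uEn K n χ m) (uEn K n χ k)) := by
    intro m k h
    by_cases hmn : m = n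
    · exact PB_L_odd hχ1 (hnn m hmn) (hsq m hmn)
    · have h' := h
      obtain ⟨h1, h2, h3⟩ := h'
      exact rel_SE2 m k (by omega) (by omega) (by omega) (by have := hadj m k h hmn; omega)
        (hdiag m (by omega) (by omega) hmn).1
  refine ⟨hn, hχ1, hχ2, far, serL, ?_, prod, ?_, ?_, ?_⟩
  · intro m k h
    by_cases hmn : m = n
    · exact PB_R_odd hχ2 (hnn m hmn) (hsq m hmn)
    · exact PB_R_even hχ1 hχ2 (prod m k h hmn) (serL m k h)
  · intro m h1 h2 h3 h
    obtain ⟨d0, d1⟩ := hdiag m h1 h2 h3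
    rw [d1, ← zpow_neg] at h
    refine q_zpow_ne q hq (-Bfm n m m * 2) (by omega) ?_
    rw [zpow_mul, show ((2 : ℤ)) = ((2 : ℕ) : ℤ) by rfl, zpow_natCast, Units.val_pow_eq_pow_val]
    linear_combination (((q ^ (-Bfm n m m) : Kˣ) : K) - 1) * h
  · intro c k l hc hkl
    have hB1 : Bfm n c k = if k < c then -1 else 1 := by
      rcases hkl with ⟨h1, h2⟩ | ⟨h1, h2⟩
      · subst h1; rw [Bfm_symm, Bfm_up n k (by omega) (by omega)]; split_ifs <;> omega
      · subst h1; rw [Bfm_up n c (by omega) (by omega)]; split_ifs <;> omega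
    have hB2 : Bfm n c l = if k < c then 1 else -1 := by
      rcases hkl with ⟨h1, h2⟩ | ⟨h1, h2⟩
      · subst h2; rw [Bfm_up n c (by omega) (by omega)]; split_ifs <;> omega
      · subst h2; rw [Bfm_symm, Bfm_up n l (by omega) (by omega)]; split_ifs <;> omega
    refine PB_odd hχ1 hχ2 ?_ (hnn c hc)
      (far k l (by omega) (by omega) (by omega) (by omega) (by omega)) (hsq c hc) ?_
    · rw [hij k c (by omega) (by omega) (by omega), hij c l (by omega) (by omega) (by omega),
        Bfm_symm n k c, ← zpow_add, hB1, hB2]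
      split_ifs <;> simp
    · refine rel_SE4 c k l (by omega) (by omega) (by omega) (by omega) (by omega) (by omega)
        (by rw [hc]; exact hdn)
        (Bfm_far n k l (by omega) (by omega) (by omega) (by omega) (by omega)) ?_ ?_
      · rw [hB1, hB2]; split_ifs <;> omega
      · rw [hB2]; split_ifs <;> omega
  · intro m hm
    have hB1 : Bfm n m (2 * n) = 2 := by
      rw [← hm, Bfm_up n m (by omega) (by omega), if_pos hm]
    have hB2 : Bfm n m m = -2 := by
      rw [Bfm_diag n m (by omega) (by omega), if_neg (by omega), if_neg (by omega),
        if_pos (by omega)]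
    obtain ⟨d0, d1⟩ := hdiag m (by omega) (by omega) (by omega)
    refine ⟨?_, ?_, ?_⟩
    · rw [hij m (2 * n) (by omega) le_rfl (by omega), d1, hB1, hB2, ← zpow_natCast, ← zpow_mul,
        ← zpow_add]
      norm_num
    · intro h
      rw [d1, hB2, ← zpow_neg] at h
      refine q_zpow_ne q hq (- -2 * 3) (by omega) ?_
      rw [zpow_mul, show ((3 : ℤ)) = ((3 : ℕ) : ℤ) by rfl, zpow_natCast, Units.val_pow_eq_pow_val]
      linear_combination (((q ^ (- -2 : ℤ) : Kˣ) : K) - 1) * h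
    · exact rel_SE3 m (2 * n) (by omega) (by omega) (by omega) (by rw [hB1, hB2]) d0
end QFin

/-- commutation properties of the root vectors `E_{ε_i−ε_j}` and
`E_{ε_i+ε_j}` of `U^♮_χ` (case of `sl^{(2)}(2n|2n)`). -/
theorem stmt18 (K : Type) [Field K] [CharZero K] (n : ℕ) (hn : 2 ≤ n)
    (q : Kˣ) (hq : ∀ m : ℕ, 0 < m → (q : K) ^ m ≠ 1)
    (χ : Lam n → Lam n → Kˣ)
    (hχ1 : ∀ a b c : Lam n, χ (a + b) c = χ a c * χ b c)
    (hχ2 : ∀ a b c : Lam n, χ a (b + c) = χ a b * χ a c)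
    (hχd : ∀ i : Fin (2 * n + 1), Bfm n i i ≠ 0 → χ (αr n i) (αr n i) = q ^ (Bfm n i i))
    (hχ0 : ∀ i : Fin (2 * n + 1), Bfm n i i = 0 → ((χ (αr n i) (αr n i) : Kˣ) : K) = -1)
    (hχij : ∀ i j : Fin (2 * n + 1), i ≠ j →
      χ (αr n i) (αr n j) * χ (αr n j) (αr n i) = q ^ (2 * Bfm n i j))
    (hχdd : χ (dr n) (dr n) = 1)
    (hχdi : ∀ i : Fin (2 * n + 1),
      χ (dr n) (αr n i) = q ^ (if (i : ℕ) = 0 then (1 : ℕ) else 0) ∧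
      χ (αr n i) (dr n) = q ^ (if (i : ℕ) = 0 then (1 : ℕ) else 0)) :
    ∀ i j : ℕ, 1 ≤ i → i < j → j ≤ 2 * n →
      (i + 2 ≤ j →
        ubrE K n χ (αn n i) (degEM n i j) (uEn K n χ i) (EMrt K n χ i j) = 0 ∧
        ubrE K n χ (αn n i) (degEP n i j) (uEn K n χ i) (EPrt K n χ i j) = 0) ∧
      (i + 2 ≤ j →
        ubrE K n χ (degEM n i j) (αn n (j - 1)) (EMrt K n χ i j) (uEn K n χ (j - 1)) = 0) ∧
      (ubrE K n χ (degEP n i j) (αn n j) (EPrt K n χ i j) (uEn K n χ j) = 0) ∧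
      (∀ k : ℕ, 1 ≤ k → k ≤ 2 * n →
        k ≠ i - 1 → k ≠ i → k ≠ j - 1 → k ≠ j →
        ubrE K n χ (degEM n i j) (αn n k) (EMrt K n χ i j) (uEn K n χ k) = 0 ∧
        ubrE K n χ (degEP n i j) (αn n k) (EPrt K n χ i j) (uEn K n χ k) = 0) := by
  exact goodQ_final (mkGoodQ n hn q hq χ hχ1 hχ2 hχd hχ0 hχij)
end
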